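/- Let r be any integer and let x ∈ F^r. Then either f_n(x) = 0 or f_n(x) ≡ 2−r (mod p−1). -/

import Mathlib

/-- Membership in the group `F^r`: `x ∈ F^×` such that for every `σ ∈ Gal(F/E)`,
`σ(x)·x^{-c_σ^r} ∈ F^{×p^n}`, where `c_σ` is the cyclotomic character value of `σ`
(encoded as a unit of `ZMod (p^n)`). -/
def memFr (p n : ℕ) (E : Type) {F : Type} [Field E] [Field F] [Algebra E F]
    (ζ : F) (r : ℤ) (x : F) : Prop :=
  x ≠ 0 ∧ ∀ (σ : F ≃ₐ[E] F) (u : (ZMod (p ^ n))ˣ),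
    σ ζ = ζ ^ ((u : ZMod (p ^ n)).val) →
      ∃ w : F, σ x * (x ^ (((u ^ r : (ZMod (p ^ n))ˣ) : ZMod (p ^ n)).val))⁻¹ = w ^ (p ^ n)

/-- `b` is a norm from `F(y)` down to `F`. -/
def isNormFrom {F : Type} [Field F] (y : AlgebraicClosure F) (b : F) : Prop :=
  ∃ z : IntermediateField.adjoin F {y}, Algebra.norm F z = b

/-- The set of integers `f ≥ 0` such that every unit `u` of `F` with `v(u-1) ≥ f`
is a norm from `F(y)`; its least element is the conductor of `F(y)/F`. -/
def condSet {F : Type} [Field F] (v : AddValuation F (WithTop ℤ))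
    (y : AlgebraicClosure F) : Set ℕ :=
  {f : ℕ | ∀ u : F, v u = 0 → ((f : ℤ) : WithTop ℤ) ≤ v (u - 1) → isNormFrom y u}

section ConductorHelpers

open Polynomial IntermediateField

set_option linter.unusedSectionVars false

section Basics

variable {p : ℕ} [Fact p.Prime] {Ω : Type*} [NormedField Ω] [NormedAlgebra ℚ_[p] Ω]
  [Algebra.IsAlgebraic ℚ_[p] Ω]

theorem norm_galois_apply [IsUltrametricDist Ω] (g : Gal(Ω/ℚ_[p])) (x : Ω) : ‖g x‖ = ‖x‖ := by
  rw [NormedAlgebra.norm_eq_spectralNorm ℚ_[p], NormedAlgebra.norm_eq_spectralNorm ℚ_[p],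
    ← spectralNorm_eq_of_equiv]

variable [IsAlgClosed Ω]

variable (p Ω) in
theorem isGalois_padic : IsGalois ℚ_[p] Ω where
  to_normal := by
    have : IsAlgClosure ℚ_[p] Ω := ⟨inferInstance, inferInstance⟩
    exact IsAlgClosure.normal ℚ_[p] Ω

theorem mem_adjoin_iff_fixed (S : Set Ω) (x : Ω) :
    x ∈ adjoin ℚ_[p] S ↔ ∀ g : Gal(Ω/ℚ_[p]), (∀ a ∈ S, g a = a) → g x = x := by
  have := isGalois_padic p Ω
  constructor
  · intro hx g hg
    have : adjoin ℚ_[p] S ≤ fixedField (Subgroup.zpowers g) := by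
      rw [adjoin_le_iff]
      intro a ha
      rw [SetLike.mem_coe, mem_fixedField_iff]
      intro f hf
      have hf' : f ∈ MulAction.stabilizer (Gal(Ω/ℚ_[p])) a :=
        (Subgroup.zpowers_le.2 (show g ∈ MulAction.stabilizer (Gal(Ω/ℚ_[p])) a from hg a ha)) hf
      exact hf'
    exact (mem_fixedField_iff _ _).1 (this hx) g (Subgroup.mem_zpowers g)
  · intro h
    rw [← InfiniteGalois.fixedField_fixingSubgroup (adjoin ℚ_[p] S), mem_fixedField_iff]
    intro g hg
    exact h g fun a ha => (mem_fixingSubgroup_iff _ _).1 hg a (subset_adjoin _ _ ha)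

theorem mem_iff_fixed (K : IntermediateField ℚ_[p] Ω) (x : Ω) :
    x ∈ K ↔ ∀ g : Gal(Ω/ℚ_[p]), (∀ a ∈ K, g a = a) → g x = x := by
  conv_lhs => rw [← adjoin_self ℚ_[p] K]
  rw [mem_adjoin_iff_fixed]
  rfl

theorem galois_mem_adjoin (g : Gal(Ω/ℚ_[p])) {S : Set Ω} {K : IntermediateField ℚ_[p] Ω}
    (h : ∀ a ∈ S, g a ∈ K) {x : Ω} (hx : x ∈ adjoin ℚ_[p] S) : g x ∈ K := by
  have : adjoin ℚ_[p] S ≤ K.comap (g : Ω →ₐ[ℚ_[p]] Ω) := adjoin_le_iff.2 h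
  exact this hx

theorem galois_eqOn_adjoin {g h : Gal(Ω/ℚ_[p])} {S : Set Ω}
    (H : ∀ a ∈ S, g a = h a) {x : Ω} (hx : x ∈ adjoin ℚ_[p] S) : g x = h x := by
  have := (mem_adjoin_iff_fixed S x).1 hx (h⁻¹ * g) (fun a ha => by
    rw [AlgEquiv.mul_apply, H a ha]; exact h.symm_apply_apply a)
  rw [AlgEquiv.mul_apply] at this
  calc g x = h (h⁻¹ (g x)) := (h.apply_symm_apply _).symm
    _ = h x := by rw [this]

/-- Hilbert's Theorem 90 for an automorphism of `Ω` acting with finite order on a subfield. -/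
theorem exists_eq_mul_of_prod_eq_one (A : IntermediateField ℚ_[p] Ω) (g : Gal(Ω/ℚ_[p]))
    (hA : ∀ a ∈ A, g a ∈ A) {d : ℕ} (hd : ∀ a ∈ A, (g ^ d) a = a) {θ : Ω} (hθ : θ ∈ A)
    (hinj : Set.InjOn (fun i : ℕ => (g ^ i) θ) (Set.Iio d)) (hd0 : 0 < d)
    {c : Ω} (hc : c ∈ A) (hprod : ∏ i ∈ Finset.range d, (g ^ i) c = 1) :
    ∃ β ∈ A, β ≠ 0 ∧ g β = β * c := by
  have hpow : ∀ i : ℕ, ∀ a ∈ A, (g ^ i) a ∈ A := by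
    intro i
    induction i with
    | zero => intro a ha; simpa using ha
    | succ i ih => intro a ha; rw [pow_succ, AlgEquiv.mul_apply]; exact ih _ (hA a ha)
  let C : ℕ → Ω := fun i => ∏ j ∈ Finset.range i, (g ^ j) c
  have hC0 : C 0 = 1 := by simp [C]
  have hCd : C d = 1 := hprod
  have hCs : ∀ i, c * g (C i) = C (i + 1) := by
    intro i
    simp only [C, map_prod, Finset.prod_range_succ', pow_zero, AlgEquiv.one_apply]
    rw [mul_comm]
    congr 1
    refine Finset.prod_congr rfl fun j _ => ?_
    rw [pow_succ', AlgEquiv.mul_apply]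
  have hCA : ∀ i, C i ∈ A := fun i => prod_mem fun j _ => hpow j c hc
  let f : Fin d → (A →* Ω) := fun i =>
    ((g ^ (i : ℕ) : Gal(Ω/ℚ_[p])) : Ω →* Ω).comp (A.val : A →* Ω)
  have hf : Function.Injective f := by
    intro i j hij
    have := DFunLike.congr_fun hij ⟨θ, hθ⟩
    exact Fin.ext (hinj i.2 j.2 this)
  have hli := (linearIndependent_monoidHom A Ω).comp f hf
  have hex : ∃ t : A, ∑ i ∈ Finset.range d, C i * (g ^ i) t ≠ 0 := by
    by_contra! hcon
    have := Fintype.linearIndependent_iff.1 hli (fun i => C i) (by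
      ext t
      have := hcon t
      rw [Finset.sum_range] at this
      simpa [f] using this) ⟨0, hd0⟩
    simp [hC0] at this
  obtain ⟨t, ht⟩ := hex
  set γ := ∑ i ∈ Finset.range d, C i * (g ^ i) (t : Ω) with hγ
  have hγA : γ ∈ A := sum_mem fun i _ => mul_mem (hCA i) (hpow i _ t.2)
  have hkey : c * g γ = γ := by
    obtain ⟨e, rfl⟩ : ∃ e, d = e + 1 := ⟨d - 1, by omega⟩
    rw [hγ, map_sum, Finset.mul_sum, Finset.sum_range_succ, Finset.sum_range_succ' _ e]
    have h1 : ∀ i, c * g (C i * (g ^ i) (t : Ω)) = C (i + 1) * (g ^ (i + 1)) (t : Ω) := by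
      intro i
      rw [map_mul, ← mul_assoc, hCs, pow_succ', AlgEquiv.mul_apply]
    simp only [h1]
    rw [hCd, hC0, hd _ t.2]
    simp
  have hc0 : c ≠ 0 := by
    rintro rfl
    simp at hkey
    exact ht hkey.symm
  refine ⟨γ⁻¹, inv_mem hγA, inv_ne_zero ht, ?_⟩
  rw [map_inv₀]
  have hg0 : g γ ≠ 0 := by simpa using ht
  rw [eq_inv_mul_iff_mul_eq₀ ht, mul_inv_eq_iff_eq_mul₀ hg0]
  exact hkey.symm

end Basics

section Ultrametric

variable {Ω : Type*} [NormedField Ω] [IsUltrametricDist Ω]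

theorem norm_add_lt_of_lt {x y : Ω} {r : ℝ} (hx : ‖x‖ < r) (hy : ‖y‖ < r) : ‖x + y‖ < r :=
  (IsUltrametricDist.norm_add_le_max x y).trans_lt (max_lt hx hy)

theorem norm_add_le_of_le_of_le {x y : Ω} {r : ℝ} (hx : ‖x‖ ≤ r) (hy : ‖y‖ ≤ r) : ‖x + y‖ ≤ r :=
  (IsUltrametricDist.norm_add_le_max x y).trans (max_le hx hy)

theorem norm_sub_lt_of_lt {x y : Ω} {r : ℝ} (hx : ‖x‖ < r) (hy : ‖y‖ < r) : ‖x - y‖ < r := by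
  rw [sub_eq_add_neg]; exact norm_add_lt_of_lt hx (by rwa [norm_neg])

theorem norm_sub_le_of_le_of_le {x y : Ω} {r : ℝ} (hx : ‖x‖ ≤ r) (hy : ‖y‖ ≤ r) : ‖x - y‖ ≤ r := by
  rw [sub_eq_add_neg]; exact norm_add_le_of_le_of_le hx (by rwa [norm_neg])

theorem norm_eq_of_norm_sub_lt {x y : Ω} (h : ‖x - y‖ < ‖y‖) : ‖x‖ = ‖y‖ := by
  have := IsUltrametricDist.norm_add_eq_max_of_norm_ne_norm (x := x - y) (y := y) h.ne
  rw [sub_add_cancel, max_eq_right h.le] at this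
  exact this

theorem norm_eq_one_of_norm_sub_lt {x : Ω} (h : ‖x - 1‖ < 1) : ‖x‖ = 1 := by
  have := norm_eq_of_norm_sub_lt (x := x) (y := 1) (by simpa using h)
  simpa using this

theorem norm_mul_sub_one_le {x y : Ω} {r : ℝ} (h1 : ‖y‖ ≤ 1) (hx : ‖x - 1‖ ≤ r) (hy : ‖y - 1‖ ≤ r) :
    ‖x * y - 1‖ ≤ r := by
  have : x * y - 1 = (x - 1) * y + (y - 1) := by ring
  rw [this]
  refine norm_add_le_of_le_of_le ?_ hy
  rw [norm_mul]
  exact (mul_le_of_le_one_right (norm_nonneg _) h1).trans hx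

theorem norm_pow_sub_one_le {x : Ω} (h : ‖x‖ ≤ 1) (i : ℕ) : ‖x ^ i - 1‖ ≤ ‖x - 1‖ := by
  induction i with
  | zero => simp
  | succ i ih => rw [pow_succ]; exact norm_mul_sub_one_le h ih le_rfl

theorem norm_prod_sub_one_le {ι : Type*} (s : Finset ι) (f : ι → Ω) {r : ℝ} (hr : 0 ≤ r)
    (h1 : ∀ i ∈ s, ‖f i‖ ≤ 1) (h : ∀ i ∈ s, ‖f i - 1‖ ≤ r) : ‖∏ i ∈ s, f i - 1‖ ≤ r := by
  classical
  induction s using Finset.induction_on with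
  | empty => simpa using hr
  | insert a s ha ih =>
    rw [Finset.prod_insert ha]
    refine norm_mul_sub_one_le ?_ (h a (by simp)) (ih (fun i hi => h1 i (by simp [hi]))
      fun i hi => h i (by simp [hi]))
    rw [norm_prod]
    exact Finset.prod_le_one (fun i _ => norm_nonneg _) fun i hi => h1 i (by simp [hi])

variable (Ω) in
/-- The closed unit ball of an ultrametric normed field. -/
def unitBall : Subring Ω where
  carrier := {x | ‖x‖ ≤ 1}
  mul_mem' {a b} ha hb := by
    simp only [Set.mem_ofPred_eq, norm_mul] at *
    exact mul_le_one₀ ha (norm_nonneg _) hb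
  one_mem' := by simp
  add_mem' ha hb := norm_add_le_of_le_of_le ha hb
  zero_mem' := by simp
  neg_mem' := by simp

theorem mem_unitBall {x : Ω} : x ∈ unitBall Ω ↔ ‖x‖ ≤ 1 := Iff.rfl

variable (Ω) in
/-- The open unit ball, as an ideal of the closed one. -/
def openUnitBall : Ideal (unitBall Ω) where
  carrier := {x | ‖(x : Ω)‖ < 1}
  add_mem' ha hb := by simpa using norm_add_lt_of_lt ha hb
  zero_mem' := by simp
  smul_mem' c x hx := by
    simp only [Set.mem_ofPred_eq, smul_eq_mul, Subring.coe_mul, norm_mul] at *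
    exact mul_lt_one_of_nonneg_of_lt_one_right c.2 (norm_nonneg _) hx

theorem mem_openUnitBall {x : unitBall Ω} : x ∈ openUnitBall Ω ↔ ‖(x : Ω)‖ < 1 := Iff.rfl

instance : (openUnitBall Ω).IsMaximal := by
  rw [Ideal.isMaximal_iff]
  refine ⟨by simp [mem_openUnitBall], fun J x _ hx hxJ => ?_⟩
  rw [mem_openUnitBall, not_lt] at hx
  have h1 : ‖(x : Ω)‖ = 1 := le_antisymm x.2 hx
  have hx0 : (x : Ω) ≠ 0 := by rintro h; simp [h] at h1
  have := J.mul_mem_left ⟨(x : Ω)⁻¹, by rw [mem_unitBall, norm_inv, h1]; simp⟩ hxJ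
  convert this
  exact Subtype.ext (inv_mul_cancel₀ hx0).symm

theorem exists_one_add_pow_prime {q : ℕ} (hq : q.Prime) {z : Ω} (hz : ‖z‖ ≤ 1) :
    ∃ w : Ω, ‖w‖ ≤ 1 ∧ (1 + z) ^ q = 1 + z ^ q + q * z * w := by
  obtain ⟨r, hr⟩ := exists_add_pow_prime_eq hq (1 : unitBall Ω) ⟨z, hz⟩
  refine ⟨r, r.2, ?_⟩
  have := congrArg (Subtype.val) hr
  simpa using this

/-- The product expansion `∏ (1 + x i) = 1 + ∑ x i` up to quadratic terms. -/
theorem norm_prod_one_add_sub_le {ι : Type*} (s : Finset ι) (f : ι → Ω) {r : ℝ} (hr : r ≤ 1)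
    (hr0 : 0 ≤ r) (h : ∀ i ∈ s, ‖f i‖ ≤ r) :
    ‖∏ i ∈ s, (1 + f i) - (1 + ∑ i ∈ s, f i)‖ ≤ r ^ 2 := by
  classical
  induction s using Finset.induction_on with
  | empty => simp; positivity
  | insert a s ha ih =>
    rw [Finset.prod_insert ha, Finset.sum_insert ha]
    have ih' := ih (fun i hi => h i (by simp [hi]))
    have h0 := h a (by simp)
    have : (1 + f a) * ∏ i ∈ s, (1 + f i) - (1 + (f a + ∑ i ∈ s, f i)) =
      (∏ i ∈ s, (1 + f i) - (1 + ∑ i ∈ s, f i)) + f a * (∏ i ∈ s, (1 + f i) - 1) := by ring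
    rw [this]
    refine norm_add_le_of_le_of_le ih' ?_
    rw [norm_mul, sq]
    refine mul_le_mul h0 ?_ (norm_nonneg _) hr0
    refine norm_prod_sub_one_le _ _ hr0 (fun i hi => ?_) fun i hi => ?_
    · exact norm_add_le_of_le_of_le (by simp) ((h i (by simp [hi])).trans hr)
    · simpa using h i (by simp [hi])

end Ultrametric

section Tame

variable {p : ℕ} [hp : Fact p.Prime] {Ω : Type*} [NormedField Ω] [NormedAlgebra ℚ_[p] Ω]
  [IsUltrametricDist Ω]

variable (Ω) in
theorem norm_prime_eq : ‖(p : Ω)‖ = (p : ℝ)⁻¹ := by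
  have := norm_algebraMap' Ω (p : ℚ_[p])
  rw [map_natCast] at this
  rw [this, Padic.norm_p]

variable (p Ω) in
theorem norm_prime_lt_one : ‖(p : Ω)‖ < 1 := by
  rw [norm_prime_eq]
  exact inv_lt_one_of_one_lt₀ (by exact_mod_cast hp.out.one_lt)

variable (p Ω) in
theorem norm_prime_pos : 0 < ‖(p : Ω)‖ := by
  rw [norm_prime_eq]
  exact inv_pos.2 (by exact_mod_cast hp.out.pos)

variable (p) in
theorem norm_natCast_of_not_dvd {N : ℕ} (hN : ¬ p ∣ N) : ‖(N : Ω)‖ = 1 := by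
  have := norm_algebraMap' Ω (N : ℚ_[p])
  rw [map_natCast] at this
  rw [this, Padic.norm_natCast_eq_one_iff]
  exact (Nat.Prime.coprime_iff_not_dvd hp.out).2 hN

variable (p) in
theorem norm_pow_sub_one_of_not_dvd {u : Ω} (hu : ‖u - 1‖ < 1) {N : ℕ} (hN : ¬ p ∣ N) :
    ‖u ^ N - 1‖ = ‖u - 1‖ := by
  have h1 := norm_eq_one_of_norm_sub_lt hu
  have : ‖∑ i ∈ Finset.range N, u ^ i‖ = 1 := by
    rw [← norm_natCast_of_not_dvd p (Ω := Ω) hN]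
    apply norm_eq_of_norm_sub_lt
    rw [norm_natCast_of_not_dvd p hN]
    have : ∑ i ∈ Finset.range N, u ^ i - N = ∑ i ∈ Finset.range N, (u ^ i - 1) := by
      simp
    rw [this]
    exact (IsUltrametricDist.norm_sum_le_of_forall_le_of_nonneg (norm_nonneg _)
      fun i _ => norm_pow_sub_one_le h1.le i).trans_lt hu
  rw [← geom_sum_mul, norm_mul, this, one_mul]

variable (p Ω) in
/-- The roots of unity of order prime to `p`. -/
def tameRoots : Set Ω := {τ | ∃ N : ℕ, ¬ p ∣ N ∧ τ ^ N = 1}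

theorem tameRoots_norm {τ : Ω} (h : τ ∈ tameRoots p Ω) : ‖τ‖ = 1 := by
  obtain ⟨N, hN, h⟩ := h
  have : ‖τ‖ ^ N = 1 := by rw [← norm_pow, h, norm_one]
  exact (pow_eq_one_iff_of_nonneg (norm_nonneg _) (by rintro rfl; simp at hN)).1 this

theorem tameRoots_one : (1 : Ω) ∈ tameRoots p Ω :=
  ⟨1, hp.out.one_lt.ne' ∘ Nat.dvd_one.1, by simp⟩

theorem tameRoots_mul {τ τ' : Ω} (h : τ ∈ tameRoots p Ω) (h' : τ' ∈ tameRoots p Ω) :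
    τ * τ' ∈ tameRoots p Ω := by
  obtain ⟨N, hN, h⟩ := h
  obtain ⟨N', hN', h'⟩ := h'
  refine ⟨N * N', fun h => (hp.out.dvd_mul.1 h).elim hN hN', ?_⟩
  rw [mul_pow, pow_mul, h, mul_comm N, pow_mul, h']; simp

theorem tameRoots_inv {τ : Ω} (h : τ ∈ tameRoots p Ω) : τ⁻¹ ∈ tameRoots p Ω := by
  obtain ⟨N, hN, h⟩ := h
  exact ⟨N, hN, by rw [inv_pow, h, inv_one]⟩

theorem tameRoots_pow {τ : Ω} (h : τ ∈ tameRoots p Ω) (i : ℕ) : τ ^ i ∈ tameRoots p Ω := by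
  obtain ⟨N, hN, h⟩ := h
  exact ⟨N, hN, by rw [← pow_mul, mul_comm, pow_mul, h, one_pow]⟩

theorem tameRoots_map {τ : Ω} (h : τ ∈ tameRoots p Ω) (g : Gal(Ω/ℚ_[p])) :
    g τ ∈ tameRoots p Ω := by
  obtain ⟨N, hN, h⟩ := h
  exact ⟨N, hN, by rw [← map_pow, h, map_one]⟩

theorem tameRoots_ne_zero {τ : Ω} (h : τ ∈ tameRoots p Ω) : τ ≠ 0 := by
  rintro rfl
  simpa using tameRoots_norm h

theorem tameRoots_eq_one {τ : Ω} (h : τ ∈ tameRoots p Ω) (h1 : ‖τ - 1‖ < 1) : τ = 1 := by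
  obtain ⟨N, hN, h⟩ := h
  have := norm_pow_sub_one_of_not_dvd p h1 hN
  rw [h, sub_self, norm_zero] at this
  exact sub_eq_zero.1 (norm_eq_zero.1 this.symm)

theorem tameRoots_eq {τ τ' : Ω} (h : τ ∈ tameRoots p Ω) (h' : τ' ∈ tameRoots p Ω)
    (h1 : ‖τ - τ'‖ < 1) : τ = τ' := by
  have h0 := tameRoots_ne_zero h'
  have := tameRoots_eq_one (tameRoots_mul h (tameRoots_inv h')) (by
    have e : τ * τ'⁻¹ - 1 = (τ - τ') * τ'⁻¹ := by field_simp
    rw [e, norm_mul, tameRoots_norm (tameRoots_inv h'), mul_one]; exact h1)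
  field_simp at this
  exact this

theorem tameRoots_exists_pth_root {τ : Ω} (h : τ ∈ tameRoots p Ω) :
    ∃ τ' ∈ tameRoots p Ω, τ' ^ p = τ := by
  have h' := h
  obtain ⟨N, hN, h⟩ := h
  have hcop : Nat.Coprime p N := (Nat.Prime.coprime_iff_not_dvd hp.out).2 hN
  have hN0 : N ≠ 0 := by rintro rfl; simp at hN
  rcases eq_or_ne N 1 with rfl | hN1
  · exact ⟨1, tameRoots_one, by simpa using h.symm⟩
  obtain ⟨m, hm⟩ := Nat.exists_mul_mod_eq_one_of_coprime hcop (by omega)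
  refine ⟨τ ^ m, tameRoots_pow h' m, ?_⟩
  rw [← pow_mul, mul_comm, ← Nat.div_add_mod (p * m) N, pow_add, pow_mul, h, hm.2]; simp

variable (p) in
theorem charZero_padic_algebra (_ : NormedAlgebra ℚ_[p] Ω) : CharZero Ω := by
  have : Function.Injective (algebraMap ℚ_[p] Ω) := (algebraMap ℚ_[p] Ω).injective
  exact charZero_of_injective_algebraMap this

end Tame

section Residue

variable {p : ℕ} [hp : Fact p.Prime] {Ω : Type*} [NormedField Ω] [NormedAlgebra ℚ_[p] Ω]
  [IsUltrametricDist Ω]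

theorem charP_residue : CharP (unitBall Ω ⧸ openUnitBall Ω) p := by
  refine (CharP.charP_iff_prime_eq_zero hp.out).2 ?_
  rw [← map_natCast (Ideal.Quotient.mk (openUnitBall Ω)), Ideal.Quotient.eq_zero_iff_mem,
    mem_openUnitBall]
  simpa using norm_prime_lt_one p Ω

/-- The conjugates of a root of unity of order prime to `p` over `ℚ_p` are its `p`-power powers. -/
theorem exists_galois_eq_pow [Algebra.IsAlgebraic ℚ_[p] Ω] {τ : Ω} (hτ : τ ∈ tameRoots p Ω)
    (h : Gal(Ω/ℚ_[p])) : ∃ i : ℕ, h τ = τ ^ p ^ i := by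
  classical
  obtain ⟨N, hN, hτN⟩ := id hτ
  have hτ' : ∀ a : Ω, a ^ N = 1 → ‖a‖ ≤ 1 := fun a ha => (tameRoots_norm (p := p) ⟨N, hN, ha⟩).le
  let _ := Ideal.Quotient.field (openUnitBall Ω)
  have : CharP (unitBall Ω ⧸ openUnitBall Ω) p := charP_residue
  let red := Ideal.Quotient.mk (openUnitBall Ω)
  have hred : ∀ a, red a = 0 ↔ ‖(a : Ω)‖ < 1 := fun a => by
    rw [Ideal.Quotient.eq_zero_iff_mem, mem_openUnitBall]
  let t : unitBall Ω := ⟨τ, hτ' τ hτN⟩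
  have ht : t ^ N = 1 := Subtype.ext (by simpa using hτN)
  -- a period of the Frobenius on `τ`
  have hcop : Nat.Coprime p N := (Nat.Prime.coprime_iff_not_dvd hp.out).2 hN
  have hd : t ^ p ^ N.totient = t := by
    have := Nat.ModEq.pow_totient hcop
    have h2 : t ^ (p ^ N.totient) = t ^ (p ^ N.totient % N) := by
      conv_lhs => rw [← Nat.div_add_mod (p ^ N.totient) N, pow_add, pow_mul, ht, one_pow, one_mul]
    rw [h2, this, ← pow_mod_orderOf]
    have h3 : orderOf t ∣ N := orderOf_dvd_of_pow_eq_one ht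
    rw [Nat.mod_mod_of_dvd _ h3, pow_mod_orderOf, pow_one]
  set d := N.totient
  have hd0 : d ≠ 0 := (Nat.totient_pos.2 (Nat.pos_of_ne_zero (by rintro rfl; simp at hN))).ne'
  let f : ℕ → (unitBall Ω ⧸ openUnitBall Ω)[X] := fun i => X - C (red t ^ p ^ i)
  let P : (unitBall Ω ⧸ openUnitBall Ω)[X] := ∏ i ∈ Finset.range d, f i
  have hP : P.map (frobenius _ p) = P := by
    have h1 : P.map (frobenius _ p) = ∏ i ∈ Finset.range d, f (i + 1) := by
      simp only [P, f, Polynomial.map_prod, Polynomial.map_sub, map_X, map_C, frobenius_def,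
        ← pow_mul, pow_succ]
    have h2 : f d = f 0 := by simp only [f, ← map_pow, hd, pow_zero, pow_one]
    have h3 := Finset.prod_range_succ f d
    rw [Finset.prod_range_succ', h2] at h3
    rw [h1]
    exact mul_right_cancel₀ (X_sub_C_ne_zero _) h3
  have hlift : P ∈ lifts (Int.castRingHom (unitBall Ω ⧸ openUnitBall Ω)) := by
    rw [lifts_iff_coeff_lifts]
    intro n
    have h1 : P.coeff n ^ p = P.coeff n := by
      conv_rhs => rw [← hP]
      rw [coeff_map, frobenius_def]
    obtain ⟨m, hm⟩ := (mem_bot_iff_intCast p _).1 ((Subfield.mem_bot_iff_pow_eq_self _ p).2 h1)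
    exact ⟨m, hm⟩
  obtain ⟨Q, hQ⟩ := (mem_lifts _).1 hlift
  have key : ∀ s : unitBall Ω, P.eval (red s) = 0 ↔ ‖aeval (s : Ω) Q‖ < 1 := by
    intro s
    have : aeval (s : Ω) Q = ((aeval s Q : unitBall Ω) : Ω) := by
      rw [← Subring.coe_subtype, aeval_def, aeval_def, hom_eval₂]
      congr! 1
    rw [this, ← hred, ← hQ, eval_map, aeval_def, hom_eval₂]
    congr! 2
  have h0 : P.eval (red t) = 0 := by
    rw [eval_prod]
    exact Finset.prod_eq_zero (Finset.mem_range.2 (Nat.pos_of_ne_zero hd0)) (by simp [f])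
  have hh : (h τ) ^ N = 1 := by rw [← map_pow, hτN, map_one]
  have h1 : P.eval (red ⟨h τ, hτ' _ hh⟩) = 0 := by
    rw [key] at h0 ⊢
    have : aeval (h τ) Q = h (aeval τ Q) := by
      simp only [aeval_def, eval₂_eq_sum_range, map_sum, map_mul, map_pow]
      simp
    rw [this, norm_galois_apply]
    exact h0
  rw [eval_prod, Finset.prod_eq_zero_iff] at h1
  obtain ⟨i, -, hi⟩ := h1
  refine ⟨i, tameRoots_eq (tameRoots_map hτ h) (tameRoots_pow hτ _) ?_⟩
  simp only [f, eval_sub, eval_X, eval_C, ← map_pow, ← map_sub] at hi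
  simpa using (hred _).1 hi

end Residue

section Approx

variable {p : ℕ} [hp : Fact p.Prime] {Ω : Type*} [NormedField Ω] [NormedAlgebra ℚ_[p] Ω]
  [IsUltrametricDist Ω] [Algebra.IsAlgebraic ℚ_[p] Ω]

theorem exists_monic_padicInt {x : Ω} (hx : ‖x‖ ≤ 1) : ∃ f : ℤ_[p][X], f.Monic ∧
    eval₂ ((algebraMap ℚ_[p] Ω).comp (algebraMap ℤ_[p] ℚ_[p])) x f = 0 := by
  have hxint : IsIntegral ℚ_[p] x := Algebra.IsIntegral.isIntegral x
  have hmon := minpoly.monic hxint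
  have h1 : ∀ n, ‖(minpoly ℚ_[p] x).coeff n‖ ≤ 1 := by
    rw [← spectralValue_le_one_iff hmon]
    rw [NormedAlgebra.norm_eq_spectralNorm ℚ_[p]] at hx
    exact hx
  have hlift : minpoly ℚ_[p] x ∈ lifts (algebraMap ℤ_[p] ℚ_[p]) := by
    rw [lifts_iff_coeff_lifts]
    intro n
    exact ⟨⟨_, h1 n⟩, rfl⟩
  obtain ⟨q, hq, -, hm⟩ := lifts_and_natDegree_eq_and_monic hlift hmon
  refine ⟨q, hm, ?_⟩
  rw [← eval₂_map, hq]
  exact minpoly.aeval _ _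

theorem norm_sub_one_lt_of_pow_prime {x : Ω} (hx : ‖x‖ ≤ 1) (h : ‖x ^ p - 1‖ < 1) :
    ‖x - 1‖ < 1 := by
  obtain ⟨w, hw, h1⟩ := exists_one_add_pow_prime hp.out (z := x - 1)
    (norm_sub_le_of_le_of_le hx (by simp))
  rw [add_sub_cancel] at h1
  have h2 : (x - 1) ^ p = (x ^ p - 1) - p * ((x - 1) * w) := by rw [h1]; ring
  have h3 : ‖(x - 1) ^ p‖ < 1 := by
    rw [h2]
    refine norm_sub_lt_of_lt h ?_
    rw [norm_mul, norm_mul]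
    refine mul_lt_one_of_nonneg_of_lt_one_left (norm_nonneg _) (norm_prime_lt_one p Ω) ?_
    exact mul_le_one₀ (norm_sub_le_of_le_of_le hx (by simp)) (norm_nonneg _) hw
  rw [norm_pow] at h3
  by_contra! h4
  exact absurd h3 (not_lt.2 (one_le_pow₀ h4))

/-- An element of norm one has a power of exponent prime to `p` close to one. -/
theorem exists_norm_pow_sub_one_lt {x : Ω} (hx : ‖x‖ = 1) : ∃ t : ℕ, ¬ p ∣ t ∧ ‖x ^ t - 1‖ < 1 := by
  obtain ⟨f, hf, hfx⟩ := exists_monic_padicInt (p := p) hx.le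
  set φ := (algebraMap ℚ_[p] Ω).comp (algebraMap ℤ_[p] ℚ_[p])
  have hφ : ∀ a : ℤ_[p], ‖φ a‖ = ‖a‖ := fun a => by simp [φ, norm_algebraMap']
  let F : ℕ → (Fin f.natDegree → ZMod p) := fun i j =>
    PadicInt.toZMod ((X ^ i %ₘ f).coeff j)
  obtain ⟨i, j, hij, hF⟩ := Finite.exists_ne_map_eq_of_infinite F
  have hev : ∀ i : ℕ, eval₂ φ x (X ^ i %ₘ f) = x ^ i := by
    intro i
    have := congrArg (eval₂ φ x) (modByMonic_add_div (X ^ i) f)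
    simpa [eval₂_add, eval₂_mul, hfx] using this
  have hdiff : ‖x ^ i - x ^ j‖ < 1 := by
    rw [← hev, ← hev, ← eval₂_sub, eval₂_eq_sum_range]
    refine (IsUltrametricDist.norm_sum_le_of_forall_le_of_nonneg (C := ‖(p : Ω)‖)
      (norm_nonneg _) fun k _ => ?_).trans_lt (norm_prime_lt_one p Ω)
    rw [norm_mul, norm_pow, hx, one_pow, mul_one, hφ, norm_prime_eq, coeff_sub]
    have hk : PadicInt.toZMod ((X ^ i %ₘ f).coeff k) = PadicInt.toZMod ((X ^ j %ₘ f).coeff k) := by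
      rcases lt_or_ge k f.natDegree with h | h
      · exact congrFun hF ⟨k, h⟩
      · have hz : ∀ i : ℕ, (X ^ i %ₘ f).coeff k = 0 := fun i =>
          coeff_eq_zero_of_degree_lt ((degree_modByMonic_lt _ hf).trans_le
            (degree_le_natDegree.trans (by exact_mod_cast h)))
        rw [hz, hz]
    have hk' : (X ^ i %ₘ f).coeff k - (X ^ j %ₘ f).coeff k ∈ RingHom.ker (PadicInt.toZMod (p := p)) := by
      rw [RingHom.mem_ker, map_sub, hk, sub_self]
    rw [PadicInt.ker_toZMod, PadicInt.maximalIdeal_eq_span_p] at hk'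
    have := (PadicInt.norm_le_pow_iff_mem_span_pow ((X ^ i %ₘ f).coeff k - (X ^ j %ₘ f).coeff k) 1).2
      (by simpa using hk')
    simpa using this
  have hpos : ∃ t : ℕ, 0 < t ∧ ‖x ^ t - 1‖ < 1 := by
    have hw : ∀ i j : ℕ, i < j → ‖x ^ i - x ^ j‖ < 1 → ∃ t : ℕ, 0 < t ∧ ‖x ^ t - 1‖ < 1 := by
      intro i j hij h
      refine ⟨j - i, by omega, ?_⟩
      have : x ^ j = x ^ i * x ^ (j - i) := by rw [← pow_add]; congr 1; omega
      rw [norm_sub_rev, this, ← mul_sub_one, norm_mul, norm_pow, hx, one_pow, one_mul] at h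
      exact h
    rcases lt_or_gt_of_ne hij with h | h
    · exact hw i j h hdiff
    · exact hw j i h (by rwa [norm_sub_rev])
  obtain ⟨t, ht0, ht⟩ := hpos
  obtain ⟨a, m, hm, rfl⟩ := Nat.exists_eq_pow_mul_and_not_dvd ht0.ne' p hp.out.ne_one
  refine ⟨m, hm, ?_⟩
  clear ht0
  induction a with
  | zero => simpa using ht
  | succ a ih =>
    refine ih (norm_sub_one_lt_of_pow_prime (p := p) (by rw [norm_pow, hx, one_pow]) ?_)
    rwa [← pow_mul, mul_right_comm, ← pow_succ]

variable [IsAlgClosed Ω]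

/-- Teichmüller approximation. -/
theorem exists_tameRoots_norm_sub_lt {x : Ω} (hx : ‖x‖ = 1) : ∃ τ ∈ tameRoots p Ω, ‖x - τ‖ < 1 := by
  have := charZero_padic_algebra p (Ω := Ω) inferInstance
  obtain ⟨t, htp, ht⟩ := exists_norm_pow_sub_one_lt (p := p) hx
  have ht0 : t ≠ 0 := by rintro rfl; simp at htp
  have : NeZero (t : Ω) := ⟨Nat.cast_ne_zero.2 ht0⟩
  obtain ⟨ζ, hζ⟩ := HasEnoughRootsOfUnity.exists_primitiveRoot Ω t
  have h := congrArg (eval x) (X_pow_sub_one_eq_prod (Nat.pos_of_ne_zero ht0) hζ)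
  simp only [eval_sub, eval_pow, eval_X, eval_one, eval_prod, eval_C] at h
  by_contra! hcon
  rw [h, norm_prod] at ht
  refine absurd ht (not_lt.2 ?_)
  refine Finset.one_le_prod (fun τ hτ => ?_)
  exact hcon τ ⟨t, htp, by simpa using (mem_nthRootsFinset (Nat.pos_of_ne_zero ht0) 1).1 hτ⟩

/-- Close to `u ≠ 0` with `‖u‖ = ‖a‖` there is an element `τ * a` with `τ` a tame root of unity. -/
theorem exists_tameRoots_mul_norm_sub_lt {u a : Ω} (hu : u ≠ 0) (h : ‖u‖ = ‖a‖) :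
    ∃ τ ∈ tameRoots p Ω, ‖u - τ * a‖ < ‖a‖ := by
  have ha : a ≠ 0 := by rintro rfl; simp at h; exact hu h
  obtain ⟨τ, hτ, h1⟩ := exists_tameRoots_norm_sub_lt (p := p) (x := u / a)
    (by rw [norm_div, h, div_self (norm_ne_zero_iff.2 ha)])
  refine ⟨τ, hτ, ?_⟩
  have : u - τ * a = (u / a - τ) * a := by field_simp
  rw [this, norm_mul]
  exact mul_lt_of_lt_one_left (norm_pos_iff.2 ha) h1

theorem norm_one_sub_pow_primitive {ω : Ω} {k : ℕ} (h : IsPrimitiveRoot ω k) (hk : k ≠ 0) {i : ℕ}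
    (hi : i.Coprime k) : ‖1 - ω ^ i‖ = ‖1 - ω‖ := by
  have hn : ‖ω‖ = 1 := by
    have : ‖ω‖ ^ k = 1 := by rw [← norm_pow, h.pow_eq_one, norm_one]
    exact (pow_eq_one_iff_of_nonneg (norm_nonneg _) hk).1 this
  have h1 : ∀ (ω : Ω) (i : ℕ), ‖ω‖ = 1 → ‖1 - ω ^ i‖ ≤ ‖1 - ω‖ := fun ω i hω => by
    rw [norm_sub_rev, norm_sub_rev 1]; exact norm_pow_sub_one_le hω.le i
  refine le_antisymm (h1 ω i hn) ?_
  obtain ⟨j, hj⟩ : ∃ j : ℕ, (ω ^ i) ^ j = ω := by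
    have := (h.pow_of_coprime i hi)
    have : NeZero k := ⟨hk⟩
    obtain ⟨j, -, hj⟩ := (h.pow_of_coprime i hi).eq_pow_of_pow_eq_one h.pow_eq_one
    exact ⟨j, hj⟩
  calc ‖1 - ω‖ = ‖1 - (ω ^ i) ^ j‖ := by rw [hj]
    _ ≤ _ := h1 _ _ (by rw [norm_pow, hn, one_pow])

theorem norm_one_sub_primitive_pow {ω : Ω} (h : IsPrimitiveRoot ω p) :
    ‖1 - ω‖ ^ (p - 1) = ‖(p : Ω)‖ := by
  have hp1 : p - 1 + 1 = p := Nat.sub_add_cancel hp.out.one_le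
  have h' := h
  rw [← hp1] at h'
  have := h'.prod_one_sub_pow_eq_order
  have h2 : (((p - 1 : ℕ) : Ω) + 1) = p := by rw [← Nat.cast_succ, Nat.succ_eq_add_one, hp1]
  rw [h2] at this
  rw [← this, norm_prod, Finset.prod_congr rfl (g := fun _ => ‖1 - ω‖), Finset.prod_const,
    Finset.card_range]
  intro i hi
  refine norm_one_sub_pow_primitive h hp.out.ne_zero ?_
  refine Nat.Coprime.symm ((Nat.Prime.coprime_iff_not_dvd hp.out).2 ?_)
  rw [Finset.mem_range] at hi
  exact Nat.not_dvd_of_pos_of_lt (by omega) (by omega)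

/-- Units sufficiently close to one are `p`-th powers. -/
theorem exists_pth_root (M : IntermediateField ℚ_[p] Ω) (hW : tameRoots p Ω ⊆ M) {ω : Ω}
    (h : IsPrimitiveRoot ω p) (hω : ω ∈ M) {u : Ω} (hu : u ∈ M) (h1 : ‖u - 1‖ ≤ ‖1 - ω‖ ^ p) :
    ∃ t ∈ M, t ^ p = u := by
  have hp0 := hp.out.pos
  have hpow := norm_one_sub_primitive_pow h
  set l := ‖1 - ω‖ with hl
  have hω1 : 1 - ω ≠ 0 := by
    intro h0
    rw [hl, h0, norm_zero, zero_pow (Nat.sub_pos_of_lt hp.out.one_lt).ne'] at hpow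
    exact (norm_prime_pos p Ω).ne hpow
  have hl0 : 0 < l := norm_pos_iff.2 hω1
  have hl1 : l < 1 := by
    by_contra! hc
    exact absurd (norm_prime_lt_one p Ω) (not_lt.2 (hpow ▸ one_le_pow₀ hc))
  obtain ⟨y, hy⟩ := IsAlgClosed.exists_pow_nat_eq u hp0
  have hu1 : ‖u‖ = 1 := norm_eq_one_of_norm_sub_lt
    (h1.trans_lt (pow_lt_one₀ hl0.le hl1 hp0.ne'))
  have hy1 : ‖y‖ = 1 := by
    have : ‖y‖ ^ p = 1 := by rw [← norm_pow, hy, hu1]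
    exact (pow_eq_one_iff_of_nonneg (norm_nonneg _) hp0.ne').1 this
  have hyl : ‖y - 1‖ ≤ l := by
    obtain ⟨w, hw, hz⟩ := exists_one_add_pow_prime hp.out (z := y - 1)
      (norm_sub_le_of_le_of_le hy1.le (by simp))
    rw [add_sub_cancel, hy] at hz
    have hz' : (y - 1) ^ p = (u - 1) - p * (y - 1) * w := by rw [hz]; ring
    by_contra! hc
    have hpp : p = (p - 1) + 1 := by omega
    have hlt : l ^ (p - 1) < ‖y - 1‖ ^ (p - 1) :=
      pow_lt_pow_left₀ hc hl0.le (Nat.sub_pos_of_lt hp.out.one_lt).ne'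
    have h2 : ‖(y - 1) ^ p‖ < ‖y - 1‖ ^ p := by
      rw [hz']
      refine norm_sub_lt_of_lt (h1.trans_lt (pow_lt_pow_left₀ hc hl0.le hp0.ne')) ?_
      rw [norm_mul, norm_mul, ← hpow]
      calc l ^ (p - 1) * ‖y - 1‖ * ‖w‖ ≤ l ^ (p - 1) * ‖y - 1‖ :=
            mul_le_of_le_one_right (by positivity) hw
        _ < ‖y - 1‖ ^ (p - 1) * ‖y - 1‖ := mul_lt_mul_of_pos_right hlt (hl0.trans hc)
        _ = ‖y - 1‖ ^ p := by rw [← pow_succ, ← hpp]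
    rw [norm_pow] at h2
    exact lt_irrefl _ h2
  refine ⟨y, ?_, hy⟩
  set X := (y - 1) / (1 - ω) with hX
  have hX1 : ‖X‖ ≤ 1 := by rw [hX, norm_div]; exact (div_le_one hl0).2 hyl
  obtain ⟨A, hA, hXA⟩ : ∃ A ∈ M, ‖X - A‖ < 1 := by
    rcases hX1.lt_or_eq with h | h
    · exact ⟨0, zero_mem _, by simpa using h⟩
    · obtain ⟨τ, hτ, h⟩ := exists_tameRoots_norm_sub_lt (p := p) h
      exact ⟨τ, hW hτ, h⟩
  rw [mem_iff_fixed]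
  intro g hg
  have hgX : ‖g X - X‖ < 1 := by
    have : g X - X = g (X - A) - (X - A) := by rw [map_sub, hg A hA]; ring
    rw [this]
    exact norm_sub_lt_of_lt (by rwa [norm_galois_apply]) hXA
  have hy0 : y ≠ 0 := by rintro rfl; simp at hy1
  have : NeZero p := ⟨hp0.ne'⟩
  obtain ⟨j, hj, hgy⟩ := h.eq_pow_of_pow_eq_one (ξ := g y / y) (by
    rw [div_pow, ← map_pow, hy, hg u hu, div_self]
    rw [← hy]; exact pow_ne_zero _ hy0)
  have hgy' : g y = ω ^ j * y := by rw [hgy]; field_simp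
  rcases Nat.eq_zero_or_pos j with rfl | hj0
  · simpa using hgy'
  · exfalso
    have : g X - X = -(y * (1 - ω ^ j)) / (1 - ω) := by
      rw [hX, map_div₀, map_sub, map_sub, map_one, hg ω hω, hgy']; ring
    rw [this, norm_div, norm_neg, norm_mul, hy1, one_mul, norm_one_sub_pow_primitive h hp0.ne',
      div_self hl0.ne'] at hgX
    · exact lt_irrefl _ hgX
    · exact Nat.Coprime.symm ((Nat.Prime.coprime_iff_not_dvd hp.out).2
        (Nat.not_dvd_of_pos_of_lt hj0 hj))

/-- Units sufficiently close to one are `d`-th powers. -/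
theorem exists_nth_root (d : ℕ) (hd : 0 < d) : ∃ ε : ℝ, 0 < ε ∧
    ∀ (K : IntermediateField ℚ_[p] Ω), ∀ u ∈ K, ‖u - 1‖ < ε → ∃ t ∈ K, t ^ d = u := by
  classical
  have := charZero_padic_algebra p (Ω := Ω) inferInstance
  obtain ⟨δ, hδ, hδ', hδ1⟩ : ∃ δ : ℝ, 0 < δ ∧ δ ≤ 1 ∧ ∀ ω : Ω, ω ^ d = 1 → ω ≠ 1 → δ ≤ ‖ω - 1‖ := by
    let S := (nthRootsFinset d (1 : Ω)).erase 1
    rcases S.eq_empty_or_nonempty with h | h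
    · refine ⟨1, one_pos, le_rfl, fun ω h1 h2 => ?_⟩
      have : ω ∈ S := Finset.mem_erase.2 ⟨h2, (mem_nthRootsFinset hd 1).2 h1⟩
      simp [h] at this
    · obtain ⟨ω0, h0, hmin⟩ := S.exists_min_image (fun ω => ‖ω - 1‖) h
      refine ⟨min ‖ω0 - 1‖ 1, lt_min (norm_pos_iff.2 (sub_ne_zero.2 (Finset.mem_erase.1 h0).1))
        one_pos, min_le_right _ _, fun ω h1 h2 => (min_le_left _ _).trans <| hmin ω (Finset.mem_erase.2 ⟨h2, (mem_nthRootsFinset hd 1).2 h1⟩)⟩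
  refine ⟨δ ^ d, by positivity, fun K u hu h1 => ?_⟩
  have hne : NeZero (d : Ω) := ⟨Nat.cast_ne_zero.2 hd.ne'⟩
  obtain ⟨ζ, hζ⟩ := HasEnoughRootsOfUnity.exists_primitiveRoot Ω d
  obtain ⟨y, hy⟩ := IsAlgClosed.exists_pow_nat_eq u hd
  have hprod := hζ.pow_sub_pow_eq_prod_sub_mul y 1 hd
  simp only [one_pow, mul_one] at hprod
  obtain ⟨ω, hω, hyω⟩ : ∃ ω ∈ nthRootsFinset d (1 : Ω), ‖y - ω‖ < δ := by
    by_contra! hc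
    have : δ ^ d ≤ ‖u - 1‖ := by
      have h2 : δ ^ d = ∏ ω ∈ nthRootsFinset d (1 : Ω), δ := by
        rw [Finset.prod_const, hζ.card_nthRootsFinset]
      rw [← hy, hprod, norm_prod, h2]
      exact Finset.prod_le_prod (fun _ _ => hδ.le) fun ω hω => hc ω hω
    exact absurd h1 (not_lt.2 this)
  rw [mem_nthRootsFinset hd] at hω
  have hω1 : ‖ω‖ = 1 := (pow_eq_one_iff_of_nonneg (norm_nonneg _) hd.ne').1
    (by rw [← norm_pow, hω, norm_one])
  have hω0 : ω ≠ 0 := by rintro rfl; simp at hω1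
  have hy1 : ‖y / ω - 1‖ < δ := by
    have : y / ω - 1 = (y - ω) / ω := by field_simp
    rw [this, norm_div, hω1, div_one]; exact hyω
  refine ⟨y / ω, ?_, by rw [div_pow, hω, div_one, hy]⟩
  rw [mem_iff_fixed]
  intro g hg
  set t := y / ω with ht
  have htd : t ^ d = u := by rw [ht, div_pow, hω, div_one, hy]
  have ht1 : ‖t‖ = 1 := norm_eq_one_of_norm_sub_lt (hy1.trans_le hδ')
  have ht0 : t ≠ 0 := by rintro h; simp [h] at ht1
  have h2 : ‖g t / t - 1‖ < δ := by
    have : g t / t - 1 = (g (t - 1) - (t - 1)) / t := by rw [map_sub, map_one]; field_simp; ring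
    rw [this, norm_div, ht1, div_one]
    exact norm_sub_lt_of_lt (by rwa [norm_galois_apply]) hy1
  by_contra hgt
  refine absurd h2 (not_lt.2 (hδ1 _ ?_ fun h => hgt ?_))
  · rw [div_pow, ← map_pow, htd, hg u hu, div_self]
    rw [← htd]; exact pow_ne_zero _ ht0
  · rwa [div_eq_one_iff_eq ht0] at h

end Approx

section Orbit

variable {p : ℕ} [hp : Fact p.Prime] {Ω : Type*} [NormedField Ω] [NormedAlgebra ℚ_[p] Ω]
  [IsUltrametricDist Ω] [Algebra.IsAlgebraic ℚ_[p] Ω]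

theorem galois_pow_succ_apply (g : Gal(Ω/ℚ_[p])) (i : ℕ) (x : Ω) :
    (g ^ (i + 1)) x = g ((g ^ i) x) := by
  rw [pow_succ', AlgEquiv.mul_apply]

theorem galois_pow_succ_apply' (g : Gal(Ω/ℚ_[p])) (i : ℕ) (x : Ω) :
    (g ^ (i + 1)) x = (g ^ i) (g x) := by
  rw [pow_succ, AlgEquiv.mul_apply]

theorem galois_pow_fixed {g : Gal(Ω/ℚ_[p])} {x : Ω} (h : g x = x) (i : ℕ) : (g ^ i) x = x := by
  induction i with
  | zero => simp
  | succ i ih => rw [galois_pow_succ_apply, ih, h]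

theorem galois_pow_mem {g : Gal(Ω/ℚ_[p])} {A : Set Ω} (hA : ∀ a ∈ A, g a ∈ A) (i : ℕ) {x : Ω}
    (hx : x ∈ A) : (g ^ i) x ∈ A := by
  induction i with
  | zero => simpa using hx
  | succ i ih => rw [galois_pow_succ_apply]; exact hA _ ih

theorem galois_pow_mod {g : Gal(Ω/ℚ_[p])} {d : ℕ} {x : Ω} (h : (g ^ d) x = x) (i : ℕ) :
    (g ^ (i % d)) x = (g ^ i) x := by
  conv_rhs => rw [← Nat.mod_add_div i d, pow_add, pow_mul, AlgEquiv.mul_apply,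
    galois_pow_fixed h]

theorem galois_sum_shift {g : Gal(Ω/ℚ_[p])} {d : ℕ} {x : Ω} (h : (g ^ d) x = x) :
    g (∑ i ∈ Finset.range d, (g ^ i) x) = ∑ i ∈ Finset.range d, (g ^ i) x := by
  rw [map_sum]
  have h1 := Finset.sum_range_succ (fun i => (g ^ i) x) d
  rw [Finset.sum_range_succ', h, pow_zero, AlgEquiv.one_apply] at h1
  simpa only [galois_pow_succ_apply] using add_right_cancel h1

theorem galois_prod_shift {g : Gal(Ω/ℚ_[p])} {d : ℕ} {x : Ω} (h : (g ^ d) x = x) :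
    g (∏ i ∈ Finset.range d, (g ^ i) x) = ∏ i ∈ Finset.range d, (g ^ i) x := by
  rcases eq_or_ne x 0 with rfl | hx
  · rcases Nat.eq_zero_or_pos d with rfl | hd
    · simp
    · simp [hd.ne']
  rw [map_prod]
  have h1 := Finset.prod_range_succ (fun i => (g ^ i) x) d
  rw [Finset.prod_range_succ', h, pow_zero, AlgEquiv.one_apply] at h1
  simpa only [galois_pow_succ_apply] using mul_right_cancel₀ hx h1

theorem tameRoots_exists_period {τ : Ω} (hτ : τ ∈ tameRoots p Ω) :
    ∃ D : ℕ, 0 < D ∧ τ ^ p ^ D = τ := by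
  obtain ⟨N, hN, hτN⟩ := hτ
  have hcop : Nat.Coprime p N := (Nat.Prime.coprime_iff_not_dvd hp.out).2 hN
  refine ⟨N.totient, Nat.totient_pos.2 (Nat.pos_of_ne_zero (by rintro rfl; simp at hN)), ?_⟩
  have := Nat.ModEq.pow_totient hcop
  rw [← Nat.div_add_mod (p ^ N.totient) N, pow_add, pow_mul, hτN, one_pow, one_mul, this,
    ← pow_mod_orderOf]
  have h3 : orderOf τ ∣ N := orderOf_dvd_of_pow_eq_one hτN
  rw [Nat.mod_mod_of_dvd _ h3, pow_mod_orderOf, pow_one]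

/-- The automorphisms fixing `K` act on a root of unity of order prime to `p` through the powers
of a single one. -/
theorem exists_cyclic (K : IntermediateField ℚ_[p] Ω) {τ : Ω} (hτ : τ ∈ tameRoots p Ω) :
    ∃ (φ : Gal(Ω/ℚ_[p])) (d : ℕ), (∀ a ∈ K, φ a = a) ∧ 0 < d ∧ (φ ^ d) τ = τ ∧
      Set.InjOn (fun i : ℕ => (φ ^ i) τ) (Set.Iio d) ∧
      ∀ h : Gal(Ω/ℚ_[p]), (∀ a ∈ K, h a = a) → ∃ j < d, h τ = (φ ^ j) τ := by
  classical
  have hex : ∃ i : ℕ, 0 < i ∧ ∃ h : Gal(Ω/ℚ_[p]), (∀ a ∈ K, h a = a) ∧ h τ = τ ^ p ^ i := by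
    obtain ⟨D, hD, h⟩ := tameRoots_exists_period hτ
    exact ⟨D, hD, 1, fun a _ => rfl, h.symm⟩
  obtain ⟨hi0, φ, hφK, hφ⟩ := Nat.find_spec hex
  set i0 := Nat.find hex with hi0def
  have hφq : ∀ q : ℕ, (φ ^ q) τ = τ ^ p ^ (i0 * q) := by
    intro q
    induction q with
    | zero => simp
    | succ q ih => rw [galois_pow_succ_apply, ih, map_pow, hφ, ← pow_mul, ← pow_add]; ring_nf
  have hφqK : ∀ q : ℕ, ∀ a ∈ K, (φ ^ q) a = a := fun q a ha => galois_pow_fixed (hφK a ha) q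
  have hgen : ∀ h : Gal(Ω/ℚ_[p]), (∀ a ∈ K, h a = a) → ∃ j, h τ = (φ ^ j) τ := by
    intro h hK
    obtain ⟨i, hi⟩ := exists_galois_eq_pow hτ h
    refine ⟨i / i0, ?_⟩
    have h1 : ((φ ^ (i / i0))⁻¹ * h) τ = τ ^ p ^ (i % i0) := by
      apply (φ ^ (i / i0)).injective
      rw [← AlgEquiv.mul_apply, mul_inv_cancel_left, map_pow, hφq, hi, ← pow_mul, ← pow_add,
        Nat.div_add_mod]
    have h2 : i % i0 = 0 := by
      by_contra h0
      refine Nat.find_min hex (Nat.mod_lt i hi0) ⟨Nat.pos_of_ne_zero h0, _, fun a ha => ?_, h1⟩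
      rw [AlgEquiv.mul_apply, hK a ha]
      nth_rw 1 [← hφqK (i / i0) a ha]
      exact (φ ^ (i / i0)).symm_apply_apply a
    rw [h2, pow_zero, pow_one] at h1
    conv_rhs => rw [← h1, ← AlgEquiv.mul_apply, mul_inv_cancel_left]
  obtain ⟨D, hD, hper⟩ := tameRoots_exists_period hτ
  have hpt : τ ∈ Function.periodicPts φ := by
    refine ⟨D, hD, ?_⟩
    rw [Function.IsPeriodicPt, Function.IsFixedPt, ← AlgEquiv.coe_pow, hφq]
    have : ∀ k : ℕ, τ ^ p ^ (D * k) = τ := by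
      intro k
      induction k with
      | zero => simp
      | succ k ih => rw [Nat.mul_succ, pow_add, pow_mul, ih, hper]
    rw [mul_comm, this]
  have hd : (φ ^ Function.minimalPeriod φ τ) τ = τ := by
    rw [AlgEquiv.coe_pow]; exact Function.iterate_minimalPeriod
  have hd0 := Function.minimalPeriod_pos_of_mem_periodicPts hpt
  refine ⟨φ, Function.minimalPeriod φ τ, hφK, hd0, hd, ?_, fun h hK => ?_⟩
  · simp only [AlgEquiv.coe_pow]
    exact Function.iterate_injOn_Iio_minimalPeriod
  · obtain ⟨j, hj⟩ := hgen h hK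
    exact ⟨j % _, Nat.mod_lt _ hd0, by rw [galois_pow_mod hd, hj]⟩

/-- Some twisted trace of `x` has the same norm as `x`. -/
theorem exists_norm_trace_eq {φ : Gal(Ω/ℚ_[p])} {d : ℕ} (hd : 0 < d) {τ : Ω}
    (hτ : τ ∈ tameRoots p Ω) (hinj : Set.InjOn (fun i : ℕ => (φ ^ i) τ) (Set.Iio d)) (x : Ω) :
    ∃ l : ℕ, ‖∑ i ∈ Finset.range d, (φ ^ i) (x * τ ^ l)‖ = ‖x‖ := by
  have h1 : ∀ l : ℕ, ‖∑ i ∈ Finset.range d, (φ ^ i) (x * τ ^ l)‖ ≤ ‖x‖ := fun l =>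
    IsUltrametricDist.norm_sum_le_of_forall_le_of_nonneg (norm_nonneg _) fun i _ => by
      rw [norm_galois_apply, norm_mul, norm_pow, tameRoots_norm hτ, one_pow, mul_one]
  by_contra! hcon
  obtain ⟨N, hN, hτN⟩ := id hτ
  have hN0 : 0 < N := Nat.pos_of_ne_zero (by rintro rfl; simp at hN)
  have hτ0 := tameRoots_ne_zero hτ
  have hsum : ∑ l ∈ Finset.range N, (τ⁻¹) ^ l * ∑ i ∈ Finset.range d, (φ ^ i) (x * τ ^ l) = N * x := by
    simp_rw [Finset.mul_sum]
    rw [Finset.sum_comm, Finset.sum_eq_single_of_mem 0 (Finset.mem_range.2 hd)]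
    · have : ∀ l ∈ Finset.range N, τ⁻¹ ^ l * (φ ^ 0) (x * τ ^ l) = x := fun l _ => by
        rw [pow_zero, AlgEquiv.one_apply, mul_comm x, ← mul_assoc, ← mul_pow,
            inv_mul_cancel₀ hτ0, one_pow, one_mul]
      rw [Finset.sum_congr rfl this]; simp
    · intro i hi hi0
      have : ∀ l ∈ Finset.range N, τ⁻¹ ^ l * (φ ^ i) (x * τ ^ l) =
          (φ ^ i) x * (τ⁻¹ * (φ ^ i) τ) ^ l := fun l _ => by
        rw [map_mul, map_pow, mul_pow]; ring
      rw [Finset.sum_congr rfl this, ← Finset.mul_sum]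
      have hne : τ⁻¹ * (φ ^ i) τ ≠ 1 := by
        intro h
        refine hi0 (hinj (Finset.mem_range.1 hi) hd ?_)
        rw [inv_mul_eq_one₀ hτ0] at h
        simpa using h.symm
      have h0 := mul_geom_sum (τ⁻¹ * (φ ^ i) τ) N
      rw [mul_pow, inv_pow, ← map_pow, hτN, map_one, inv_one, mul_one, sub_self] at h0
      rw [(mul_eq_zero.1 h0).resolve_left (sub_ne_zero.2 hne), mul_zero]
  have hlt : ‖(N : Ω) * x‖ < ‖x‖ := by
    rw [← hsum]
    have : Nonempty ℕ := ⟨0⟩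
    obtain ⟨l, hl, hle⟩ := IsUltrametricDist.exists_norm_finsetSum_le (Finset.range N)
      (fun l => (τ⁻¹) ^ l * ∑ i ∈ Finset.range d, (φ ^ i) (x * τ ^ l))
    refine hle.trans_lt ?_
    rw [norm_mul, norm_pow, norm_inv, tameRoots_norm hτ, inv_one, one_pow, one_mul]
    exact lt_of_le_of_ne (h1 l) (hcon l)
  rw [norm_mul, norm_natCast_of_not_dvd p hN, one_mul] at hlt
  exact lt_irrefl _ hlt

variable [IsAlgClosed Ω]

theorem exists_norm_eq_of_mem_adjoin_tameRoot (K : IntermediateField ℚ_[p] Ω) {τ : Ω}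
    (hτ : τ ∈ tameRoots p Ω) {x : Ω} (hx : x ∈ adjoin ℚ_[p] ((K : Set Ω) ∪ {τ})) :
    ∃ e ∈ K, ‖e‖ = ‖x‖ := by
  obtain ⟨φ, d, hφK, hd0, hd, hinj, hgen⟩ := exists_cyclic K hτ
  obtain ⟨l, hl⟩ := exists_norm_trace_eq hd0 hτ hinj x
  refine ⟨_, ?_, hl⟩
  set A := adjoin ℚ_[p] ((K : Set Ω) ∪ {τ}) with hA
  have hτA : τ ∈ A := subset_adjoin _ _ (by simp)
  have hKA : ∀ a ∈ K, a ∈ A := fun a ha => subset_adjoin _ _ (Or.inl ha)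
  have hfix : ∀ z ∈ A, (φ ^ d) z = z := fun z hz =>
    (mem_adjoin_iff_fixed _ z).1 hz _ (by
      rintro a (ha | rfl)
      · exact galois_pow_fixed (hφK a ha) d
      · exact hd)
  have hφA : ∀ z ∈ A, φ z ∈ A := fun z hz => galois_mem_adjoin φ (by
    rintro a (ha | rfl)
    · rw [hφK a ha]; exact hKA a ha
    · obtain ⟨i, hi⟩ := exists_galois_eq_pow hτ φ
      rw [hi]; exact pow_mem hτA _) hz
  set z := x * τ ^ l
  have hz : z ∈ A := mul_mem hx (pow_mem hτA _)
  have hT : ∑ i ∈ Finset.range d, (φ ^ i) z ∈ A :=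
    sum_mem fun i _ => galois_pow_mem (A := (A : Set Ω)) hφA i hz
  rw [mem_iff_fixed]
  intro g hg
  obtain ⟨j, -, hj⟩ := hgen g hg
  rw [galois_eqOn_adjoin (g := g) (h := φ ^ j) ?_ hT]
  · exact galois_pow_fixed (galois_sum_shift (hfix z hz)) j
  · rintro a (ha | rfl)
    · rw [hg a ha, galois_pow_fixed (hφK a ha)]
    · exact hj

theorem exists_tameRoot_mem_adjoin {S : Set Ω} {x : Ω}
    (hx : x ∈ adjoin ℚ_[p] (S ∪ tameRoots p Ω)) :
    ∃ τ ∈ tameRoots p Ω, x ∈ adjoin ℚ_[p] (S ∪ {τ}) := by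
  classical
  have := charZero_padic_algebra p (Ω := Ω) inferInstance
  obtain ⟨T, hT, hxT⟩ := exists_finset_of_mem_adjoin hx
  obtain ⟨N, hN, hTN⟩ : ∃ N : ℕ, ¬ p ∣ N ∧ ∀ t ∈ T, t ∈ S ∨ t ^ N = 1 := by
    clear hxT
    induction T using Finset.induction_on with
    | empty => exact ⟨1, hp.out.one_lt.ne' ∘ Nat.dvd_one.1, by simp⟩
    | insert a T ha ih =>
      rw [Finset.coe_insert, Set.insert_subset_iff] at hT
      obtain ⟨N, hN, h⟩ := ih hT.2
      rcases hT.1 with h' | ⟨N', hN', h'⟩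
      · refine ⟨N, hN, fun t ht => ?_⟩
        rcases Finset.mem_insert.1 ht with rfl | ht
        · exact Or.inl h'
        · exact h t ht
      · refine ⟨N * N', fun h => (hp.out.dvd_mul.1 h).elim hN hN', fun t ht => ?_⟩
        rcases Finset.mem_insert.1 ht with rfl | ht
        · right; rw [mul_comm, pow_mul, h', one_pow]
        · exact (h t ht).imp_right fun h => by rw [pow_mul, h, one_pow]
  have hN0 : N ≠ 0 := by rintro rfl; simp at hN
  have : NeZero (N : Ω) := ⟨Nat.cast_ne_zero.2 hN0⟩
  have : NeZero N := ⟨hN0⟩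
  obtain ⟨ζ, hζ⟩ := HasEnoughRootsOfUnity.exists_primitiveRoot Ω N
  refine ⟨ζ, ⟨N, hN, hζ.pow_eq_one⟩, ?_⟩
  have hle : adjoin ℚ_[p] (T : Set Ω) ≤ adjoin ℚ_[p] (S ∪ {ζ}) := by
    rw [adjoin_le_iff]
    intro t ht
    rcases hTN t ht with h | h
    · exact subset_adjoin _ _ (Or.inl h)
    · obtain ⟨i, -, rfl⟩ := hζ.eq_pow_of_pow_eq_one h
      exact pow_mem (subset_adjoin _ _ (by simp)) _
  exact hle hxT

/-- Adjoining roots of unity of order prime to `p` does not change the value group. -/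
theorem exists_norm_eq_of_mem_adjoin_tameRoots (K : IntermediateField ℚ_[p] Ω) {x : Ω}
    (hx : x ∈ adjoin ℚ_[p] ((K : Set Ω) ∪ tameRoots p Ω)) : ∃ e ∈ K, ‖e‖ = ‖x‖ := by
  obtain ⟨τ, hτ, h⟩ := exists_tameRoot_mem_adjoin hx
  exact exists_norm_eq_of_mem_adjoin_tameRoot K hτ h

theorem exists_norm_pow_natDegree_eq (M : IntermediateField ℚ_[p] Ω) (x : Ω) :
    ∃ c ∈ M, ‖c‖ = ‖x‖ ^ (minpoly M x).natDegree := by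
  have hxint : IsIntegral M x := Algebra.IsIntegral.isIntegral x
  have hn : Normal M Ω := by
    have : IsAlgClosure M Ω := ⟨inferInstance, inferInstance⟩
    exact IsAlgClosure.normal M Ω
  refine ⟨((minpoly M x).coeff 0 : M), SetLike.coe_mem _, ?_⟩
  set f := minpoly M x
  have hs : (f.map (algebraMap M Ω)).Splits := IsAlgClosed.splits _
  have h1 := hs.coeff_zero_eq_prod_roots_of_monic ((minpoly.monic hxint).map _)
  rw [coeff_map, natDegree_map] at h1
  change ‖algebraMap M Ω (f.coeff 0)‖ = _
  rw [h1, norm_mul, norm_pow, norm_neg, norm_one, one_pow, one_mul]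
  have h2 : ∀ r ∈ (f.map (algebraMap M Ω)).roots, ‖r‖ = ‖x‖ := by
    intro r hr
    have hr' := (mem_roots'.1 hr).2
    rw [IsRoot, eval_map_algebraMap] at hr'
    obtain ⟨σ, rfl⟩ := minpoly.exists_algEquiv_of_root' hxint.isAlgebraic hr'
    exact norm_galois_apply (σ.restrictScalars ℚ_[p]) x
  have h3 : Multiset.card (f.map (algebraMap M Ω)).roots = f.natDegree := by
    rw [← hs.natDegree_eq_card_roots, natDegree_map]
  rw [← h3]
  generalize (f.map (algebraMap M Ω)).roots = s at h2
  clear h3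
  induction s using Multiset.induction_on with
  | empty => simp
  | cons a s ih =>
    rw [Multiset.prod_cons, norm_mul, h2 a (by simp), ih fun r hr => h2 r (by simp [hr]),
      Multiset.card_cons, pow_succ']

variable (p) in
/-- The value group of `M` is contained in a discrete group `‖p‖^(ℤ/D)`. -/
def IsDiscreteSubfield (M : IntermediateField ℚ_[p] Ω) : Prop :=
  ∃ D : ℕ, 0 < D ∧ ∀ x ∈ M, x ≠ 0 → ∃ k : ℤ, ‖x‖ ^ D = ‖(p : Ω)‖ ^ k

theorem IsDiscreteSubfield.adjoin_singleton {M : IntermediateField ℚ_[p] Ω}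
    (h : IsDiscreteSubfield p M) (y : Ω) :
    IsDiscreteSubfield p (adjoin ℚ_[p] ((M : Set Ω) ∪ {y})) := by
  obtain ⟨D, hD, h⟩ := h
  have hxint : IsIntegral M y := Algebra.IsIntegral.isIntegral y
  have : FiniteDimensional M M⟮y⟯ := adjoin.finiteDimensional hxint
  set m := Module.finrank M M⟮y⟯
  refine ⟨D * m.factorial, Nat.mul_pos hD (Nat.factorial_pos _), fun x hx hx0 => ?_⟩
  have hxM : x ∈ M⟮y⟯ := by
    have hle : ((M : Set Ω) ∪ {y}) ⊆ (M⟮y⟯.restrictScalars ℚ_[p] : IntermediateField ℚ_[p] Ω) := by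
      rintro a (ha | ha)
      · exact (M⟮y⟯).algebraMap_mem ⟨a, ha⟩
      · rw [Set.mem_singleton_iff.1 ha]
        exact mem_adjoin_simple_self M y
    exact (mem_restrictScalars ℚ_[p]).1 (adjoin_le_iff.2 hle hx)
  obtain ⟨c, hc, hcx⟩ := exists_norm_pow_natDegree_eq M x
  have hc0 : c ≠ 0 := by
    rw [← norm_ne_zero_iff, hcx]; exact pow_ne_zero _ (norm_ne_zero_iff.2 hx0)
  have hdeg : (minpoly M x).natDegree ≤ m := by
    have := minpoly.natDegree_le (A := M) (⟨x, hxM⟩ : M⟮y⟯)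
    rwa [IntermediateField.minpoly_eq] at this
  have hpos : 0 < (minpoly M x).natDegree := minpoly.natDegree_pos (Algebra.IsIntegral.isIntegral x)
  obtain ⟨q, hq⟩ := Nat.dvd_factorial hpos hdeg
  obtain ⟨k, hk⟩ := h c hc hc0
  refine ⟨k * q, ?_⟩
  rw [hq, show D * ((minpoly M x).natDegree * q) = (minpoly M x).natDegree * D * q by ring,
    pow_mul, pow_mul, ← hcx, hk, zpow_mul, zpow_natCast]

/-- A subfield with discrete value group that contains `p` has a uniformizer. -/
theorem IsDiscreteSubfield.exists_uniformizer {M : IntermediateField ℚ_[p] Ω}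
    (h : IsDiscreteSubfield p M) : ∃ π ∈ M, 0 < ‖π‖ ∧ ‖π‖ < 1 ∧
      ∀ x ∈ M, x ≠ 0 → ∃ k : ℤ, ‖x‖ = ‖π‖ ^ k := by
  classical
  obtain ⟨D, hD, h⟩ := h
  have hp0 := norm_prime_pos p Ω
  have hp1 := norm_prime_lt_one p Ω
  have hex : ∃ k : ℕ, 0 < k ∧ ∃ x ∈ M, ‖x‖ ^ D = ‖(p : Ω)‖ ^ k :=
    ⟨D, hD, p, _root_.natCast_mem _ _, rfl⟩
  obtain ⟨hk0, π, hπ, hk⟩ := Nat.find_spec hex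
  set k0 := Nat.find hex
  have hπ0 : 0 < ‖π‖ := by
    refine lt_of_le_of_ne (norm_nonneg _) fun h0 => ?_
    rw [← h0, zero_pow hD.ne'] at hk
    exact (pow_pos hp0 _).ne hk
  refine ⟨π, hπ, hπ0, ?_, fun x hx hx0 => ?_⟩
  · by_contra! hc
    have : 1 ≤ ‖(p : Ω)‖ ^ k0 := hk ▸ one_le_pow₀ hc
    exact absurd this (not_le.2 (pow_lt_one₀ hp0.le hp1 hk0.ne'))
  · obtain ⟨k, hkx⟩ := h x hx hx0
    refine ⟨k / k0, ?_⟩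
    have h1 : ‖x * π ^ (-(k / k0))‖ ^ D = ‖(p : Ω)‖ ^ (k % k0) := by
      rw [norm_mul, mul_pow, hkx, norm_zpow, ← zpow_natCast (‖π‖ ^ _), ← zpow_mul, mul_comm _ (D : ℤ),
        zpow_mul, zpow_natCast, hk, ← zpow_natCast, ← zpow_mul, ← zpow_add₀ hp0.ne']
      congr 1
      have := Int.mul_ediv_add_emod k k0
      linarith
    have h2 : k % k0 = 0 := by
      by_contra h0
      have h3 : 0 ≤ k % k0 := Int.emod_nonneg _ (by exact_mod_cast hk0.ne')
      have h4 : k % k0 < k0 := Int.emod_lt_of_pos _ (by exact_mod_cast hk0)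
      refine Nat.find_min hex (m := (k % k0).toNat) (by omega) ⟨by omega,
        x * π ^ (-(k / k0)), ?_, ?_⟩
      · exact mul_mem hx (zpow_mem hπ _)
      · rw [h1, ← zpow_natCast, Int.toNat_of_nonneg h3]
    rw [h2, zpow_zero] at h1
    have h5 := (pow_eq_one_iff_of_nonneg (norm_nonneg _) hD.ne').1 h1
    rw [norm_mul, norm_zpow, zpow_neg] at h5
    exact (mul_inv_eq_one₀ (zpow_ne_zero _ hπ0.ne')).1 h5

end Orbit

section Symbol

variable {p : ℕ} [hp : Fact p.Prime] {Ω : Type*} [NormedField Ω] [NormedAlgebra ℚ_[p] Ω]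
  [IsUltrametricDist Ω] [Algebra.IsAlgebraic ℚ_[p] Ω]

/-- The field generated by `M` and `y`. -/
noncomputable abbrev adjoinElem (M : IntermediateField ℚ_[p] Ω) (y : Ω) : IntermediateField ℚ_[p] Ω :=
  adjoin ℚ_[p] ((M : Set Ω) ∪ {y})

theorem mem_adjoinElem_of_mem {M : IntermediateField ℚ_[p] Ω} {a : Ω} (y : Ω) (ha : a ∈ M) :
    a ∈ adjoinElem M y := subset_adjoin _ _ (Or.inl ha)

theorem self_mem_adjoinElem (M : IntermediateField ℚ_[p] Ω) (y : Ω) : y ∈ adjoinElem M y :=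
  subset_adjoin _ _ (by simp)

theorem adjoinElem_le {M K : IntermediateField ℚ_[p] Ω} {y : Ω} (h : M ≤ K) (hy : y ∈ K) :
    adjoinElem M y ≤ K := by
  rw [adjoin_le_iff]
  rintro a (ha | ha)
  · exact h ha
  · rw [Set.mem_singleton_iff.1 ha]; exact hy

theorem prod_range_sub_primitiveRoot_mul {ω : Ω} {k : ℕ} (hk : 0 < k) (h : IsPrimitiveRoot ω k)
    (x y : Ω) : ∏ i ∈ Finset.range k, (x - ω ^ i * y) = x ^ k - y ^ k := by
  classical
  have : NeZero k := ⟨hk.ne'⟩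
  rw [h.pow_sub_pow_eq_prod_sub_mul x y hk]
  refine Finset.prod_nbij (fun i => ω ^ i) (fun i _ => ?_) (fun i hi j hj hij => ?_) (fun z hz => ?_)
    fun i _ => rfl
  · rw [mem_nthRootsFinset hk, ← pow_mul, mul_comm, pow_mul, h.pow_eq_one, one_pow]
  · exact h.pow_inj (Finset.mem_range.1 hi) (Finset.mem_range.1 hj) hij
  · obtain ⟨i, hi, rfl⟩ := h.eq_pow_of_pow_eq_one ((mem_nthRootsFinset hk 1).1 hz)
    exact ⟨i, by simpa using hi, rfl⟩

theorem galois_pow_kummer {g : Gal(Ω/ℚ_[p])} {ω y : Ω} (hω : g ω = ω) (hy : g y = ω * y) (i : ℕ) :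
    (g ^ i) y = ω ^ i * y := by
  induction i with
  | zero => simp
  | succ i ih => rw [galois_pow_succ_apply, ih, map_mul, map_pow, hω, hy]; ring

/-- Automorphisms over `M` act on a Kummer generator through the powers of `g`. -/
theorem exists_galois_eq_pow_kummer {M : IntermediateField ℚ_[p] Ω} {ω y : Ω} {k : ℕ} (hk : 0 < k)
    (h : IsPrimitiveRoot ω k) (hω : ω ∈ M) (hy : y ^ k ∈ M) {g : Gal(Ω/ℚ_[p])}
    (hg : ∀ a ∈ M, g a = a) (hgy : g y = ω * y) (f : Gal(Ω/ℚ_[p])) (hf : ∀ a ∈ M, f a = a) :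
    ∃ i < k, f y = (g ^ i) y := by
  have : NeZero k := ⟨hk.ne'⟩
  rcases eq_or_ne y 0 with rfl | hy0
  · exact ⟨0, hk, by simp⟩
  obtain ⟨i, hi, h1⟩ := h.eq_pow_of_pow_eq_one (ξ := f y / y) (by
    rw [div_pow, ← map_pow, hf _ hy, div_self (pow_ne_zero _ hy0)])
  refine ⟨i, hi, ?_⟩
  rw [galois_pow_kummer (hg _ hω) hgy, h1]
  field_simp

variable [IsAlgClosed Ω]

theorem galois_eqOn_adjoinElem {g h : Gal(Ω/ℚ_[p])} {M : IntermediateField ℚ_[p] Ω}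
    {y : Ω} (hM : ∀ a ∈ M, g a = h a) (hy : g y = h y) {x : Ω} (hx : x ∈ adjoinElem M y) :
    g x = h x :=
  galois_eqOn_adjoin (by
    rintro a (ha | ha)
    · exact hM a ha
    · rw [Set.mem_singleton_iff.1 ha]; exact hy) hx

theorem galois_mem_adjoinElem {g : Gal(Ω/ℚ_[p])} {M K : IntermediateField ℚ_[p] Ω}
    {y : Ω} (hM : ∀ a ∈ M, g a ∈ K) (hy : g y ∈ K) {x : Ω} (hx : x ∈ adjoinElem M y) :
    g x ∈ K :=
  galois_mem_adjoin g (by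
    rintro a (ha | ha)
    · exact hM a ha
    · rw [Set.mem_singleton_iff.1 ha]; exact hy) hx

/-- If `g` generates the action of the automorphisms over `M` on `θ`, then the elements of `M(θ)`
fixed by `g` lie in `M`. -/
theorem mem_of_galois_fixed {M : IntermediateField ℚ_[p] Ω} {θ : Ω} {g : Gal(Ω/ℚ_[p])}
    (hg : ∀ a ∈ M, g a = a)
    (hgen : ∀ f : Gal(Ω/ℚ_[p]), (∀ a ∈ M, f a = a) → ∃ i : ℕ, f θ = (g ^ i) θ) {x : Ω}
    (hx : x ∈ adjoinElem M θ) (hgx : g x = x) : x ∈ M := by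
  rw [mem_iff_fixed]
  intro f hf
  obtain ⟨i, hi⟩ := hgen f hf
  rw [galois_eqOn_adjoinElem (h := g ^ i) (fun a ha => ?_) hi hx, galois_pow_fixed hgx]
  rw [hf a ha, galois_pow_fixed (hg a ha)]

/-- `w` is a norm from the Kummer extension `M(z^(1/p))`, formulated through automorphisms. -/
def IsKummerNorm (M : IntermediateField ℚ_[p] Ω) (ω z w : Ω) : Prop :=
  ∀ (y : Ω) (g : Gal(Ω/ℚ_[p])), y ^ p = z → (∀ a ∈ M, g a = a) → g y = ω * y →
    ∃ b ∈ adjoinElem M y, ∏ i ∈ Finset.range p, (g ^ i) b = w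

namespace IsKummerNorm

variable {M : IntermediateField ℚ_[p] Ω} {ω z w z' w' c : Ω}

theorem mul_right (h : IsKummerNorm M ω z w) (h' : IsKummerNorm M ω z w') :
    IsKummerNorm M ω z (w * w') := by
  intro y g hy hg hgy
  obtain ⟨b, hb, rfl⟩ := h y g hy hg hgy
  obtain ⟨b', hb', rfl⟩ := h' y g hy hg hgy
  exact ⟨b * b', mul_mem hb hb', by simp [Finset.prod_mul_distrib]⟩

theorem zpow_right (h : IsKummerNorm M ω z w) (k : ℤ) : IsKummerNorm M ω z (w ^ k) := by
  intro y g hy hg hgy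
  obtain ⟨b, hb, rfl⟩ := h y g hy hg hgy
  exact ⟨b ^ k, zpow_mem hb k, by simp [Finset.prod_zpow]⟩

theorem of_pow_right (z : Ω) (hc : c ∈ M) : IsKummerNorm M ω z (c ^ p) := by
  intro y g hy hg hgy
  refine ⟨c, mem_adjoinElem_of_mem _ hc, ?_⟩
  rw [Finset.prod_congr rfl fun i _ => galois_pow_fixed (hg c hc) i]
  simp

theorem congr_left (h : IsKummerNorm M ω z w) (hc : c ∈ M) (hc0 : c ≠ 0) :
    IsKummerNorm M ω (z * c ^ p) w := by
  intro y g hy hg hgy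
  obtain ⟨b, hb, hbw⟩ := h (y / c) g (by rw [div_pow, hy]; field_simp) hg
    (by rw [map_div₀, hg c hc, hgy]; ring)
  refine ⟨b, ?_, hbw⟩
  exact adjoinElem_le (fun a ha => mem_adjoinElem_of_mem _ ha)
    (div_mem (self_mem_adjoinElem _ _) (mem_adjoinElem_of_mem _ hc)) hb

variable (hω : IsPrimitiveRoot ω p) (hωM : ω ∈ M)
include hω hωM

theorem of_pow_left (w : Ω) (hc : c ∈ M) (hc0 : c ≠ 0) : IsKummerNorm M ω (c ^ p) w := by
  intro y g hy hg hgy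
  exfalso
  have : NeZero p := ⟨hp.out.ne_zero⟩
  obtain ⟨i, -, hi⟩ := hω.eq_pow_of_pow_eq_one (ξ := y / c)
    (by rw [div_pow, hy, div_self (pow_ne_zero _ hc0)])
  have hyM : y ∈ M := by
    have : y = ω ^ i * c := by rw [hi]; field_simp
    rw [this]; exact mul_mem (pow_mem hωM _) hc
  have hy0 : y ≠ 0 := by
    rintro rfl
    rw [zero_pow hp.out.ne_zero] at hy
    exact pow_ne_zero _ hc0 hy.symm
  rw [hg y hyM] at hgy
  exact hω.ne_one hp.out.one_lt (mul_right_cancel₀ hy0 (by rw [← hgy, one_mul]))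

theorem one_sub (z : Ω) : IsKummerNorm M ω z (1 - z) := by
  intro y g hy hg hgy
  refine ⟨1 - y, sub_mem (one_mem _) (self_mem_adjoinElem _ _), ?_⟩
  simp only [map_sub, map_one, galois_pow_kummer (hg _ hωM) hgy]
  rw [prod_range_sub_primitiveRoot_mul hp.out.pos hω, one_pow, hy]

theorem self (hp2 : Odd p) (z : Ω) : IsKummerNorm M ω z z := by
  intro y g hy hg hgy
  refine ⟨y, self_mem_adjoinElem _ _, ?_⟩
  simp only [galois_pow_kummer (hg _ hωM) hgy]
  have := prod_range_sub_primitiveRoot_mul hp.out.pos hω 0 y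
  simp only [zero_sub, Finset.prod_neg, Finset.card_range, hp2.neg_one_pow, hy,
    zero_pow hp.out.ne_zero, neg_one_mul, neg_inj] at this
  exact this

theorem symm (hp2 : Odd p) (hz : z ∈ M) (hz0 : z ≠ 0) (hw : w ∈ M) (hw0 : w ≠ 0)
    (h : IsKummerNorm M ω z w) : IsKummerNorm M ω w z := by
  intro v h' hv hh' hh'v
  have hpp := hp.out.pos
  have : NeZero p := ⟨hpp.ne'⟩
  have hroot : ∀ a b : Ω, b ≠ 0 → a ^ p = b ^ p → ∃ i < p, a = ω ^ i * b := by
    intro a b hb hab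
    obtain ⟨i, hi, h1⟩ := hω.eq_pow_of_pow_eq_one (ξ := a / b)
      (by rw [div_pow, hab, div_self (pow_ne_zero _ hb)])
    exact ⟨i, hi, by rw [h1]; field_simp⟩
  have hv0 : v ≠ 0 := by
    rintro rfl; rw [zero_pow hpp.ne'] at hv; exact hw0 hv.symm
  obtain ⟨y, hy⟩ := IsAlgClosed.exists_pow_nat_eq z hpp
  have hy0 : y ≠ 0 := by
    rintro rfl; rw [zero_pow hpp.ne'] at hy; exact hz0 hy.symm
  have hgal : ∀ f : Gal(Ω/ℚ_[p]), (∀ a ∈ M, f a = a) → ∃ i < p, f y = ω ^ i * y := fun f hf =>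
    hroot _ _ hy0 (by rw [← map_pow, hy, hf z hz])
  by_cases hyv : y ∈ adjoinElem M v
  · obtain ⟨j, -, hj⟩ := hgal h' hh'
    have ht : y / v ^ j ∈ M := by
      refine mem_of_galois_fixed hh' (fun f hf => ?_)
        (div_mem hyv (pow_mem (self_mem_adjoinElem _ _) j)) ?_
      · obtain ⟨i, -, hi⟩ := exists_galois_eq_pow_kummer hpp hω hωM (by rwa [hv]) hh' hh'v f hf
        exact ⟨i, hi⟩
      · rw [map_div₀, map_pow, hj, hh'v, mul_pow, mul_div_mul_left _ _
          (pow_ne_zero _ (hω.ne_zero hpp.ne'))]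
    have hz' : z = w ^ (j : ℤ) * (y / v ^ j) ^ p := by
      rw [← hy, ← hv, zpow_natCast, div_pow, ← pow_mul, ← pow_mul, mul_comm p j,
        mul_div_cancel₀ _ (pow_ne_zero _ hv0)]
    rw [hz']
    exact ((self hω hωM hp2 w).zpow_right j).mul_right (of_pow_right w ht) v h' hv hh' hh'v
  · obtain ⟨g, hg, hgy⟩ : ∃ g : Gal(Ω/ℚ_[p]), (∀ a ∈ adjoinElem M v, g a = a) ∧ g y = ω * y := by
      rw [mem_iff_fixed] at hyv
      push Not at hyv
      obtain ⟨g, hg, hgy⟩ := hyv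
      have hgM : ∀ a ∈ M, g a = a := fun a ha => hg a (mem_adjoinElem_of_mem _ ha)
      obtain ⟨j, hjp, hj⟩ := hgal g hgM
      have hj0 : j ≠ 0 := by rintro rfl; exact hgy (by simpa using hj)
      have hcop : Nat.Coprime j p := Nat.Coprime.symm ((Nat.Prime.coprime_iff_not_dvd hp.out).2
        (Nat.not_dvd_of_pos_of_lt (Nat.pos_of_ne_zero hj0) hjp))
      obtain ⟨m, hm⟩ := Nat.exists_mul_mod_eq_one_of_coprime hcop hp.out.one_lt
      refine ⟨g ^ m, fun a ha => galois_pow_fixed (hg a ha) m, ?_⟩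
      rw [galois_pow_kummer (ω := ω ^ j) (by rw [map_pow, hgM _ hωM]) hj, ← pow_mul,
        ← Nat.div_add_mod (j * m) p, hm.2, pow_add, pow_mul, hω.pow_eq_one, one_pow, one_mul,
        pow_one]
    have hgM : ∀ a ∈ M, g a = a := fun a ha => hg a (mem_adjoinElem_of_mem _ ha)
    have hgv : g v = v := hg v (self_mem_adjoinElem _ _)
    obtain ⟨f, hf, hfv, hfy⟩ : ∃ f : Gal(Ω/ℚ_[p]), (∀ a ∈ M, f a = a) ∧ f v = ω * v ∧ f y = y := by
      obtain ⟨i, hip, hi⟩ := hgal h' hh'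
      refine ⟨h' * g ^ (p - i), fun a ha => ?_, ?_, ?_⟩
      · rw [AlgEquiv.mul_apply, galois_pow_fixed (hgM a ha), hh' a ha]
      · rw [AlgEquiv.mul_apply, galois_pow_fixed hgv, hh'v]
      · rw [AlgEquiv.mul_apply, galois_pow_kummer (hgM _ hωM) hgy, map_mul, map_pow, hh' _ hωM, hi,
          ← mul_assoc, ← pow_add, Nat.sub_add_cancel hip.le, hω.pow_eq_one, one_mul]
    obtain ⟨b, hb, hbw⟩ := h y g hy hgM hgy
    set A := adjoinElem (adjoinElem M v) y with hAdef
    have hvA : v ∈ A := mem_adjoinElem_of_mem _ (self_mem_adjoinElem _ _)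
    have hyA : y ∈ A := self_mem_adjoinElem _ _
    have hMA : ∀ a ∈ M, a ∈ A := fun a ha => mem_adjoinElem_of_mem _ (mem_adjoinElem_of_mem _ ha)
    have hωA := hMA _ hωM
    have hbA : b ∈ A := adjoinElem_le (K := A) hMA hyA hb
    have hgA : ∀ a ∈ A, g a ∈ A := fun a ha => galois_mem_adjoinElem
      (fun c hc => by rw [hg c hc]; exact mem_adjoinElem_of_mem _ hc)
      (by rw [hgy]; exact mul_mem hωA hyA) ha
    have hfA : ∀ a ∈ A, f a ∈ A := fun a ha => galois_mem_adjoinElem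
      (fun c hc => galois_mem_adjoinElem (fun e he => by rw [hf e he]; exact hMA e he)
        (by rw [hfv]; exact mul_mem hωA hvA) hc) (by rw [hfy]; exact hyA) ha
    have hgp : ∀ a ∈ A, (g ^ p) a = a := fun a ha =>
      galois_eqOn_adjoinElem (h := 1) (fun c hc => galois_pow_fixed (hg c hc) p)
        (by rw [galois_pow_kummer (hgM _ hωM) hgy, hω.pow_eq_one, one_mul]; rfl) ha
    have hfp : ∀ a ∈ A, (f ^ p) a = a := fun a ha =>
      galois_eqOn_adjoinElem (h := 1) (fun c hc => galois_eqOn_adjoinElem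
        (fun e he => galois_pow_fixed (hf e he) p)
        (by rw [galois_pow_kummer (hf _ hωM) hfv, hω.pow_eq_one, one_mul]; rfl) hc)
        (galois_pow_fixed hfy p) ha
    have hcomm : ∀ a ∈ A, g (f a) = f (g a) := fun a ha => by
      rw [← AlgEquiv.mul_apply, ← AlgEquiv.mul_apply]
      refine galois_eqOn_adjoinElem (fun c hc => galois_eqOn_adjoinElem (fun e he => ?_) ?_ hc) ?_ ha
      · rw [AlgEquiv.mul_apply, AlgEquiv.mul_apply, hf e he, hgM e he, hf e he]
      · rw [AlgEquiv.mul_apply, AlgEquiv.mul_apply, hfv, map_mul, hgv, hgM _ hωM, hfv]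
      · rw [AlgEquiv.mul_apply, AlgEquiv.mul_apply, hfy, hgy, map_mul, hf _ hωM, hfy]
    have hinj : Set.InjOn (fun i : ℕ => (g ^ i) y) (Set.Iio p) := by
      intro i hi j hj hij
      simp only [galois_pow_kummer (hgM _ hωM) hgy] at hij
      exact hω.pow_inj hi hj (mul_right_cancel₀ hy0 hij)
    obtain ⟨β, hβ, hβ0, hgβ⟩ := exists_eq_mul_of_prod_eq_one A g hgA hgp hyA hinj hpp
      (c := b / v) (div_mem hbA hvA) (by
        simp only [map_div₀, Finset.prod_div_distrib, hbw, galois_pow_fixed hgv]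
        rw [Finset.prod_const, Finset.card_range, hv, div_self hw0])
    have hfb : f b = b := galois_eqOn_adjoinElem (h := 1) hf hfy hb
    have hb0 : b ≠ 0 := by
      rintro rfl
      simp [hpp.ne'] at hbw
      exact hw0 hbw.symm
    have hω0 := hω.ne_zero hpp.ne'
    have hfβ0 : f β ≠ 0 := by simpa using hβ0
    refine ⟨y * (f β / β), ?_, ?_⟩
    · refine mem_of_galois_fixed (θ := y) hg (fun e he => ?_)
        (mul_mem hyA (div_mem (hfA β hβ) hβ)) ?_
      · obtain ⟨i, -, hi⟩ := exists_galois_eq_pow_kummer hpp hω (mem_adjoinElem_of_mem v hωM)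
          (by rw [hy]; exact mem_adjoinElem_of_mem _ hz) hg hgy e he
        exact ⟨i, hi⟩
      · rw [map_mul, map_div₀, hcomm β hβ, hgβ, hgy, map_mul, map_div₀, hfb, hfv]
        field_simp
    · have hagree : ∀ i : ℕ, (h' ^ i) (y * (f β / β)) = (f ^ i) (y * (f β / β)) := by
        intro i
        have hmem : y * (f β / β) ∈ adjoinElem M v := by
          refine mem_of_galois_fixed (θ := y) hg (fun e he => ?_)
            (mul_mem hyA (div_mem (hfA β hβ) hβ)) ?_
          · obtain ⟨i, -, hi⟩ := exists_galois_eq_pow_kummer hpp hω (mem_adjoinElem_of_mem v hωM)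
              (by rw [hy]; exact mem_adjoinElem_of_mem _ hz) hg hgy e he
            exact ⟨i, hi⟩
          · rw [map_mul, map_div₀, hcomm β hβ, hgβ, hgy, map_mul, map_div₀, hfb, hfv]
            field_simp
        refine galois_eqOn_adjoinElem (fun a ha => ?_) ?_ hmem
        · rw [galois_pow_fixed (hh' a ha), galois_pow_fixed (hf a ha)]
        · rw [galois_pow_kummer (hh' _ hωM) hh'v, galois_pow_kummer (hf _ hωM) hfv]
      rw [Finset.prod_congr rfl fun i _ => hagree i]
      simp only [map_mul, map_div₀, Finset.prod_mul_distrib, Finset.prod_div_distrib,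
        galois_pow_fixed hfy]
      have h1 : ∏ i ∈ Finset.range p, (f ^ i) (f β) = ∏ i ∈ Finset.range p, (f ^ i) β := by
        conv_rhs => rw [← galois_prod_shift (hfp β hβ), map_prod]
        refine Finset.prod_congr rfl fun i _ => ?_
        rw [← galois_pow_succ_apply, galois_pow_succ_apply']
      rw [h1, div_self, Finset.prod_const, Finset.card_range, hy, mul_one]
      exact Finset.prod_ne_zero_iff.2 fun i _ => (_root_.map_ne_zero _).2 hβ0

end IsKummerNorm
end Symbol

section SymbolTrivial

variable {p : ℕ} [hp : Fact p.Prime] {Ω : Type*} [NormedField Ω] [NormedAlgebra ℚ_[p] Ω]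
  [IsUltrametricDist Ω] [Algebra.IsAlgebraic ℚ_[p] Ω] [IsAlgClosed Ω]
  {M : IntermediateField ℚ_[p] Ω} {ω : Ω}

theorem exists_eq_zpow_mul_tameRoot_mul {π : Ω} (hπ : π ∈ M) (hπ0 : 0 < ‖π‖)
    (hdisc : ∀ x ∈ M, x ≠ 0 → ∃ k : ℤ, ‖x‖ = ‖π‖ ^ k) (hW : tameRoots p Ω ⊆ M) {x : Ω}
    (hx : x ∈ M) (hx0 : x ≠ 0) :
    ∃ k : ℤ, ∃ τ ∈ tameRoots p Ω, ∃ b ∈ M, ‖b‖ < 1 ∧ x = π ^ k * τ * (1 - b) := by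
  obtain ⟨k, hk⟩ := hdisc x hx hx0
  obtain ⟨τ, hτ, h⟩ := exists_tameRoots_mul_norm_sub_lt (p := p) (a := π ^ k) hx0
    (by rw [hk, norm_zpow])
  have hπ' : π ≠ 0 := norm_pos_iff.1 hπ0
  have hτ0 := tameRoots_ne_zero hτ
  have hne : π ^ k * τ ≠ 0 := mul_ne_zero (zpow_ne_zero _ hπ') hτ0
  refine ⟨k, τ, hτ, 1 - x / (π ^ k * τ), sub_mem (one_mem _) (div_mem hx
    (mul_mem (zpow_mem hπ k) (hW hτ))), ?_, ?_⟩
  · have : 1 - x / (π ^ k * τ) = -(x - τ * π ^ k) / (π ^ k * τ) := by field_simp; ring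
    rw [this, norm_div, norm_neg, norm_mul, tameRoots_norm hτ, mul_one]
    exact (div_lt_one (norm_pos_iff.2 (zpow_ne_zero _ hπ'))).2 h
  · rw [sub_sub_cancel, mul_div_cancel₀ _ hne]

theorem norm_le_pow_succ_of_norm_lt {π : Ω} (hπ0 : 0 < ‖π‖) (hπ1 : ‖π‖ < 1)
    (hdisc : ∀ x ∈ M, x ≠ 0 → ∃ k : ℤ, ‖x‖ = ‖π‖ ^ k) {x : Ω} (hx : x ∈ M) {s : ℕ}
    (h : ‖x‖ < ‖π‖ ^ s) : ‖x‖ ≤ ‖π‖ ^ (s + 1) := by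
  rcases eq_or_ne x 0 with rfl | hx0
  · simp only [norm_zero]; positivity
  obtain ⟨k, hk⟩ := hdisc x hx hx0
  rw [hk, ← zpow_natCast, zpow_lt_zpow_iff_right_of_lt_one₀ hπ0 hπ1] at h
  rw [hk, ← zpow_natCast, zpow_le_zpow_iff_right_of_lt_one₀ hπ0 hπ1]
  push_cast; omega

namespace IsKummerNorm

theorem mul_left (hω : IsPrimitiveRoot ω p) (hωM : ω ∈ M) (hp2 : Odd p) {z z' w : Ω}
    (hz : z ∈ M) (hz0 : z ≠ 0) (hz' : z' ∈ M) (hz0' : z' ≠ 0) (hw : w ∈ M) (hw0 : w ≠ 0)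
    (h : IsKummerNorm M ω z w) (h' : IsKummerNorm M ω z' w) : IsKummerNorm M ω (z * z') w :=
  ((h.symm hω hωM hp2 hz hz0 hw hw0).mul_right (h'.symm hω hωM hp2 hz' hz0' hw hw0)).symm hω hωM
    hp2 hw hw0 (mul_mem hz hz') (mul_ne_zero hz0 hz0')

theorem tameRoot_right (hW : tameRoots p Ω ⊆ M) (z : Ω) {τ : Ω} (hτ : τ ∈ tameRoots p Ω) :
    IsKummerNorm M ω z τ := by
  obtain ⟨τ', hτ', rfl⟩ := tameRoots_exists_pth_root hτ
  exact of_pow_right z (hW hτ')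

theorem of_norm_sub_one_eq (hω : IsPrimitiveRoot ω p) (hωM : ω ∈ M) (hp2 : Odd p)
    (hW : tameRoots p Ω ⊆ M) {π : Ω} (hπ : π ∈ M) (hπ0 : 0 < ‖π‖) (hπ1 : ‖π‖ < 1)
    (hdisc : ∀ x ∈ M, x ≠ 0 → ∃ k : ℤ, ‖x‖ = ‖π‖ ^ k) {s : ℕ} (hs : ¬ p ∣ s)
    (ih : ∀ u ∈ M, ‖u - 1‖ < ‖π‖ ^ s → ∀ z ∈ M, z ≠ 0 → IsKummerNorm M ω u z)
    {u : Ω} (hu : u ∈ M) (hus : ‖u - 1‖ = ‖π‖ ^ s) {z : Ω} (hz : z ∈ M) (hz0 : z ≠ 0) :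
    IsKummerNorm M ω u z := by
  have hs0 : s ≠ 0 := by rintro rfl; exact hs (dvd_zero p)
  have hπs : ‖π‖ ^ s < 1 := pow_lt_one₀ hπ0.le hπ1 hs0
  have hπne : π ≠ 0 := norm_pos_iff.1 hπ0
  have hπspos : 0 < ‖π‖ ^ s := by positivity
  -- a close approximation of `u` of the form `1 - a` gives the symbol of `u` and `a`
  have key : ∀ a ∈ M, a ≠ 0 → ‖a‖ ≤ ‖π‖ ^ s → ‖u - (1 - a)‖ < ‖π‖ ^ s →
      IsKummerNorm M ω u a := by
    intro a ha ha0 has h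
    have hn : ‖1 - a‖ = 1 := norm_eq_one_of_norm_sub_lt
      (by rw [sub_sub_cancel_left, norm_neg]; exact has.trans_lt hπs)
    have h1a : 1 - a ≠ 0 := norm_pos_iff.1 (by rw [hn]; exact one_pos)
    have h1aM : 1 - a ∈ M := sub_mem (one_mem _) ha
    have hu0 : u ≠ 0 := by
      have : ‖u‖ = 1 := norm_eq_one_of_norm_sub_lt (by rw [hus]; exact hπs)
      exact norm_pos_iff.1 (by rw [this]; exact one_pos)
    have h1 : IsKummerNorm M ω (1 - a) a := by simpa using one_sub hω hωM (1 - a)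
    have h2 : IsKummerNorm M ω (u / (1 - a)) a := by
      refine ih _ (div_mem hu h1aM) ?_ a ha ha0
      rw [div_sub_one h1a, norm_div, hn, div_one]; exact h
    have := h1.mul_left hω hωM hp2 h1aM h1a (div_mem hu h1aM) (div_ne_zero hu0 h1a) ha ha0 h2
    rwa [mul_div_cancel₀ _ h1a] at this
  have hπu : IsKummerNorm M ω u π := by
    have hne : 1 - u ≠ 0 := norm_pos_iff.1 (by rw [norm_sub_rev, hus]; exact hπspos)
    obtain ⟨τ, hτ, h⟩ := exists_tameRoots_mul_norm_sub_lt (p := p) (u := 1 - u) (a := π ^ s) hne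
      (by rw [norm_sub_rev, hus, norm_pow])
    have hτ0 := tameRoots_ne_zero hτ
    have h1 : IsKummerNorm M ω u (τ * π ^ s) := key _ (mul_mem (hW hτ) (pow_mem hπ s))
      (mul_ne_zero hτ0 (pow_ne_zero _ hπne))
      (by rw [norm_mul, tameRoots_norm hτ, one_mul, norm_pow]) (by
        rw [norm_pow] at h
        have : u - (1 - τ * π ^ s) = -(1 - u - τ * π ^ s) := by ring
        rwa [this, norm_neg])
    have h2 : IsKummerNorm M ω u (π ^ s) := by
      have := h1.mul_right ((tameRoot_right (ω := ω) hW u hτ).zpow_right (-1))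
      convert this using 1; field_simp
    have h3 : IsKummerNorm M ω u (π ^ p) := of_pow_right u hπ
    have hcop : IsCoprime (s : ℤ) (p : ℤ) := Nat.isCoprime_iff_coprime.2
      (Nat.Coprime.symm ((Nat.Prime.coprime_iff_not_dvd hp.out).2 hs))
    obtain ⟨A, B, hAB⟩ := hcop
    have := (h2.zpow_right A).mul_right (h3.zpow_right B)
    rwa [← zpow_natCast, ← zpow_natCast, ← zpow_mul, ← zpow_mul, ← zpow_add₀ hπne, mul_comm (s : ℤ),
      mul_comm (p : ℤ), hAB, zpow_one] at this
  obtain ⟨k, τ, hτ, b, hb, hb1, rfl⟩ := exists_eq_zpow_mul_tameRoot_mul hπ hπ0 hdisc hW hz hz0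
  refine ((hπu.zpow_right k).mul_right (tameRoot_right hW u hτ)).mul_right ?_
  have hane : 1 - u ≠ 0 := norm_pos_iff.1 (by rw [norm_sub_rev, hus]; exact hπspos)
  have haM : 1 - u ∈ M := sub_mem (one_mem _) hu
  have hbn : ‖1 - b‖ = 1 := norm_eq_one_of_norm_sub_lt
    (by rw [sub_sub_cancel_left, norm_neg]; exact hb1)
  have hb0 : 1 - b ≠ 0 := norm_pos_iff.1 (by rw [hbn]; exact one_pos)
  have h1 : IsKummerNorm M ω u (1 - u) := one_sub hω hωM u
  have h2 : IsKummerNorm M ω u ((1 - u) * (1 - b)) := by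
    refine key _ (mul_mem haM (sub_mem (one_mem _) hb)) (mul_ne_zero hane hb0) ?_ ?_
    · rw [norm_mul, hbn, mul_one, norm_sub_rev, hus]
    · have : u - (1 - (1 - u) * (1 - b)) = (u - 1) * b := by ring
      rw [this, norm_mul, hus]
      exact mul_lt_of_lt_one_right hπspos hb1
  have := h2.mul_right (h1.zpow_right (-1))
  convert this using 1
  rw [zpow_neg_one]; field_simp

theorem of_norm_sub_one_le (hω : IsPrimitiveRoot ω p) (hωM : ω ∈ M) (hp2 : Odd p)
    (hW : tameRoots p Ω ⊆ M) {π : Ω} (hπ : π ∈ M) (hπ0 : 0 < ‖π‖) (hπ1 : ‖π‖ < 1)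
    (hdisc : ∀ x ∈ M, x ≠ 0 → ∃ k : ℤ, ‖x‖ = ‖π‖ ^ k) (s : ℕ) :
    ∀ u ∈ M, ‖u - 1‖ ≤ ‖π‖ ^ (s + 1) → ∀ z ∈ M, z ≠ 0 → IsKummerNorm M ω u z := by
  have hω1 : 0 < ‖1 - ω‖ := norm_pos_iff.2
    (sub_ne_zero.2 (hω.ne_one hp.out.one_lt).symm)
  have base : ∀ u ∈ M, u ≠ 0 → ‖u - 1‖ ≤ ‖1 - ω‖ ^ p → ∀ z ∈ M, z ≠ 0 →
      IsKummerNorm M ω u z := by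
    intro u hu hu0 h z _ _
    obtain ⟨t, ht, rfl⟩ := exists_pth_root M hW hω hωM hu h
    exact of_pow_left hω hωM z ht (by rintro rfl; exact hu0 (zero_pow hp.out.ne_zero))
  obtain ⟨N, hN⟩ := exists_pow_lt_of_lt_one (pow_pos hω1 p) hπ1
  have hne : ∀ u : Ω, ∀ s : ℕ, ‖u - 1‖ ≤ ‖π‖ ^ (s + 1) → u ≠ 0 := by
    rintro u s h rfl
    have := h.trans_lt (pow_lt_one₀ hπ0.le hπ1 s.succ_ne_zero)
    simp at this
  have main : ∀ d s, N ≤ s + d → ∀ u ∈ M, ‖u - 1‖ ≤ ‖π‖ ^ (s + 1) → ∀ z ∈ M, z ≠ 0 →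
      IsKummerNorm M ω u z := by
    intro d
    induction d with
    | zero =>
      intro s hs u hu h
      exact base u hu (hne u s h) (h.trans ((pow_le_pow_of_le_one hπ0.le hπ1.le
        ((show N ≤ s from hs).trans s.le_succ)).trans hN.le))
    | succ d ihd =>
      intro s hs u hu h z hz hz0
      have ih : ∀ u ∈ M, ‖u - 1‖ < ‖π‖ ^ (s + 1) → ∀ z ∈ M, z ≠ 0 → IsKummerNorm M ω u z :=
        fun u hu h => ihd (s + 1) (by omega) u hu
          (norm_le_pow_succ_of_norm_lt hπ0 hπ1 hdisc (sub_mem hu (one_mem _)) h)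
      rcases h.lt_or_eq with h | h
      · exact ih u hu h z hz hz0
      by_cases hps : p ∣ s + 1
      · rcases le_or_gt ‖u - 1‖ (‖1 - ω‖ ^ p) with hle | hlt
        · exact base u hu (hne u s h.le) hle z hz hz0
        obtain ⟨t, ht⟩ := hps
        rw [h] at hlt
        have hπ' : 0 < ‖π‖ ^ (s + 1) := pow_pos hπ0 _
        obtain ⟨τ, hτ, h2⟩ := exists_tameRoots_mul_norm_sub_lt (p := p) (u := u - 1)
          (a := π ^ (s + 1)) (norm_pos_iff.1 (by rw [h]; exact hπ')) (by rw [h, norm_pow])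
        obtain ⟨τ', hτ', rfl⟩ := tameRoots_exists_pth_root hτ
        set α := τ' * π ^ t with hα
        have hαM : α ∈ M := mul_mem (hW hτ') (pow_mem hπ t)
        have hαp : α ^ p = τ' ^ p * π ^ (s + 1) := by
          rw [hα, mul_pow, ← pow_mul, ht, mul_comm t p]
        have hαn : ‖α‖ = ‖π‖ ^ t := by rw [hα, norm_mul, tameRoots_norm hτ', one_mul, norm_pow]
        have hαpn : ‖α‖ ^ p = ‖π‖ ^ (s + 1) := by rw [hαn, ← pow_mul, ht, mul_comm t p]
        have ht0 : t ≠ 0 := by rintro rfl; simp at ht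
        have hα1 : ‖α‖ < 1 := by rw [hαn]; exact pow_lt_one₀ hπ0.le hπ1 ht0
        have hα0 : 0 < ‖α‖ := by rw [hαn]; exact pow_pos hπ0 _
        have hωα : ‖1 - ω‖ < ‖α‖ := lt_of_pow_lt_pow_left₀ p hα0.le (by rw [hαpn]; exact hlt)
        obtain ⟨w, hw, hpow⟩ := exists_one_add_pow_prime hp.out hα1.le
        have hpα : ‖(p : Ω)‖ * ‖α‖ < ‖α‖ ^ p := by
          rw [← norm_one_sub_primitive_pow hω]
          conv_rhs => rw [← Nat.sub_add_cancel hp.out.one_le, pow_succ]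
          exact mul_lt_mul_of_pos_right (pow_lt_pow_left₀ hωα hω1.le
            (Nat.sub_pos_of_lt hp.out.one_lt).ne') hα0
        have hdiff : ‖u - (1 + α) ^ p‖ < ‖π‖ ^ (s + 1) := by
          have : u - (1 + α) ^ p = (u - 1 - τ' ^ p * π ^ (s + 1)) - p * α * w := by
            rw [hpow, hαp]; ring
          rw [this]
          rw [norm_pow] at h2
          refine norm_sub_lt_of_lt h2 ?_
          rw [← hαpn, norm_mul, norm_mul]
          exact (mul_le_of_le_one_right (by positivity) hw).trans_lt hpα
        have hn1 : ‖1 + α‖ = 1 := norm_eq_one_of_norm_sub_lt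
          (by rwa [add_sub_cancel_left])
        have h10 : 1 + α ≠ 0 := norm_pos_iff.1 (by rw [hn1]; exact one_pos)
        have h1M : 1 + α ∈ M := add_mem (one_mem _) hαM
        have hρ := ih (u / (1 + α) ^ p) (div_mem hu (pow_mem h1M p)) (by
          rw [div_sub_one (pow_ne_zero _ h10), norm_div, norm_pow, hn1, one_pow, div_one]
          exact hdiff) z hz hz0
        have := hρ.congr_left h1M h10
        rwa [div_mul_cancel₀ _ (pow_ne_zero _ h10)] at this
      · exact of_norm_sub_one_eq hω hωM hp2 hW hπ hπ0 hπ1 hdisc hps ih hu h hz hz0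
  exact main N s (Nat.le_add_left _ _)

/-- Over a discretely valued field containing all roots of unity of order prime to `p`, every
element is a norm from every Kummer extension of degree `p`. -/
theorem of_tameRoots_subset (hω : IsPrimitiveRoot ω p) (hωM : ω ∈ M) (hp2 : Odd p)
    (hW : tameRoots p Ω ⊆ M) (hM : IsDiscreteSubfield p M) {z w : Ω} (hz : z ∈ M) (hz0 : z ≠ 0)
    (hw : w ∈ M) (hw0 : w ≠ 0) : IsKummerNorm M ω z w := by
  obtain ⟨π, hπ, hπ0, hπ1, hdisc⟩ := hM.exists_uniformizer
  have hπne : π ≠ 0 := norm_pos_iff.1 hπ0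
  have hunit : ∀ b ∈ M, ‖b‖ < 1 → ∀ x ∈ M, x ≠ 0 → IsKummerNorm M ω x (1 - b) := by
    intro b hb hb1 x hx hx0
    have hne : 1 - b ≠ 0 := sub_ne_zero.2 (by rintro rfl; simp at hb1)
    refine (of_norm_sub_one_le hω hωM hp2 hW hπ hπ0 hπ1 hdisc 0 _ (sub_mem (one_mem _) hb) ?_
      x hx hx0).symm hω hωM hp2 (sub_mem (one_mem _) hb) hne hx hx0
    exact norm_le_pow_succ_of_norm_lt hπ0 hπ1 hdisc (sub_mem (sub_mem (one_mem _) hb) (one_mem _))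
      (by simpa using hb1)
  have hππ : ∀ x ∈ M, x ≠ 0 → IsKummerNorm M ω π x := by
    intro x hx hx0
    obtain ⟨k, τ, hτ, b, hb, hb1, rfl⟩ := exists_eq_zpow_mul_tameRoot_mul hπ hπ0 hdisc hW hx hx0
    exact (((self hω hωM hp2 π).zpow_right k).mul_right (tameRoot_right hW _ hτ)).mul_right
      (hunit b hb hb1 π hπ hπne)
  obtain ⟨k, τ, hτ, b, hb, hb1, rfl⟩ := exists_eq_zpow_mul_tameRoot_mul hπ hπ0 hdisc hW hw hw0
  exact ((((hππ z hz hz0).symm hω hωM hp2 hπ hπne hz hz0).zpow_right k).mul_right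
    (tameRoot_right hW _ hτ)).mul_right (hunit b hb hb1 z hz hz0)

end IsKummerNorm

theorem Finset.prod_range_mul_eq {α : Type*} [CommMonoid α] (f : ℕ → α) (a b : ℕ) :
    ∏ m ∈ Finset.range (a * b), f m =
      ∏ i ∈ Finset.range a, ∏ j ∈ Finset.range b, f (i + a * j) := by
  rw [Finset.prod_comm]
  induction b with
  | zero => simp
  | succ b ih =>
    rw [Nat.mul_succ, Finset.prod_range_add, ih, Finset.prod_range_succ]
    simp [add_comm]

/-- Over a discretely valued field containing all roots of unity of order prime to `p`, every
element is a norm from every Kummer extension of degree `p ^ k`. -/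
theorem exists_prod_galois_eq_of_tameRoots_subset (hp2 : Odd p) (k : ℕ) :
    ∀ {M : IntermediateField ℚ_[p] Ω} (_ : tameRoots p Ω ⊆ M) (_ : IsDiscreteSubfield p M)
      {ω y : Ω} {g : Gal(Ω/ℚ_[p])} (_ : IsPrimitiveRoot ω (p ^ k)) (_ : ω ∈ M)
      (_ : ∀ a ∈ M, g a = a) (_ : g y = ω * y) (_ : y ≠ 0) (_ : y ^ p ^ k ∈ M) {w : Ω}
      (_ : w ∈ M) (_ : w ≠ 0), ∃ b ∈ adjoinElem M y, ∏ i ∈ Finset.range (p ^ k), (g ^ i) b = w := by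
  induction k with
  | zero =>
    intro M _ _ ω y g _ _ _ _ _ _ w hw _
    exact ⟨w, mem_adjoinElem_of_mem _ hw, by simp⟩
  | succ k ih =>
    intro M hW hM ω y g hω hωM hg hgy hy0 hyM w hw hw0
    have hpk : p ^ k ≠ 0 := pow_ne_zero _ hp.out.ne_zero
    have hω1 : IsPrimitiveRoot (ω ^ p ^ k) p :=
      hω.pow (Nat.pos_of_ne_zero (pow_ne_zero _ hp.out.ne_zero)) (pow_succ _ _)
    have hωp : IsPrimitiveRoot (ω ^ p) (p ^ k) :=
      hω.pow (Nat.pos_of_ne_zero (pow_ne_zero _ hp.out.ne_zero)) (pow_succ' _ _)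
    have hgy1 : g (y ^ p ^ k) = ω ^ p ^ k * y ^ p ^ k := by rw [map_pow, hgy, mul_pow]
    have hy1 : (y ^ p ^ k) ^ p ∈ M := by rwa [← pow_mul, ← pow_succ]
    obtain ⟨b₁, hb₁, hprod⟩ := IsKummerNorm.of_tameRoots_subset hω1 (pow_mem hωM _) hp2 hW hM hy1
      (pow_ne_zero _ (pow_ne_zero _ hy0)) hw hw0 (y ^ p ^ k) g rfl hg hgy1
    have hb₁0 : b₁ ≠ 0 := by
      rintro rfl
      simp [hp.out.ne_zero] at hprod
      exact hw0 hprod.symm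
    obtain ⟨b, hb, hb1⟩ := ih (M := adjoinElem M (y ^ p ^ k))
      (fun a ha => mem_adjoinElem_of_mem _ (hW ha)) (hM.adjoin_singleton _) (g := g ^ p) hωp
      (mem_adjoinElem_of_mem _ (pow_mem hωM _)) (fun a ha => galois_eqOn_adjoinElem (h := 1)
        (fun c hc => galois_pow_fixed (hg c hc) p)
        (by rw [galois_pow_kummer (by rw [map_pow, hg _ hωM]) hgy1, hω1.pow_eq_one, one_mul]; rfl)
        ha)
      (galois_pow_kummer (hg _ hωM) hgy p) hy0 (self_mem_adjoinElem _ _) hb₁ hb₁0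
    refine ⟨b, adjoinElem_le (adjoinElem_le (fun a ha => mem_adjoinElem_of_mem _ ha)
      (pow_mem (self_mem_adjoinElem _ _) _)) (self_mem_adjoinElem _ _) hb, ?_⟩
    rw [pow_succ', Finset.prod_range_mul_eq, ← hprod]
    refine Finset.prod_congr rfl fun i _ => ?_
    rw [← hb1, map_prod]
    refine Finset.prod_congr rfl fun j _ => ?_
    rw [pow_add, pow_mul, AlgEquiv.mul_apply]

end SymbolTrivial

section NormDescent

variable {p : ℕ} [hp : Fact p.Prime] {Ω : Type*} [NormedField Ω] [NormedAlgebra ℚ_[p] Ω]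
  [IsUltrametricDist Ω] [Algebra.IsAlgebraic ℚ_[p] Ω] [IsAlgClosed Ω]

/-- The subfield fixed by an automorphism. -/
noncomputable def galoisFixed (g : Gal(Ω/ℚ_[p])) : IntermediateField ℚ_[p] Ω :=
  fixedField (Subgroup.zpowers g)

theorem mem_galoisFixed {g : Gal(Ω/ℚ_[p])} {x : Ω} : x ∈ galoisFixed g ↔ g x = x := by
  rw [galoisFixed, mem_fixedField_iff]
  refine ⟨fun h => h g (Subgroup.mem_zpowers g), fun h f hf => ?_⟩
  have : Subgroup.zpowers g ≤ MulAction.stabilizer (Gal(Ω/ℚ_[p])) x := by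
    rw [Subgroup.zpowers_le]; exact h
  exact this hf

/-- Principal units are norms from unramified extensions. -/
theorem exists_prod_galois_eq_of_norm_sub_one_lt (A : IntermediateField ℚ_[p] Ω)
    {φ : Gal(Ω/ℚ_[p])} (hA : ∀ a ∈ A, φ a ∈ A) {τ : Ω} (hτ : τ ∈ tameRoots p Ω) (hτA : τ ∈ A)
    {d : ℕ} (hd0 : 0 < d) (hd : (φ ^ d) τ = τ)
    (hinj : Set.InjOn (fun i : ℕ => (φ ^ i) τ) (Set.Iio d)) {v : Ω} (hv : v ∈ A) (hφv : φ v = v)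
    (hv1 : ‖v - 1‖ < 1) : ∃ κ ∈ A, ∏ i ∈ Finset.range d, (φ ^ i) κ = v := by
  have hpow : ∀ i, ∀ a ∈ A, (φ ^ i) a ∈ A := fun i a ha => galois_pow_mem (A := (A : Set Ω)) hA i ha
  obtain ⟨l, hl⟩ := exists_norm_trace_eq hd0 hτ hinj 1
  simp only [one_mul, norm_one] at hl
  have hdl : (φ ^ d) (τ ^ l) = τ ^ l := by rw [map_pow, hd]
  set ε := ∑ i ∈ Finset.range d, (φ ^ i) (τ ^ l) with hε
  have hεA : ε ∈ A := sum_mem fun i _ => hpow i _ (pow_mem hτA l)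
  have hφε : φ ε = ε := galois_sum_shift hdl
  have hε0 : ε ≠ 0 := norm_pos_iff.1 (by rw [hl]; exact one_pos)
  have step : ∀ x ∈ A, φ x = x → ‖x - 1‖ < 1 → ∃ κ ∈ A, (φ ^ d) κ = κ ∧
      ‖∏ i ∈ Finset.range d, (φ ^ i) κ‖ = 1 ∧
      ‖x / ∏ i ∈ Finset.range d, (φ ^ i) κ - 1‖ ≤ ‖x - 1‖ ^ 2 := by
    intro x hx hφx hx1
    set a := x - 1 with ha
    have hφa : φ a = a := by rw [ha, map_sub, hφx, map_one]
    have haA : a ∈ A := sub_mem hx (one_mem _)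
    have hP : ∀ i, (φ ^ i) (1 + a * τ ^ l / ε) = 1 + a * (φ ^ i) (τ ^ l) / ε := fun i => by
      rw [map_add, map_one, map_div₀, map_mul, galois_pow_fixed hφa, galois_pow_fixed hφε]
    have hb : ‖∏ i ∈ Finset.range d, (φ ^ i) (1 + a * τ ^ l / ε) - x‖ ≤ ‖a‖ ^ 2 := by
      have := norm_prod_one_add_sub_le (Finset.range d) (fun i => a * (φ ^ i) (τ ^ l) / ε)
        (r := ‖a‖) hx1.le (norm_nonneg _) (fun i _ => by
          rw [norm_div, hl, div_one, norm_mul, norm_galois_apply, norm_pow, tameRoots_norm hτ,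
            one_pow, mul_one])
      rw [← Finset.sum_div, ← Finset.mul_sum, ← hε, mul_div_cancel_right₀ _ hε0] at this
      simp only [hP]
      convert this using 3
      rw [ha]; ring
    have hxn : ‖x‖ = 1 := norm_eq_one_of_norm_sub_lt hx1
    have hPn : ‖∏ i ∈ Finset.range d, (φ ^ i) (1 + a * τ ^ l / ε)‖ = 1 := by
      rw [← hxn]
      refine norm_eq_of_norm_sub_lt ?_
      rw [hxn]
      exact hb.trans_lt (pow_lt_one₀ (norm_nonneg _) hx1 two_ne_zero)
    refine ⟨1 + a * τ ^ l / ε, add_mem (one_mem _) (div_mem (mul_mem haA (pow_mem hτA l)) hεA), ?_,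
      hPn, ?_⟩
    · rw [hP, hdl]
    · rw [div_sub_one (norm_pos_iff.1 (by rw [hPn]; exact one_pos)), norm_div, hPn, div_one,
        norm_sub_rev]
      exact hb
  have iter : ∀ n : ℕ, ∃ κ ∈ A, (φ ^ d) κ = κ ∧ ‖∏ i ∈ Finset.range d, (φ ^ i) κ‖ = 1 ∧
      ‖v / ∏ i ∈ Finset.range d, (φ ^ i) κ - 1‖ ≤ ‖v - 1‖ ^ (n + 1) := by
    intro n
    induction n with
    | zero => exact ⟨1, one_mem _, by simp, by simp, by simp⟩
    | succ n ih =>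
      obtain ⟨κ, hκ, hκd, hκn, h⟩ := ih
      have hPA : ∏ i ∈ Finset.range d, (φ ^ i) κ ∈ A := prod_mem fun i _ => hpow i _ hκ
      obtain ⟨κ', hκ', hκd', hκn', h'⟩ := step (v / ∏ i ∈ Finset.range d, (φ ^ i) κ)
        (div_mem hv hPA) (by rw [map_div₀, hφv, galois_prod_shift hκd])
        (h.trans_lt (pow_lt_one₀ (norm_nonneg _) hv1 n.succ_ne_zero))
      refine ⟨κ * κ', mul_mem hκ hκ', by rw [map_mul, hκd, hκd'], ?_, ?_⟩
      · simp only [map_mul, Finset.prod_mul_distrib, norm_mul, hκn, hκn', one_mul]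
      · simp only [map_mul, Finset.prod_mul_distrib, ← div_div]
        refine h'.trans ((pow_le_pow_left₀ (norm_nonneg _) h 2).trans ?_)
        rw [← pow_mul]
        exact pow_le_pow_of_le_one (norm_nonneg _) hv1.le (by omega)
  obtain ⟨δ, hδ, hroot⟩ := exists_nth_root (p := p) (Ω := Ω) d hd0
  obtain ⟨n, hn⟩ := exists_pow_lt_of_lt_one hδ hv1
  obtain ⟨κ, hκ, hκd, hκn, h⟩ := iter n
  have hP0 : ∏ i ∈ Finset.range d, (φ ^ i) κ ≠ 0 := norm_pos_iff.1 (by rw [hκn]; exact one_pos)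
  obtain ⟨t, ht, htd⟩ := hroot (A ⊓ galoisFixed φ) (v / ∏ i ∈ Finset.range d, (φ ^ i) κ)
    ⟨div_mem hv (prod_mem fun i _ => hpow i _ hκ), mem_galoisFixed.2
      (by rw [map_div₀, hφv, galois_prod_shift hκd])⟩
    ((h.trans (pow_le_pow_of_le_one (norm_nonneg _) hv1.le n.le_succ)).trans_lt hn)
  refine ⟨κ * t, mul_mem hκ ht.1, ?_⟩
  simp only [map_mul, Finset.prod_mul_distrib, galois_pow_fixed (mem_galoisFixed.1 ht.2),
    Finset.prod_const, Finset.card_range, htd]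
  rw [mul_div_cancel₀ _ hP0]

theorem exists_prod_galois_eq_pow_of_norm_eq_one (A : IntermediateField ℚ_[p] Ω)
    {φ : Gal(Ω/ℚ_[p])} (hA : ∀ a ∈ A, φ a ∈ A) {τ : Ω} (hτ : τ ∈ tameRoots p Ω) (hτA : τ ∈ A)
    {d : ℕ} (hd0 : 0 < d) (hd : (φ ^ d) τ = τ)
    (hinj : Set.InjOn (fun i : ℕ => (φ ^ i) τ) (Set.Iio d)) {v : Ω} (hv : v ∈ A) (hφv : φ v = v)
    (hv1 : ‖v‖ = 1) : ∃ N, ¬ p ∣ N ∧ ∃ κ ∈ A, ∏ i ∈ Finset.range d, (φ ^ i) κ = v ^ N := by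
  obtain ⟨N, hN, h⟩ := exists_norm_pow_sub_one_lt (p := p) hv1
  exact ⟨N, hN, exists_prod_galois_eq_of_norm_sub_one_lt A hA hτ hτA hd0 hd hinj (pow_mem hv N)
    (by rw [map_pow, hφv]) h⟩

theorem galois_fixed_of_coprime {g : Gal(Ω/ℚ_[p])} {x : Ω} {m q : ℕ} (hmq : m.Coprime q)
    (hm : (g ^ m) x = x) (hq : (g ^ q) x = x) : g x = x := by
  rcases Nat.lt_or_ge 1 q with h1 | h1
  · obtain ⟨k, -, hk⟩ := Nat.exists_mul_mod_eq_one_of_coprime hmq h1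
    have := galois_pow_fixed hm k
    rwa [← pow_mul, ← galois_pow_mod hq, hk, pow_one] at this
  · interval_cases q
    · rw [Nat.coprime_zero_right] at hmq
      simpa [hmq] using hm
    · simpa using hq

theorem prod_galois_pow_mul_coprime {g : Gal(Ω/ℚ_[p])} {x : Ω} {m q : ℕ} (hmq : m.Coprime q)
    (hq0 : 0 < q) (hq : (g ^ q) x = x) :
    ∏ i ∈ Finset.range q, (g ^ (m * i)) x = ∏ i ∈ Finset.range q, (g ^ i) x := by
  have hmaps : ∀ i ∈ Finset.range q, m * i % q ∈ Finset.range q := fun i _ =>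
    Finset.mem_range.2 (Nat.mod_lt _ hq0)
  have hinj : Set.InjOn (fun i => m * i % q) (Finset.range q) := by
    intro i hi j hj hij
    have : i ≡ j [MOD q] := Nat.ModEq.cancel_left_of_coprime (by rwa [Nat.coprime_comm] at hmq) hij
    exact this.eq_of_lt_of_lt (Finset.mem_range.1 hi) (Finset.mem_range.1 hj)
  refine Finset.prod_nbij (fun i => m * i % q) hmaps hinj
    (Finset.surjOn_of_injOn_of_card_le _ hmaps hinj le_rfl) fun i _ => (galois_pow_mod hq _).symm

/-- Descent of a norm equation along a cyclic unramified extension, twisted by an automorphism `σ`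
with `σ g = g ^ m σ`. -/
theorem exists_prod_galois_eq_twist_pow (A : IntermediateField ℚ_[p] Ω) {g φ σ : Gal(Ω/ℚ_[p])}
    (hgA : ∀ a ∈ A, g a ∈ A) (hφA : ∀ a ∈ A, φ a ∈ A) (hσA : ∀ a ∈ A, σ a ∈ A) {q d m : ℕ}
    (hq : ∀ a ∈ A, (g ^ q) a = a) (hd : ∀ a ∈ A, (φ ^ d) a = a)
    (hgφ : ∀ a ∈ A, g (φ a) = φ (g a)) (hσφ : ∀ a ∈ A, σ (φ a) = φ (σ a))
    (hσg : ∀ a ∈ A, σ (g a) = (g ^ m) (σ a)) (hmq : m.Coprime q) (hq0 : 0 < q) (hd0 : 0 < d)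
    {y η : Ω} (hyA : y ∈ A) (hyinj : Set.InjOn (fun i : ℕ => (g ^ i) y) (Set.Iio q))
    (hηA : η ∈ A) (hη : η ∈ tameRoots p Ω)
    (hηinj : Set.InjOn (fun i : ℕ => (φ ^ i) η) (Set.Iio d)) (hgη : g η = η)
    {b w : Ω} (hb : b ∈ A) (hb0 : b ≠ 0) (hw : ∏ i ∈ Finset.range q, (g ^ i) b = w)
    (hφw : φ w = w) :
    ∃ N, ¬ p ∣ N ∧ ∃ b' ∈ A, φ b' = b' ∧
      ∏ i ∈ Finset.range q, (g ^ i) b' = (σ w / w ^ m) ^ N := by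
  have hgi : ∀ i, ∀ a ∈ A, (g ^ i) a ∈ A := fun i a ha => galois_pow_mem (A := (A : Set Ω)) hgA i ha
  have hφi : ∀ i, ∀ a ∈ A, (φ ^ i) a ∈ A := fun i a ha => galois_pow_mem (A := (A : Set Ω)) hφA i ha
  have hgφi : ∀ i, ∀ a ∈ A, g ((φ ^ i) a) = (φ ^ i) (g a) := by
    intro i
    induction i with
    | zero => intro a _; simp
    | succ i ih =>
      intro a ha
      rw [galois_pow_succ_apply, galois_pow_succ_apply, hgφ _ (hφi i a ha), ih a ha]
  have hσφi : ∀ i, ∀ a ∈ A, σ ((φ ^ i) a) = (φ ^ i) (σ a) := by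
    intro i
    induction i with
    | zero => intro a _; simp
    | succ i ih =>
      intro a ha
      rw [galois_pow_succ_apply, galois_pow_succ_apply, hσφ _ (hφi i a ha), ih a ha]
  have hgiφ : ∀ i, ∀ a ∈ A, (g ^ i) (φ a) = φ ((g ^ i) a) := by
    intro i
    induction i with
    | zero => intro a _; simp
    | succ i ih =>
      intro a ha
      rw [galois_pow_succ_apply, galois_pow_succ_apply, ih a ha, hgφ _ (hgi i a ha)]
  have hgiφj : ∀ i j, ∀ a ∈ A, (φ ^ j) ((g ^ i) a) = (g ^ i) ((φ ^ j) a) := by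
    intro i j
    induction j with
    | zero => intro a _; simp
    | succ j ih =>
      intro a ha
      rw [galois_pow_succ_apply, galois_pow_succ_apply, ih a ha, hgiφ _ _ (hφi j a ha)]
  have hσgi : ∀ i, ∀ a ∈ A, σ ((g ^ i) a) = (g ^ (m * i)) (σ a) := by
    intro i
    induction i with
    | zero => intro a _; simp
    | succ i ih =>
      intro a ha
      rw [galois_pow_succ_apply, hσg _ (hgi i a ha), ih a ha, ← AlgEquiv.mul_apply, ← pow_add,
        Nat.mul_succ, add_comm]
  have hw0 : w ≠ 0 := by
    rw [← hw]; exact Finset.prod_ne_zero_iff.2 fun i _ => (_root_.map_ne_zero _).2 hb0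
  obtain ⟨β, hβ, hβ0, hgβ⟩ := exists_eq_mul_of_prod_eq_one A g hgA hq hyA hyinj hq0
    (c := φ b / b) (div_mem (hφA b hb) hb) (by
      simp only [map_div₀, Finset.prod_div_distrib, hw]
      rw [Finset.prod_congr rfl fun i _ => hgiφ i b hb, ← map_prod, hw, hφw, div_self hw0])
  set s := ∏ i ∈ Finset.range d, (φ ^ i) β with hs
  have hsA : s ∈ A := prod_mem fun i _ => hφi i β hβ
  have hs0 : s ≠ 0 := Finset.prod_ne_zero_iff.2 fun i _ => (_root_.map_ne_zero _).2 hβ0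
  have hφs : φ s = s := galois_prod_shift (hd β hβ)
  have hgs : g s = s := by
    have hN : ∏ i ∈ Finset.range d, (φ ^ i) b ≠ 0 :=
      Finset.prod_ne_zero_iff.2 fun i _ => (_root_.map_ne_zero _).2 hb0
    have h1 : ∏ i ∈ Finset.range d, (φ ^ i) (φ b) = ∏ i ∈ Finset.range d, (φ ^ i) b := by
      conv_rhs => rw [← galois_prod_shift (hd b hb), map_prod]
      exact Finset.prod_congr rfl fun i _ => by
        rw [← galois_pow_succ_apply, galois_pow_succ_apply']
    rw [hs, map_prod, Finset.prod_congr rfl fun i _ => hgφi i β hβ]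
    simp only [hgβ, map_mul, map_div₀, Finset.prod_mul_distrib, Finset.prod_div_distrib]
    rw [h1, div_self hN, mul_one]
  have hgσs : g (σ s) = σ s :=
    galois_fixed_of_coprime hmq (by rw [← hσg s hsA, hgs]) (hq _ (hσA s hsA))
  have hφσs : φ (σ s) = σ s := by rw [← hσφ s hsA, hφs]
  obtain ⟨N, hN, κ, hκ, hκN⟩ := exists_prod_galois_eq_pow_of_norm_eq_one (A ⊓ galoisFixed g)
    (φ := φ) (fun a ha => ⟨hφA a ha.1, mem_galoisFixed.2
      (by rw [hgφ a ha.1, mem_galoisFixed.1 ha.2])⟩) hη ⟨hηA, mem_galoisFixed.2 hgη⟩ hd0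
    (hd η hηA) hηinj (v := σ s / s) ⟨div_mem (hσA s hsA) hsA, mem_galoisFixed.2
      (by rw [map_div₀, hgσs, hgs])⟩ (by rw [map_div₀, hφσs, hφs])
    (by rw [norm_div, norm_galois_apply, div_self (norm_ne_zero_iff.2 hs0)])
  have hσs0 : σ s ≠ 0 := (_root_.map_ne_zero _).2 hs0
  have hσb0 : σ b ≠ 0 := (_root_.map_ne_zero _).2 hb0
  have hσβ0 : σ β ≠ 0 := (_root_.map_ne_zero _).2 hβ0
  have hκ0 : κ ≠ 0 := by
    rintro rfl
    simp only [map_zero, Finset.prod_const, Finset.card_range, zero_pow hd0.ne'] at hκN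
    exact pow_ne_zero _ (div_ne_zero hσs0 hs0) hκN.symm
  have hgκ : g κ = κ := mem_galoisFixed.1 hκ.2
  set b₁ := (σ b / b ^ m) ^ N with hb₁
  have hb₁0 : b₁ ≠ 0 := pow_ne_zero _ (div_ne_zero hσb0 (pow_ne_zero _ hb0))
  have hb₁A : b₁ ∈ A := pow_mem (div_mem (hσA b hb) (pow_mem hb m)) N
  set T := ∏ i ∈ Finset.range m, (g ^ i) (σ β) with hT
  have hTA : T ∈ A := prod_mem fun i _ => hgi i _ (hσA β hβ)
  have hT0 : T ≠ 0 := Finset.prod_ne_zero_iff.2 fun i _ => (_root_.map_ne_zero _).2 hσβ0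
  have hgT : g T = T * (φ (σ b) / σ b) := by
    have h1 : g T * σ β = T * (g ^ m) (σ β) := by
      rw [hT, ← Finset.prod_range_succ, Finset.prod_range_succ', map_prod]
      simp only [pow_zero, AlgEquiv.one_apply, galois_pow_succ_apply]
    rw [← hσg β hβ, hgβ, map_mul, map_div₀, hσφ b hb] at h1
    refine mul_right_cancel₀ hσβ0 (h1.trans ?_)
    ring
  set β₁ := (T / β ^ m) ^ N with hβ₁
  have hβ₁A : β₁ ∈ A := pow_mem (div_mem hTA (pow_mem hβ m)) N
  have hβ₁0 : β₁ ≠ 0 := pow_ne_zero _ (div_ne_zero hT0 (pow_ne_zero _ hβ0))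
  have hφb0 : φ b ≠ 0 := (_root_.map_ne_zero _).2 hb0
  have hφσb0 : φ (σ b) ≠ 0 := (_root_.map_ne_zero _).2 hσb0
  have hgβ₁ : g β₁ = β₁ * (φ b₁ / b₁) := by
    rw [hβ₁, hb₁]
    simp only [map_pow, map_div₀, hgT, hgβ, ← div_pow, ← mul_pow]
    congr 1
    simp only [mul_pow, div_pow]
    field_simp
  have hNβ : ∏ i ∈ Finset.range d, (φ ^ i) (β₁ / κ ^ m) = 1 := by
    have h2 : ∏ i ∈ Finset.range d, (φ ^ i) T = (σ s) ^ m := by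
      simp only [hT, map_prod]
      rw [Finset.prod_comm]
      have : ∀ j ∈ Finset.range m, ∏ i ∈ Finset.range d, (φ ^ i) ((g ^ j) (σ β)) = σ s := by
        intro j _
        rw [Finset.prod_congr rfl fun i _ => hgiφj j i _ (hσA β hβ),
          Finset.prod_congr rfl fun i _ => by rw [← hσφi i β hβ], ← map_prod, ← map_prod, ← hs,
          galois_pow_fixed hgσs]
      rw [Finset.prod_congr rfl this, Finset.prod_const, Finset.card_range]
    simp only [hβ₁, map_div₀, map_pow, Finset.prod_div_distrib, Finset.prod_pow, h2, ← hs, hκN]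
    rw [← pow_mul, mul_comm N m, pow_mul, div_pow (σ s), div_self]
    exact pow_ne_zero _ (div_ne_zero (pow_ne_zero _ hσs0) (pow_ne_zero _ hs0))
  obtain ⟨γ, hγ, hγ0, hφγ⟩ := exists_eq_mul_of_prod_eq_one A φ hφA hd hηA hηinj hd0
    (c := β₁ / κ ^ m) (div_mem hβ₁A (pow_mem hκ.1 m)) hNβ
  have hgγ0 : g γ ≠ 0 := (_root_.map_ne_zero _).2 hγ0
  have hφb₁0 : φ b₁ ≠ 0 := (_root_.map_ne_zero _).2 hb₁0
  refine ⟨N, hN, b₁ * (γ / g γ), mul_mem hb₁A (div_mem hγ (hgA γ hγ)), ?_, ?_⟩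
  · clear_value b₁ β₁
    rw [map_mul, map_div₀, ← hgφ γ hγ, hφγ, map_mul, map_div₀, map_pow, hgκ, hgβ₁]
    field_simp
  · have h3 : ∏ i ∈ Finset.range q, (g ^ i) (g γ) = ∏ i ∈ Finset.range q, (g ^ i) γ := by
      conv_rhs => rw [← galois_prod_shift (hq γ hγ), map_prod]
      exact Finset.prod_congr rfl fun i _ => by
        rw [← galois_pow_succ_apply, galois_pow_succ_apply']
    have h4 : ∏ i ∈ Finset.range q, (g ^ i) (σ b) = σ w := by
      rw [← hw, map_prod, Finset.prod_congr rfl fun i _ => hσgi i b hb,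
        prod_galois_pow_mul_coprime hmq hq0 (hq _ (hσA b hb))]
    simp only [hb₁, map_mul, map_pow, map_div₀, Finset.prod_mul_distrib, Finset.prod_div_distrib,
      Finset.prod_pow, h3, h4, hw]
    rw [div_self, mul_one]
    exact Finset.prod_ne_zero_iff.2 fun i _ => (_root_.map_ne_zero _).2 hγ0

end NormDescent

section Twist

variable {p : ℕ} [hp : Fact p.Prime] {Ω : Type*} [NormedField Ω] [NormedAlgebra ℚ_[p] Ω]
  [IsUltrametricDist Ω] [Algebra.IsAlgebraic ℚ_[p] Ω] [IsAlgClosed Ω]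

/-- `b` is a product of the conjugates over `F` of some element of `F(η, y)`; in particular `b` is
a norm from `F(y)`. -/
def IsConjProd (F : IntermediateField ℚ_[p] Ω) (y b : Ω) : Prop :=
  ∃ (η t : Ω) (S : Finset (ℕ × ℕ)) (f : ℕ × ℕ → Gal(Ω/ℚ_[p])),
    t ∈ adjoinElem (adjoinElem F η) y ∧ (∀ s ∈ S, ∀ a ∈ F, f s a = a) ∧
    (∀ h : Gal(Ω/ℚ_[p]), (∀ a ∈ F, h a = a) → ∃! s, s ∈ S ∧ h η = f s η ∧ h y = f s y) ∧
    ∏ s ∈ S, f s t = b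

theorem IsDiscreteSubfield.adjoin_tameRoots {F : IntermediateField ℚ_[p] Ω}
    (hF : IsDiscreteSubfield p F) :
    IsDiscreteSubfield p (adjoin ℚ_[p] ((F : Set Ω) ∪ tameRoots p Ω)) := by
  obtain ⟨D, hD, h⟩ := hF
  refine ⟨D, hD, fun x hx hx0 => ?_⟩
  obtain ⟨e, he, hex⟩ := exists_norm_eq_of_mem_adjoin_tameRoots F hx
  obtain ⟨k, hk⟩ := h e he (norm_pos_iff.1 (by rw [hex]; exact norm_pos_iff.2 hx0))
  exact ⟨k, by rw [← hex, hk]⟩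

/-- A generator of a Kummer extension of `p`-power degree, after descent to its true degree. -/
theorem exists_kummer_generator {M : IntermediateField ℚ_[p] Ω} {y : Ω} (hy0 : y ≠ 0) {n : ℕ}
    (hy : y ^ p ^ n ∈ M) :
    ∃ k ≤ n, y ^ p ^ k ∈ M ∧ ∃ (ω : Ω) (g : Gal(Ω/ℚ_[p])), IsPrimitiveRoot ω (p ^ k) ∧
      (∀ a ∈ M, g a = a) ∧ g y = ω * y := by
  classical
  have hex : ∃ k, y ^ p ^ k ∈ M := ⟨n, hy⟩
  refine ⟨Nat.find hex, Nat.find_min' hex hy, Nat.find_spec hex, ?_⟩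
  rcases hk : Nat.find hex with _ | k
  · exact ⟨1, 1, by simp, fun a _ => rfl, by simp⟩
  have h1 : y ^ p ^ k ∉ M := Nat.find_min hex (by omega)
  have h2 : y ^ p ^ (k + 1) ∈ M := hk ▸ Nat.find_spec hex
  rw [mem_iff_fixed] at h1
  push Not at h1
  obtain ⟨g, hg, hgy⟩ := h1
  refine ⟨g y / y, g, ?_, hg, by field_simp⟩
  rw [← orderOf_eq_prime_pow (x := g y / y) (p := p) (n := k)]
  · exact IsPrimitiveRoot.orderOf _
  · intro h
    rw [div_pow, div_eq_one_iff_eq (pow_ne_zero _ hy0), ← map_pow] at h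
    exact hgy h
  · rw [div_pow, div_eq_one_iff_eq (pow_ne_zero _ hy0), ← map_pow, hg _ h2]

set_option maxHeartbeats 400000 in
theorem isConjProd_twist (hp2 : Odd p) {F : IntermediateField ℚ_[p] Ω}
    (hF : IsDiscreteSubfield p F) {n : ℕ} (hn : n ≠ 0) {ζ : Ω} (hζ : IsPrimitiveRoot ζ (p ^ n))
    (hζF : ζ ∈ F) {σ : Gal(Ω/ℚ_[p])} (hσF : ∀ a ∈ F, σ a ∈ F)
    (hσW : ∀ τ ∈ tameRoots p Ω, σ τ = τ) {c e m : ℕ} (hσζ : σ ζ = ζ ^ c) (hc : ¬ p ∣ c)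
    (hme : m * e ≡ c [MOD p ^ n]) {y w₀ : Ω} (hy0 : y ≠ 0) (hy : y ^ p ^ n ∈ F) (hw₀ : w₀ ∈ F)
    (hσy : σ (y ^ p ^ n) = (y ^ p ^ n) ^ e * w₀ ^ p ^ n) {u : Ω} (hu : u ∈ F)
    (hu1 : ‖u - 1‖ < 1) : ∃ N, ¬ p ∣ N ∧ IsConjProd F y ((σ u / u ^ m) ^ N) := by
  have hpn0 : p ^ n ≠ 0 := pow_ne_zero _ hp.out.ne_zero
  have : NeZero (p ^ n) := ⟨hpn0⟩
  have hu0 : u ≠ 0 := by rintro rfl; simp at hu1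
  set Fu := adjoin ℚ_[p] ((F : Set Ω) ∪ tameRoots p Ω) with hFu
  have hFFu : ∀ a ∈ F, a ∈ Fu := fun a ha => subset_adjoin _ _ (Or.inl ha)
  have hWFu : tameRoots p Ω ⊆ Fu := fun a ha => subset_adjoin _ _ (Or.inr ha)
  obtain ⟨k, hkn, hyk, ω, g, hω, hg, hgy⟩ := exists_kummer_generator (M := Fu) hy0 (hFFu _ hy)
  set q := p ^ k with hq
  have hq0 : 0 < q := Nat.pos_of_ne_zero (pow_ne_zero _ hp.out.ne_zero)
  have hroot : ∀ ξ : Ω, ξ ^ p ^ n = 1 → ∃ i, ξ = ζ ^ i := fun ξ hξ => by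
    obtain ⟨i, -, hi⟩ := hζ.eq_pow_of_pow_eq_one hξ
    exact ⟨i, hi.symm⟩
  obtain ⟨iω, hiω⟩ := hroot ω (by
    rw [← Nat.add_sub_cancel' hkn, pow_add, pow_mul, hω.pow_eq_one, one_pow])
  have hωF : ω ∈ F := by rw [hiω]; exact pow_mem hζF _
  have hσω : σ ω = ω ^ c := by rw [hiω, map_pow, hσζ, ← pow_mul, ← pow_mul, mul_comm]
  have hωn : ω ^ p ^ n = 1 := by rw [hiω, ← pow_mul, mul_comm, pow_mul, hζ.pow_eq_one, one_pow]
  obtain ⟨iy, hiy⟩ := hroot (σ y / (y ^ e * w₀)) (by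
    rw [div_pow, ← map_pow, hσy, mul_pow, ← pow_mul, ← pow_mul, mul_comm e, div_self]
    rw [pow_mul, ← hσy]
    exact (_root_.map_ne_zero _).2 (pow_ne_zero _ hy0))
  have hw₀0 : w₀ ≠ 0 := by
    rintro rfl
    rw [zero_pow hpn0, mul_zero] at hσy
    exact (_root_.map_ne_zero _).2 (pow_ne_zero _ hy0) hσy
  have hσy' : σ y = ζ ^ iy * y ^ e * w₀ := by
    rw [← hiy]; field_simp
  obtain ⟨η₀, hη₀, hyη₀⟩ := exists_tameRoot_mem_adjoin hyk
  obtain ⟨ψ, d₀, hψ, hd₀, hψd, hψinj, hψgen⟩ := exists_cyclic F hη₀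
  set F₁ := adjoinElem F η₀ with hF₁
  have hFF₁ : ∀ a ∈ F, a ∈ F₁ := fun a ha => mem_adjoinElem_of_mem _ ha
  have hη₀F₁ : η₀ ∈ F₁ := self_mem_adjoinElem _ _
  have hF₁Fu : ∀ a ∈ F₁, a ∈ Fu := adjoinElem_le hFFu (hWFu hη₀)
  have htame : ∀ (h : Gal(Ω/ℚ_[p])) {η : Ω}, η ∈ tameRoots p Ω → ∃ i, h η = η ^ i :=
    fun h η hη => by
      obtain ⟨i, hi⟩ := exists_galois_eq_pow hη h
      exact ⟨_, hi⟩
  have hψF₁ : ∀ a ∈ F₁, ψ a ∈ F₁ := fun a ha => galois_mem_adjoinElem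
    (fun c hc => by rw [hψ c hc]; exact hFF₁ c hc) (by
      obtain ⟨i, hi⟩ := htame ψ hη₀
      rw [hi]; exact pow_mem hη₀F₁ _) ha
  obtain ⟨w, hw, hwu⟩ := exists_prod_galois_eq_of_norm_sub_one_lt F₁ hψF₁ hη₀ hη₀F₁ hd₀ hψd hψinj
    (hFF₁ u hu) (hψ u hu) hu1
  have hw0 : w ≠ 0 := by
    rintro rfl
    simp only [map_zero, Finset.prod_const, Finset.card_range, zero_pow hd₀.ne'] at hwu
    exact hu0 hwu.symm
  obtain ⟨b, hb, hbw⟩ := exists_prod_galois_eq_of_tameRoots_subset hp2 k hWFu hF.adjoin_tameRoots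
    hω (hFFu _ hωF) hg hgy hy0 hyk (hF₁Fu w hw) hw0
  obtain ⟨η, hη, hbη⟩ := exists_tameRoot_mem_adjoin (S := (F : Set Ω) ∪ {y}) (x := b) (by
    have hsub : (F : Set Ω) ∪ {y} ∪ tameRoots p Ω ⊆
        adjoin ℚ_[p] ((F : Set Ω) ∪ {y} ∪ tameRoots p Ω) := subset_adjoin _ _
    have hle : Fu ≤ adjoin ℚ_[p] ((F : Set Ω) ∪ {y} ∪ tameRoots p Ω) := by
      rw [hFu, adjoin_le_iff]
      rintro a (ha | ha)
      · exact hsub (Or.inl (Or.inl ha))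
      · exact hsub (Or.inr ha)
    exact adjoinElem_le hle (hsub (Or.inl (Or.inr (Set.mem_singleton y)))) hb)
  set L₁ := adjoinElem F₁ y with hL₁
  have hF₁L₁ : ∀ a ∈ F₁, a ∈ L₁ := fun a ha => mem_adjoinElem_of_mem _ ha
  have hyL₁ : y ∈ L₁ := self_mem_adjoinElem _ _
  obtain ⟨φ, d, hφ, hd0, hφd, hφinj, hφgen⟩ := exists_cyclic L₁ hη
  set A := adjoinElem L₁ η with hA
  have hL₁A : ∀ a ∈ L₁, a ∈ A := fun a ha => mem_adjoinElem_of_mem _ ha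
  have hηA : η ∈ A := self_mem_adjoinElem _ _
  have hFL₁ : ∀ a ∈ F, a ∈ L₁ := fun a ha => hF₁L₁ a (hFF₁ a ha)
  have hη₀L₁ : η₀ ∈ L₁ := hF₁L₁ _ hη₀F₁
  have hbA : b ∈ A := by
    have hle : adjoin ℚ_[p] ((F : Set Ω) ∪ {y} ∪ {η}) ≤ A := by
      rw [adjoin_le_iff]
      rintro a ((ha | ha) | ha)
      · exact hL₁A a (hFL₁ a ha)
      · rw [Set.mem_singleton_iff.1 ha]; exact hL₁A _ hyL₁
      · rw [Set.mem_singleton_iff.1 ha]; exact hηA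
    exact hle hbη
  have hgF : ∀ a ∈ F, g a = a := fun a ha => hg a (hFFu a ha)
  have hgW : ∀ a ∈ tameRoots p Ω, g a = a := fun a ha => hg a (hWFu ha)
  -- two automorphisms agreeing on the generators agree on `A`
  have hext : ∀ h h' : Gal(Ω/ℚ_[p]), (∀ a ∈ F, h a = h' a) → h η₀ = h' η₀ → h y = h' y →
      h η = h' η → ∀ a ∈ A, h a = h' a := fun h h' h1 h2 h3 h4 a ha =>
    galois_eqOn_adjoinElem (fun a ha => galois_eqOn_adjoinElem
      (fun a ha => galois_eqOn_adjoinElem h1 h2 ha) h3 ha) h4 ha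
  have hmaps : ∀ h : Gal(Ω/ℚ_[p]), (∀ a ∈ F, h a ∈ F) → h y ∈ L₁ → ∀ a ∈ A, h a ∈ A := by
    intro h h1 h2 a ha
    refine galois_mem_adjoinElem (fun a ha => galois_mem_adjoinElem
      (fun a ha => galois_mem_adjoinElem (fun a ha => hL₁A _ (hFL₁ _ (h1 a ha))) ?_ ha)
      (hL₁A _ h2) ha) ?_ ha
    · obtain ⟨i, hi⟩ := htame h hη₀
      rw [hi]; exact pow_mem (hL₁A _ hη₀L₁) _
    · obtain ⟨i, hi⟩ := htame h hη
      rw [hi]; exact pow_mem hηA _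
  have hσyL₁ : σ y ∈ L₁ := by
    rw [hσy']
    exact mul_mem (mul_mem (hFL₁ _ (pow_mem hζF _)) (pow_mem hyL₁ _)) (hFL₁ _ hw₀)
  have hgA := hmaps g (fun a ha => by rwa [hgF a ha])
    (by rw [hgy]; exact mul_mem (hFL₁ _ hωF) hyL₁)
  have hφA := hmaps φ (fun a ha => by rwa [hφ a (hFL₁ a ha)]) (by rwa [hφ y hyL₁])
  have hσA := hmaps σ hσF hσyL₁
  have hgq : ∀ a ∈ A, (g ^ q) a = a := hext (g ^ q) 1 (fun a ha => galois_pow_fixed (hgF a ha) q)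
    (galois_pow_fixed (hgW _ hη₀) q)
    (by rw [galois_pow_kummer (hgF _ hωF) hgy, hω.pow_eq_one, one_mul]; rfl)
    (galois_pow_fixed (hgW _ hη) q)
  have hφd' : ∀ a ∈ A, (φ ^ d) a = a := hext (φ ^ d) 1
    (fun a ha => galois_pow_fixed (hφ _ (hFL₁ a ha)) d) (galois_pow_fixed (hφ _ hη₀L₁) d)
    (galois_pow_fixed (hφ _ hyL₁) d) hφd
  have hgφ : ∀ a ∈ A, g (φ a) = φ (g a) := by
    refine hext (g * φ) (φ * g) (fun a ha => ?_) ?_ ?_ ?_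
    · simp only [AlgEquiv.mul_apply, hφ a (hFL₁ a ha), hgF a ha]
    · simp only [AlgEquiv.mul_apply, hφ _ hη₀L₁, hgW _ hη₀]
    · simp only [AlgEquiv.mul_apply, hφ _ hyL₁, hgy, map_mul, hφ _ (hFL₁ _ hωF)]
    · obtain ⟨i, hi⟩ := htame φ hη
      simp only [AlgEquiv.mul_apply, hi, map_pow, hgW _ hη]
  have hσφ : ∀ a ∈ A, σ (φ a) = φ (σ a) := by
    refine hext (σ * φ) (φ * σ) (fun a ha => ?_) ?_ ?_ ?_
    · simp only [AlgEquiv.mul_apply, hφ a (hFL₁ a ha), hφ _ (hFL₁ _ (hσF a ha))]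
    · simp only [AlgEquiv.mul_apply, hφ _ hη₀L₁, hσW _ hη₀]
    · simp only [AlgEquiv.mul_apply, hφ _ hyL₁, hφ _ hσyL₁]
    · obtain ⟨i, hi⟩ := htame φ hη
      simp only [AlgEquiv.mul_apply, hi, map_pow, hσW _ hη]
  have hσg : ∀ a ∈ A, σ (g a) = (g ^ m) (σ a) := by
    refine hext (σ * g) (g ^ m * σ) (fun a ha => ?_) ?_ ?_ ?_
    · rw [AlgEquiv.mul_apply, AlgEquiv.mul_apply, hgF a ha, galois_pow_fixed (hgF _ (hσF a ha))]
    · rw [AlgEquiv.mul_apply, AlgEquiv.mul_apply, hgW _ hη₀, hσW _ hη₀, galois_pow_fixed (hgW _ hη₀)]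
    · rw [AlgEquiv.mul_apply, AlgEquiv.mul_apply, hgy, map_mul, hσω, hσy', map_mul, map_mul,
        galois_pow_fixed (hgF _ (pow_mem hζF iy)), galois_pow_fixed (hgF _ hw₀), map_pow,
        galois_pow_kummer (hgF _ hωF) hgy, mul_pow, ← pow_mul, ← pow_eq_pow_of_modEq hme hωn]
      ring
    · rw [AlgEquiv.mul_apply, AlgEquiv.mul_apply, hgW _ hη, hσW _ hη, galois_pow_fixed (hgW _ hη)]
  have hpm : ¬ p ∣ m := fun h => hc <| by
    have h1 : m * e ≡ c [MOD p] := hme.of_dvd (dvd_pow_self p hn)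
    exact (h1.dvd_iff dvd_rfl).1 (h.mul_right e)
  have hmq : m.Coprime q := Nat.Coprime.pow_right k
    (Nat.Coprime.symm ((Nat.Prime.coprime_iff_not_dvd hp.out).2 hpm))
  have hyinj : Set.InjOn (fun i : ℕ => (g ^ i) y) (Set.Iio q) := by
    intro i hi j hj hij
    simp only [galois_pow_kummer (hgF _ hωF) hgy] at hij
    exact hω.pow_inj hi hj (mul_right_cancel₀ hy0 hij)
  have hb0 : b ≠ 0 := by
    rintro rfl
    simp only [map_zero, Finset.prod_const, Finset.card_range] at hbw
    exact hw0 (hbw.symm.trans (zero_pow hq0.ne'))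
  obtain ⟨N, hN, b', hb', hφb', hb'w⟩ := exists_prod_galois_eq_twist_pow A hgA hφA hσA hgq hφd' hgφ
    hσφ hσg hmq hq0 hd0 (hL₁A _ hyL₁) hyinj hηA hη hφinj (hgW _ hη) hbA hb0 hbw
    (hφ w (hF₁L₁ w hw))
  have hb'L₁ : b' ∈ L₁ := mem_of_galois_fixed hφ (fun f hf => by
    obtain ⟨j, -, hj⟩ := hφgen f hf
    exact ⟨j, hj⟩) hb' hφb'
  have hψσ : ∀ i, ∀ a ∈ F₁, (ψ ^ i) (σ a) = σ ((ψ ^ i) a) := by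
    intro i a ha
    rw [← AlgEquiv.mul_apply, ← AlgEquiv.mul_apply]
    refine galois_eqOn_adjoinElem (fun a ha => ?_) ?_ ha
    · rw [AlgEquiv.mul_apply, AlgEquiv.mul_apply, galois_pow_fixed (hψ _ (hσF a ha)),
        galois_pow_fixed (hψ _ ha)]
    · obtain ⟨l, hl⟩ := htame (ψ ^ i) hη₀
      rw [AlgEquiv.mul_apply, AlgEquiv.mul_apply, hσW _ hη₀, hl, map_pow, hσW _ hη₀]
  refine ⟨N, hN, η₀, b', Finset.range d₀ ×ˢ Finset.range q, fun s => ψ ^ s.1 * g ^ s.2, hb'L₁,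
    ?_, ?_, ?_⟩
  · intro s _ a ha
    rw [AlgEquiv.mul_apply, galois_pow_fixed (hgF a ha), galois_pow_fixed (hψ a ha)]
  · intro h hh
    obtain ⟨i, hi, hhi⟩ := hψgen h hh
    have hfix : ∀ a ∈ F₁, ((ψ ^ i)⁻¹ * h) a = a := fun a ha => by
      refine galois_eqOn_adjoinElem (h := 1) (fun a ha => ?_) ?_ ha
      · rw [AlgEquiv.mul_apply, hh a ha]
        exact (AlgEquiv.symm_apply_eq _).2 (galois_pow_fixed (hψ a ha) i).symm
      · rw [AlgEquiv.mul_apply, hhi]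
        exact (ψ ^ i).symm_apply_apply _
    obtain ⟨j, hj, hhj⟩ := exists_galois_eq_pow_kummer hq0 hω (hFF₁ _ hωF) hyη₀
      (fun a ha => hg a (hF₁Fu a ha)) hgy _ hfix
    have hhj' : h y = (ψ ^ i * g ^ j) y := by
      rw [AlgEquiv.mul_apply, ← hhj, AlgEquiv.mul_apply]
      exact ((ψ ^ i).apply_symm_apply _).symm
    refine ⟨(i, j), ⟨by simp [hi, hj], ?_, hhj'⟩, ?_⟩
    · rw [AlgEquiv.mul_apply, galois_pow_fixed (hgW _ hη₀), hhi]
    · rintro ⟨i', j'⟩ ⟨hmem, h1, h2⟩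
      simp only [Finset.mem_product, Finset.mem_range] at hmem
      simp only [AlgEquiv.mul_apply, galois_pow_fixed (hgW _ hη₀)] at h1
      have hii : i' = i := hψinj hmem.1 hi (h1.symm.trans hhi)
      subst hii
      simp only [AlgEquiv.mul_apply] at h2 hhj'
      have := (ψ ^ i').injective (h2.symm.trans hhj')
      rw [hyinj hmem.2 hj this]
  · rw [Finset.prod_product]
    simp only [AlgEquiv.mul_apply, ← map_prod, hb'w]
    simp only [map_pow, map_div₀, Finset.prod_pow, Finset.prod_div_distrib, hwu]
    rw [Finset.prod_congr rfl fun i _ => hψσ i w hw, ← map_prod, hwu]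

end Twist

section NormFromConj

variable {p : ℕ} [hp : Fact p.Prime] {Ω : Type*} [NormedField Ω] [NormedAlgebra ℚ_[p] Ω]
  [IsUltrametricDist Ω] [Algebra.IsAlgebraic ℚ_[p] Ω] [IsAlgClosed Ω]
  {F : Type*} [Field F] [Algebra ℚ_[p] F] [Algebra F Ω] [IsScalarTower ℚ_[p] F Ω]

theorem exists_norm_eq_of_isConjProd {F₀ : IntermediateField ℚ_[p] Ω}
    (hF₀ : ∀ a, a ∈ F₀ ↔ ∃ x : F, algebraMap F Ω x = a) {y : Ω} {b : F}
    (h : IsConjProd F₀ y (algebraMap F Ω b)) : ∃ z : F⟮y⟯, Algebra.norm F z = b := by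
  classical
  have : CharZero F := charZero_of_injective_algebraMap (algebraMap ℚ_[p] F).injective
  have : Algebra.IsAlgebraic F Ω := Algebra.IsAlgebraic.tower_top (K := ℚ_[p]) F
  obtain ⟨η, t, S, f, ht, hfF, hfu, hft⟩ := h
  have hle : F⟮y⟯ ≤ adjoin F {η, y} := adjoin.mono F _ _ (by simp)
  let L := F⟮y⟯
  let L₁ : IntermediateField L Ω := extendScalars hle
  have : FiniteDimensional F L := adjoin.finiteDimensional (Algebra.IsIntegral.isIntegral y)
  have : FiniteDimensional F (adjoin F {η, y}) := by
    refine finiteDimensional_adjoin fun x _ => Algebra.IsIntegral.isIntegral x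
  have : FiniteDimensional F L₁ := this
  have hηL : η ∈ L₁ := subset_adjoin F {η, y} (by simp)
  have hyL : y ∈ L₁ := subset_adjoin F {η, y} (by simp)
  have htL : t ∈ L₁ := by
    have h1 : adjoinElem (adjoinElem F₀ η) y ≤ (adjoin F {η, y}).restrictScalars ℚ_[p] := by
      refine adjoinElem_le (adjoinElem_le (fun a ha => ?_) hηL) hyL
      obtain ⟨x, rfl⟩ := (hF₀ a).1 ha
      exact (adjoin F {η, y}).algebraMap_mem x
    exact h1 ht
  have : IsScalarTower F L₁ Ω := IsScalarTower.of_algebraMap_eq fun _ => rfl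
  have : Algebra.IsAlgebraic L₁ Ω := Algebra.IsAlgebraic.tower_top (K := F) L₁
  let fF : ∀ s ∈ S, Ω →ₐ[F] Ω := fun s hs =>
    { (f s : Ω →ₐ[ℚ_[p]] Ω) with
      commutes' := fun x => hfF s hs _ ((hF₀ _).2 ⟨x, rfl⟩) }
  have hfF' : ∀ s hs x, fF s hs x = f s x := fun _ _ _ => rfl
  have key : algebraMap F Ω (Algebra.norm F (⟨t, htL⟩ : L₁)) = algebraMap F Ω b := by
    rw [Algebra.norm_eq_prod_embeddings, ← hft]
    refine (Finset.prod_bij (fun s hs => (fF s hs).domRestrict L₁) (fun _ _ => Finset.mem_univ _)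
      (fun s hs s' hs' heq => ?_) (fun φ _ => ?_) (fun s hs => rfl)).symm
    · have h1 : f s η = f s' η := DFunLike.congr_fun heq ⟨η, hηL⟩
      have h2 : f s y = f s' y := DFunLike.congr_fun heq ⟨y, hyL⟩
      exact (hfu (f s) (hfF s hs)).unique ⟨hs, rfl, rfl⟩ ⟨hs', h1, h2⟩
    · obtain ⟨Φ, hΦ⟩ := IsAlgClosed.surjective_domRestrict_of_isAlgebraic (L := L₁) (E := Ω) φ
      let Φ' : Gal(Ω/ℚ_[p]) := (AlgEquiv.ofBijective Φ
        (Algebra.IsAlgebraic.algHom_bijective Φ)).restrictScalars ℚ_[p]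
      have hΦ' : ∀ x, Φ' x = Φ x := fun _ => rfl
      obtain ⟨s, ⟨hs, h1, h2⟩, -⟩ := hfu Φ' (fun a ha => by
        obtain ⟨x, rfl⟩ := (hF₀ a).1 ha
        exact Φ.commutes x)
      refine ⟨s, hs, ?_⟩
      rw [← hΦ]
      have hag : ∀ x ∈ adjoin F {η, y}, fF s hs x = Φ x := by
        intro x hx
        induction hx using adjoin_induction with
        | mem x hx =>
          rcases hx with rfl | rfl
          · exact h1.symm
          · exact h2.symm
        | algebraMap x => rw [AlgHom.commutes, AlgHom.commutes]
        | add x y _ _ h h' => rw [map_add, map_add, h, h']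
        | inv x _ h => rw [map_inv₀, map_inv₀, h]
        | mul x y _ _ h h' => rw [map_mul, map_mul, h, h']
      ext x
      exact hag x x.2
  refine ⟨Algebra.norm L (⟨t, htL⟩ : L₁), ?_⟩
  rw [Algebra.norm_norm]
  exact (algebraMap F Ω).injective key

end NormFromConj

section CyclotomicGalois

variable {p : ℕ} [hp : Fact p.Prime] {Ω : Type*} [NormedField Ω] [NormedAlgebra ℚ_[p] Ω]
  [IsUltrametricDist Ω] [Algebra.IsAlgebraic ℚ_[p] Ω] [IsAlgClosed Ω]

theorem norm_one_sub_primitive_pow_totient {n : ℕ} (hn : n ≠ 0) {ζ : Ω}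
    (hζ : IsPrimitiveRoot ζ (p ^ n)) : ‖1 - ζ‖ ^ (p ^ n).totient = ‖(p : Ω)‖ := by
  classical
  have hpn0 : p ^ n ≠ 0 := pow_ne_zero _ hp.out.ne_zero
  have : NeZero (p ^ n) := ⟨hpn0⟩
  obtain ⟨k, rfl⟩ := Nat.exists_eq_succ_of_ne_zero hn
  have h1 := eval_one_cyclotomic_prime_pow (R := Ω) (p := p) k
  rw [cyclotomic_eq_prod_X_sub_primitiveRoots hζ, eval_prod] at h1
  rw [← h1, norm_prod, ← hζ.card_primitiveRoots, ← Finset.prod_const]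
  refine Finset.prod_congr rfl fun μ hμ => ?_
  have hμ' := (mem_primitiveRoots (Nat.pos_of_ne_zero hpn0)).1 hμ
  obtain ⟨i, -, hi, rfl⟩ := (hζ.isPrimitiveRoot_iff).1 hμ'
  simp only [eval_sub, eval_X, eval_C]
  rw [norm_one_sub_pow_primitive hζ hpn0 hi]

theorem exists_galois_eq_pow_of_unramified {K : IntermediateField ℚ_[p] Ω}
    (hK : ∀ x ∈ K, x ≠ 0 → ∃ k : ℤ, ‖x‖ = ‖(p : Ω)‖ ^ k) {n : ℕ} (hn : n ≠ 0) {ζ : Ω}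
    (hζ : IsPrimitiveRoot ζ (p ^ n)) {c : ℕ} (hc : ¬ p ∣ c) :
    ∃ σ : Gal(Ω/ℚ_[p]), (∀ a ∈ K, σ a = a) ∧ (∀ τ ∈ tameRoots p Ω, σ τ = τ) ∧ σ ζ = ζ ^ c := by
  have hpn0 : p ^ n ≠ 0 := pow_ne_zero _ hp.out.ne_zero
  have : NeZero (p ^ n) := ⟨hpn0⟩
  set M := adjoin ℚ_[p] ((K : Set Ω) ∪ tameRoots p Ω) with hM
  have : IsAlgClosure M Ω := ⟨inferInstance, inferInstance⟩
  have : Normal M Ω := inferInstance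
  have hMn : ∀ x ∈ M, x ≠ 0 → ∃ k : ℤ, ‖x‖ = ‖(p : Ω)‖ ^ k := fun x hx hx0 => by
    obtain ⟨e, he, hex⟩ := exists_norm_eq_of_mem_adjoin_tameRoots K hx
    obtain ⟨k, hk⟩ := hK e he (norm_pos_iff.1 (by rw [hex]; exact norm_pos_iff.2 hx0))
    exact ⟨k, by rw [← hex, hk]⟩
  have hφ := norm_one_sub_primitive_pow_totient hn hζ
  have hφ0 : 0 < (p ^ n).totient := Nat.totient_pos.2 (Nat.pos_of_ne_zero hpn0)
  have hp0 := norm_prime_pos p Ω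
  have hϖ0 : 0 < ‖1 - ζ‖ := (norm_nonneg _).lt_of_ne fun h => by
    rw [← h, zero_pow hφ0.ne'] at hφ
    exact hp0.ne hφ
  have hϖ1 : ‖1 - ζ‖ < 1 := by
    by_contra h
    exact absurd (one_le_pow₀ (n := (p ^ n).totient) (not_lt.1 h)) (by
      rw [hφ]; exact not_le.2 (norm_prime_lt_one p Ω))
  have hxint : IsIntegral M (1 - ζ) := Algebra.IsIntegral.isIntegral _
  obtain ⟨a, ha, haD⟩ := exists_norm_pow_natDegree_eq M (1 - ζ)
  set D := (minpoly M (1 - ζ)).natDegree with hD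
  have hD0 : 0 < D := minpoly.natDegree_pos hxint
  obtain ⟨k, hk⟩ := hMn a ha (norm_pos_iff.1 (by rw [haD]; positivity))
  have hdvd : (p ^ n).totient ≤ D := by
    rw [haD, ← hφ, ← zpow_natCast, ← zpow_natCast, ← zpow_mul] at hk
    have := zpow_right_injective₀ hϖ0 hϖ1.ne hk
    exact Nat.le_of_dvd hD0 (Int.natCast_dvd_natCast.1 ⟨k, this⟩)
  set Q : M[X] := (cyclotomic (p ^ n) M).comp (1 - X) with hQ
  have hQdeg : Q.natDegree = (p ^ n).totient := by
    have h1 : (1 - X : M[X]).natDegree = 1 := by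
      rw [← neg_sub, natDegree_neg, ← C_1, natDegree_X_sub_C]
    rw [hQ, natDegree_comp, natDegree_cyclotomic, h1, mul_one]
  have hQroot : ∀ ξ : Ω, IsPrimitiveRoot ξ (p ^ n) → aeval (1 - ξ) Q = 0 := fun ξ hξ => by
    rw [hQ, aeval_comp]
    simp only [map_sub, map_one, aeval_X, sub_sub_cancel]
    rw [aeval_def, eval₂_eq_eval_map, map_cyclotomic]
    have : NeZero ((p ^ n : ℕ) : Ω) :=
      ⟨by have := charZero_padic_algebra p (Ω := Ω) inferInstance; exact_mod_cast hpn0⟩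
    exact (isRoot_cyclotomic_iff).2 hξ
  have hQ0 : Q ≠ 0 := by
    rintro h
    rw [h, natDegree_zero] at hQdeg
    omega
  have hassoc := associated_of_dvd_of_natDegree_le (minpoly.dvd M (1 - ζ) (hQroot ζ hζ)) hQ0
    (by rw [hQdeg]; exact hdvd)
  have hcop : c.Coprime (p ^ n) :=
    ((Nat.Prime.coprime_iff_not_dvd hp.out).2 hc).symm.pow_right n
  have hroot : aeval (1 - ζ ^ c) (minpoly M (1 - ζ)) = 0 := by
    obtain ⟨u, hu⟩ := hassoc.symm
    rw [← hu, map_mul, hQroot _ (hζ.pow_of_coprime c hcop), zero_mul]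
  obtain ⟨σ, hσ⟩ := minpoly.exists_algEquiv_of_root' hxint.isAlgebraic hroot
  refine ⟨σ.restrictScalars ℚ_[p], fun x hx => σ.commutes ⟨x, subset_adjoin _ _ (Or.inl hx)⟩,
    fun x hx => σ.commutes ⟨x, subset_adjoin _ _ (Or.inr hx)⟩, ?_⟩
  rw [map_sub, map_one] at hσ
  exact sub_right_injective hσ

end CyclotomicGalois

section CompareValuation

variable {p : ℕ} [hp : Fact p.Prime] {Ω : Type*} [NormedField Ω] [NormedAlgebra ℚ_[p] Ω]
  [IsUltrametricDist Ω] [Algebra.IsAlgebraic ℚ_[p] Ω] [IsAlgClosed Ω]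
  {F : Type*} [Field F] [Algebra ℚ_[p] F] [Algebra F Ω] [IsScalarTower ℚ_[p] F Ω]

theorem AddValuation.exists_eq_coe (v : AddValuation F (WithTop ℤ)) {x : F} (hx : x ≠ 0) :
    ∃ k : ℤ, v x = k :=
  ⟨_, (WithTop.coe_untop _ (mt v.top_iff.1 hx)).symm⟩

theorem AddValuation.map_zpow_of_eq_coe (v : AddValuation F (WithTop ℤ)) {x : F} {k : ℤ}
    (hx : v x = k) (i : ℤ) : v (x ^ i) = ((i * k : ℤ) : WithTop ℤ) := by
  have hx0 : x ≠ 0 := by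
    rintro rfl
    rw [v.map_zero] at hx
    exact WithTop.coe_ne_top hx.symm
  have hpow : ∀ j : ℕ, v (x ^ j) = ((j * k : ℤ) : WithTop ℤ) := by
    intro j
    induction j with
    | zero => simp
    | succ j ih =>
      rw [pow_succ, v.map_mul, ih, hx, ← WithTop.coe_add]
      congr 1
      push_cast
      ring
  obtain ⟨j, rfl | rfl⟩ := i.eq_nat_or_neg
  · rw [zpow_natCast, hpow]
  · obtain ⟨b, hb⟩ := v.exists_eq_coe (x := x ^ (-j : ℤ)) (zpow_ne_zero _ hx0)
    have h1 := v.map_mul (x ^ j) (x ^ (-j : ℤ))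
    rw [zpow_neg, zpow_natCast, mul_inv_cancel₀ (pow_ne_zero _ hx0), v.map_one, hpow,
      ← zpow_natCast, ← zpow_neg, hb, ← WithTop.coe_add, ← WithTop.coe_zero, WithTop.coe_inj] at h1
    rw [hb, WithTop.coe_inj]
    linarith

variable (Ω)

theorem zero_le_of_norm_le_one (v : AddValuation F (WithTop ℤ)) {e : ℕ} (he : 0 < e)
    (hvp : v (p : F) = ((e : ℤ) : WithTop ℤ)) {x : F} (hx : ‖algebraMap F Ω x‖ ≤ 1) : 0 ≤ v x := by
  rcases eq_or_ne x 0 with rfl | hx0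
  · simp
  obtain ⟨a, ha⟩ := v.exists_eq_coe hx0
  rw [ha, ← WithTop.coe_zero, WithTop.coe_le_coe]
  by_contra hneg
  push Not at hneg
  set N := a.natAbs + 1 with hN
  have hp0 := norm_prime_pos p Ω
  obtain ⟨ε, hε, hroot⟩ := exists_nth_root (p := p) (Ω := Ω) N (by omega)
  obtain ⟨i, hi⟩ := exists_pow_lt_of_lt_one hε (norm_prime_lt_one p Ω)
  set z : F := (p : F) ^ (N * i) * x ^ (1 + N * i * e) with hz
  have hvz : v z = (((N * i : ℕ) * e + (1 + N * i * e : ℕ) * a : ℤ) : WithTop ℤ) := by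
    rw [hz, v.map_mul, ← zpow_natCast, ← zpow_natCast, v.map_zpow_of_eq_coe hvp,
      v.map_zpow_of_eq_coe ha, ← WithTop.coe_add]
  have hzn : ‖algebraMap F Ω z‖ < ε := by
    rw [hz, map_mul, map_pow, map_pow, map_natCast, norm_mul, norm_pow, norm_pow]
    calc ‖(p : Ω)‖ ^ (N * i) * ‖algebraMap F Ω x‖ ^ (1 + N * i * e)
        ≤ ‖(p : Ω)‖ ^ (N * i) * 1 := by
          gcongr
          exact pow_le_one₀ (norm_nonneg _) hx
      _ ≤ ‖(p : Ω)‖ ^ i := by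
          rw [mul_one]
          exact pow_le_pow_of_le_one hp0.le (norm_prime_lt_one p Ω).le
            (Nat.le_mul_of_pos_left _ (by omega))
      _ < ε := hi
  obtain ⟨t, ht, htN⟩ := hroot (IsScalarTower.toAlgHom ℚ_[p] F Ω).fieldRange
    (algebraMap F Ω (1 + z)) ⟨1 + z, rfl⟩ (by simpa using hzn)
  obtain ⟨s, rfl⟩ := ht
  have hs : s ^ N = 1 + z := (algebraMap F Ω).injective (by rw [map_pow]; exact htN)
  have hlt : v z < v 1 := by
    rw [hvz, v.map_one, ← WithTop.coe_zero, WithTop.coe_lt_coe]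
    push_cast
    have : (0 : ℤ) ≤ N * i * e := by positivity
    nlinarith
  have hv1z : v (1 + z) = v z := by rw [add_comm, v.map_add_eq_of_lt_left hlt]
  have hs0 : s ≠ 0 := by
    rintro rfl
    rw [zero_pow (by omega)] at hs
    rw [← hs, v.map_zero, hvz] at hv1z
    exact WithTop.coe_ne_top hv1z.symm
  obtain ⟨b, hb⟩ := v.exists_eq_coe hs0
  rw [← hs, ← zpow_natCast, v.map_zpow_of_eq_coe hb, hvz, WithTop.coe_inj] at hv1z
  have hdvd : (N : ℤ) ∣ a := by
    refine ⟨b - i * e - i * e * a, ?_⟩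
    push_cast at hv1z
    linear_combination -hv1z
  have := Int.le_of_dvd (by omega) ((dvd_neg).2 hdvd)
  omega

theorem norm_eq_zpow_of_addValuation (v : AddValuation F (WithTop ℤ)) {e : ℕ} (he : 0 < e)
    (hvp : v (p : F) = ((e : ℤ) : WithTop ℤ)) {ϖ : F} (hϖ : v ϖ = (1 : WithTop ℤ)) :
    0 < ‖algebraMap F Ω ϖ‖ ∧ ‖algebraMap F Ω ϖ‖ < 1 ∧
      ∀ {x : F} {k : ℤ}, v x = k → ‖algebraMap F Ω x‖ = ‖algebraMap F Ω ϖ‖ ^ k := by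
  have hpos : ∀ x : F, x ≠ 0 → ‖algebraMap F Ω x‖ < 1 → 0 < v x := by
    intro x hx0 hx
    obtain ⟨k, hk⟩ := exists_pow_lt_of_lt_one (norm_prime_pos p Ω) hx
    have hp0 : (p : F) ≠ 0 := by
      rintro h
      rw [h, v.map_zero] at hvp
      exact WithTop.coe_ne_top hvp.symm
    have h1 := zero_le_of_norm_le_one Ω v he hvp (x := x ^ k / p) (by
      rw [map_div₀, map_pow, map_natCast, norm_div, norm_pow]
      exact div_le_one_of_le₀ hk.le (norm_nonneg _))
    obtain ⟨a, ha⟩ := v.exists_eq_coe hx0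
    rw [div_eq_mul_inv, v.map_mul, ← zpow_natCast, v.map_zpow_of_eq_coe ha, ← zpow_neg_one,
      v.map_zpow_of_eq_coe hvp, ← WithTop.coe_add, ← WithTop.coe_zero, WithTop.coe_le_coe] at h1
    rw [ha, ← WithTop.coe_zero, WithTop.coe_lt_coe]
    by_contra hneg
    have : (k : ℤ) * a ≤ 0 := mul_nonpos_of_nonneg_of_nonpos (by positivity) (not_lt.1 hneg)
    omega
  have hne : ∀ {x : F} {k : ℤ}, v x = k → x ≠ 0 := by
    rintro x k h rfl
    rw [v.map_zero] at h
    exact WithTop.coe_ne_top h.symm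
  have hinv : ∀ {x : F} {k : ℤ}, v x = k → v x⁻¹ = ((-k : ℤ) : WithTop ℤ) := fun h => by
    rw [← zpow_neg_one, v.map_zpow_of_eq_coe h, neg_one_mul]
  have hunit : ∀ x : F, v x = ((0 : ℤ) : WithTop ℤ) → ‖algebraMap F Ω x‖ = 1 := by
    intro x hx
    rcases lt_trichotomy ‖algebraMap F Ω x‖ 1 with h | h | h
    · have := hpos x (hne hx) h
      rw [hx] at this
      exact absurd this (lt_irrefl _)
    · exact h
    · have := hpos x⁻¹ (inv_ne_zero (hne hx)) (by
        rw [map_inv₀, norm_inv]; exact inv_lt_one_of_one_lt₀ h)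
      rw [hinv hx, neg_zero] at this
      exact absurd this (lt_irrefl _)
  have hϖ' : v ϖ = ((1 : ℤ) : WithTop ℤ) := hϖ
  have hϖ0 : 0 < ‖algebraMap F Ω ϖ‖ := norm_pos_iff.2 ((_root_.map_ne_zero _).2 (hne hϖ'))
  refine ⟨hϖ0, ?_, fun {x k} hx => ?_⟩
  · by_contra h
    have := zero_le_of_norm_le_one Ω v he hvp (x := ϖ⁻¹) (by
      rw [map_inv₀, norm_inv]; exact inv_le_one_of_one_le₀ (not_lt.1 h))
    rw [hinv hϖ', ← WithTop.coe_zero, WithTop.coe_le_coe] at this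
    omega
  · have h1 := hunit (x * ϖ ^ (-k)) (by
      rw [v.map_mul, hx, v.map_zpow_of_eq_coe hϖ', ← WithTop.coe_add]; congr 1; ring)
    rw [map_mul, map_zpow₀, norm_mul, norm_zpow, zpow_neg,
      mul_inv_eq_one₀ (zpow_ne_zero _ hϖ0.ne')] at h1
    exact h1

end CompareValuation

section NormGroup

variable {F : Type*} [Field F] {Ω : Type*} [Field Ω] [Algebra F Ω]

theorem exists_norm_zpow_eq {y : Ω} {b : F} (h : ∃ z : F⟮y⟯, Algebra.norm F z = b)
    (k : ℤ) : ∃ z : F⟮y⟯, Algebra.norm F z = b ^ k := by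
  obtain ⟨z, rfl⟩ := h
  have hpow : ∀ k : ℕ, Algebra.norm F (z ^ k) = Algebra.norm F z ^ k := fun k => map_pow _ _ _
  obtain ⟨j, rfl | rfl⟩ := k.eq_nat_or_neg
  · exact ⟨z ^ j, by rw [hpow, zpow_natCast]⟩
  · rcases eq_or_ne z 0 with rfl | hz
    · rcases Nat.eq_zero_or_pos j with rfl | hj
      · exact ⟨1, by simp⟩
      · by_cases h0 : Algebra.norm F (0 : F⟮y⟯) = 0
        · refine ⟨0, ?_⟩
          rw [h0, zero_zpow _ (by omega)]
        · refine ⟨0, ?_⟩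
          have h1 := map_mul (Algebra.norm F) (0 : F⟮y⟯) 0
          rw [mul_zero] at h1
          have h2 : Algebra.norm F (0 : F⟮y⟯) = 1 := (mul_eq_left₀ h0).1 h1.symm
          rw [h2, one_zpow]
    · refine ⟨(z ^ j)⁻¹, ?_⟩
      rw [zpow_neg, zpow_natCast, ← hpow]
      apply eq_inv_of_mul_eq_one_left
      rw [← map_mul, inv_mul_cancel₀ (pow_ne_zero _ hz), map_one]

theorem exists_norm_mul_eq {y : Ω} {a b : F} (ha : ∃ z : F⟮y⟯, Algebra.norm F z = a)
    (hb : ∃ z : F⟮y⟯, Algebra.norm F z = b) : ∃ z : F⟮y⟯, Algebra.norm F z = a * b := by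
  obtain ⟨z, rfl⟩ := ha
  obtain ⟨w, rfl⟩ := hb
  exact ⟨z * w, map_mul _ _ _⟩

theorem exists_norm_eq_of_zpow {p n : ℕ} (hp : p.Prime) {y : Ω} {u : F} (hu : u ≠ 0)
    (hpn : ∃ z : F⟮y⟯, Algebra.norm F z = u ^ p ^ n) {k : ℤ} (hk : ¬ (p : ℤ) ∣ k)
    (h : ∃ z : F⟮y⟯, Algebra.norm F z = u ^ k) : ∃ z : F⟮y⟯, Algebra.norm F z = u := by
  have hcop : IsCoprime k ((p : ℤ) ^ n) :=
    (((Nat.prime_iff_prime_int.1 hp).coprime_iff_not_dvd).2 hk).symm.pow_right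
  obtain ⟨a, b, hab⟩ := hcop
  have h1 := exists_norm_mul_eq (exists_norm_zpow_eq h a) (exists_norm_zpow_eq hpn b)
  rwa [← zpow_natCast, ← zpow_mul, ← zpow_mul, ← zpow_add₀ hu,
    show k * a + ((p ^ n : ℕ) : ℤ) * b = 1 by push_cast; linarith, zpow_one] at h1

end NormGroup

section KummerPow

variable {p : ℕ} [hp : Fact p.Prime] {Ω : Type*} [NormedField Ω] [NormedAlgebra ℚ_[p] Ω]
  [IsUltrametricDist Ω] [Algebra.IsAlgebraic ℚ_[p] Ω] [IsAlgClosed Ω]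

theorem isConjProd_pow {F : IntermediateField ℚ_[p] Ω} {n : ℕ} {ζ : Ω}
    (hζ : IsPrimitiveRoot ζ (p ^ n)) (hζF : ζ ∈ F) {y : Ω} (hy0 : y ≠ 0) (hy : y ^ p ^ n ∈ F)
    {u : Ω} (hu : u ∈ F) : ∃ k ≤ n, IsConjProd F y (u ^ p ^ k) := by
  classical
  have : NeZero (p ^ n) := ⟨pow_ne_zero _ hp.out.ne_zero⟩
  obtain ⟨k, hkn, hyk, ω, g, hω, hg, hgy⟩ := exists_kummer_generator hy0 hy
  have hk0 : 0 < p ^ k := Nat.pos_of_ne_zero (pow_ne_zero _ hp.out.ne_zero)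
  have hωF : ω ∈ F := by
    obtain ⟨i, -, hi⟩ := hζ.eq_pow_of_pow_eq_one (ξ := ω) (by
      rw [← Nat.add_sub_cancel' hkn, pow_add, pow_mul, hω.pow_eq_one, one_pow])
    rw [← hi]
    exact pow_mem hζF _
  have hgi : ∀ i : ℕ, (g ^ i) y = ω ^ i * y := by
    intro i
    induction i with
    | zero => simp
    | succ i ih => rw [galois_pow_succ_apply, ih, map_mul, map_pow, hg _ hωF, hgy]; ring
  refine ⟨k, hkn, 1, u, {0} ×ˢ Finset.range (p ^ k), fun s => g ^ s.2,
    mem_adjoinElem_of_mem _ (mem_adjoinElem_of_mem _ hu),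
    fun s _ a ha => galois_pow_fixed (hg a ha) _, fun h hh => ?_, ?_⟩
  · obtain ⟨i, hi, hiy⟩ := exists_galois_eq_pow_kummer hk0 hω hωF hyk hg hgy h hh
    refine ⟨(0, i), ⟨by simpa using hi, by simp, hiy⟩, ?_⟩
    rintro ⟨a, j⟩ ⟨hs, -, hj⟩
    simp only [Finset.mem_product, Finset.mem_singleton, Finset.mem_range] at hs
    rw [hiy, hgi] at hj
    simp only [hgi] at hj
    rw [hs.1, hω.pow_inj hs.2 hi (mul_right_cancel₀ hy0 hj).symm]
  · rw [Finset.prod_congr rfl fun s _ => galois_pow_fixed (hg u hu) s.2]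
    simp

end KummerPow

section LeadingTerm

variable {p : ℕ} [hp : Fact p.Prime] {Ω : Type*} [NormedField Ω] [NormedAlgebra ℚ_[p] Ω]
  [IsUltrametricDist Ω]

theorem norm_pow_sub_pow_lt {x y : Ω} (hx : ‖x‖ ≤ 1) (hy : ‖y‖ ≤ 1) (h : ‖x - y‖ < 1) (i : ℕ) :
    ‖x ^ i - y ^ i‖ < 1 := by
  induction i with
  | zero => simp
  | succ i ih =>
    have : x ^ (i + 1) - y ^ (i + 1) = x ^ i * (x - y) + (x ^ i - y ^ i) * y := by ring
    rw [this]
    refine norm_add_lt_of_lt ?_ ?_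
    · rw [norm_mul, norm_pow]
      exact (mul_le_of_le_one_left (norm_nonneg _) (pow_le_one₀ (norm_nonneg _) hx)).trans_lt h
    · rw [norm_mul]
      exact (mul_le_of_le_one_right (norm_nonneg _) hy).trans_lt ih

/-- If `σ` multiplies the uniformizer `ϖ` by `c` to first order, it raises `1 + τϖ^g + …` to the
power `c ^ g` to first order. -/
theorem norm_galois_sub_pow_lt {σ : Gal(Ω/ℚ_[p])} (hσn : ∀ x, ‖σ x‖ = ‖x‖) {ϖ κ τ u : Ω} {c g : ℕ}
    (hg : g ≠ 0) (hϖ0 : 0 < ‖ϖ‖) (hϖ1 : ‖ϖ‖ < 1) (hc1 : ‖(c : Ω)‖ ≤ 1) (hκ : ‖κ - c‖ < 1)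
    (hσϖ : σ ϖ = ϖ * κ) (hτ : ‖τ‖ ≤ 1) (hστ : σ τ = τ) (hu : ‖u - 1 - τ * ϖ ^ g‖ < ‖ϖ‖ ^ g) :
    ‖σ u - u ^ c ^ g‖ < ‖ϖ‖ ^ g := by
  have hκ1 : ‖κ‖ ≤ 1 := by
    have := norm_add_le_of_le_of_le hκ.le hc1
    rwa [sub_add_cancel] at this
  set a := u - 1 with ha
  set r := a - τ * ϖ ^ g with hr
  have hrg : ‖r‖ < ‖ϖ‖ ^ g := hu
  have hag : ‖a‖ ≤ ‖ϖ‖ ^ g := by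
    have h1 : a = r + τ * ϖ ^ g := by rw [hr]; ring
    rw [h1]
    refine norm_add_le_of_le_of_le hrg.le ?_
    rw [norm_mul, norm_pow]
    exact mul_le_of_le_one_left (by positivity) hτ
  have hg1 : ‖ϖ‖ ^ g < 1 := pow_lt_one₀ hϖ0.le hϖ1 hg
  have hpow : ‖u ^ c ^ g - (1 + (c : Ω) ^ g * a)‖ < ‖ϖ‖ ^ g := by
    have h1 := norm_prod_one_add_sub_le (Finset.range (c ^ g)) (fun _ => a) hg1.le (by positivity)
      (fun _ _ => hag)
    rw [Finset.prod_const, Finset.sum_const, Finset.card_range, nsmul_eq_mul, Nat.cast_pow,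
      show 1 + a = u by rw [ha]; ring] at h1
    refine h1.trans_lt ?_
    rw [sq]
    exact mul_lt_of_lt_one_right (by positivity) hg1
  have hid : σ u - u ^ c ^ g = τ * ϖ ^ g * (κ ^ g - (c : Ω) ^ g) + (σ r - (c : Ω) ^ g * r) -
      (u ^ c ^ g - (1 + (c : Ω) ^ g * a)) := by
    have h1 : u = 1 + τ * ϖ ^ g + r := by rw [hr, ha]; ring
    have h2 : σ u = 1 + τ * (ϖ * κ) ^ g + σ r := by
      conv_lhs => rw [h1]
      rw [map_add, map_add, map_one, map_mul, hστ, map_pow, hσϖ]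
    have h3 : a = τ * ϖ ^ g + r := by rw [hr]; ring
    rw [h2, h3]
    ring
  rw [hid]
  refine norm_sub_lt_of_lt (norm_add_lt_of_lt ?_ (norm_sub_lt_of_lt ?_ ?_)) hpow
  · rw [norm_mul, norm_mul, norm_pow]
    calc ‖τ‖ * ‖ϖ‖ ^ g * ‖κ ^ g - (c : Ω) ^ g‖ ≤ 1 * ‖ϖ‖ ^ g * ‖κ ^ g - (c : Ω) ^ g‖ := by gcongr
      _ < ‖ϖ‖ ^ g := by
        rw [one_mul]
        exact mul_lt_of_lt_one_right (by positivity) (norm_pow_sub_pow_lt hκ1 hc1 hκ g)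
  · rwa [hσn]
  · rw [norm_mul, norm_pow]
    exact (mul_le_of_le_one_left (norm_nonneg _) (pow_le_one₀ (norm_nonneg _) hc1)).trans_lt hrg

end LeadingTerm

section ConductorStep

variable {p : ℕ} [hp : Fact p.Prime] {Ω : Type*} [NormedField Ω] [NormedAlgebra ℚ_[p] Ω]
  [IsUltrametricDist Ω] [Algebra.IsAlgebraic ℚ_[p] Ω] [IsAlgClosed Ω]
  {F : Type*} [Field F] [Algebra ℚ_[p] F] [Algebra F Ω] [IsScalarTower ℚ_[p] F Ω]

theorem conductor_pow_modEq (hp2 : Odd p) {n : ℕ} (hn : n ≠ 0) {ζ : F}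
    (hζ : IsPrimitiveRoot ζ (p ^ n)) (v : AddValuation F (WithTop ℤ)) {D : ℕ} (hD : 0 < D)
    (hv1 : v (1 - ζ) = (1 : WithTop ℤ)) (hvp : v (p : F) = ((D : ℤ) : WithTop ℤ))
    {σ : Gal(Ω/ℚ_[p])} {s : F → F} (hs : ∀ a, algebraMap F Ω (s a) = σ (algebraMap F Ω a))
    (hσW : ∀ τ ∈ tameRoots p Ω, σ τ = τ) {c e m : ℕ} (hsζ : s ζ = ζ ^ c) (hc : ¬ p ∣ c)
    (hme : m * e ≡ c [MOD p ^ n]) {x w : F} (hx : x ≠ 0) (hsx : s x = x ^ e * w ^ p ^ n) {y : Ω}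
    (hy : y ^ p ^ n = algebraMap F Ω x) {f : ℕ}
    (hmem : ∀ u : F, v u = 0 → ((f : ℤ) : WithTop ℤ) ≤ v (u - 1) →
      ∃ z : F⟮y⟯, Algebra.norm F z = u)
    (hnot : ¬ ∀ u : F, v u = 0 → (((f - 1 : ℕ) : ℤ) : WithTop ℤ) ≤ v (u - 1) →
      ∃ z : F⟮y⟯, Algebra.norm F z = u) :
    c ^ (f - 1) ≡ m [ZMOD p] := by
  have hpn0 : p ^ n ≠ 0 := pow_ne_zero _ hp.out.ne_zero
  obtain ⟨hϖ0, hϖ1, hval⟩ := norm_eq_zpow_of_addValuation Ω v hD hvp hv1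
  set ι := algebraMap F Ω with hι
  set ϖ := ι (1 - ζ) with hϖ
  have hval' : ∀ {x : F} {k : ℤ}, x ≠ 0 → ‖ι x‖ = ‖ϖ‖ ^ k → v x = k := fun {x k} hx0 h => by
    obtain ⟨a, ha⟩ := v.exists_eq_coe hx0
    rw [hval ha] at h
    rw [ha, zpow_right_injective₀ hϖ0 hϖ1.ne h]
  let F₀ : IntermediateField ℚ_[p] Ω := (IsScalarTower.toAlgHom ℚ_[p] F Ω).fieldRange
  have hF₀ : ∀ a, a ∈ F₀ ↔ ∃ x : F, ι x = a := fun a => Iff.rfl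
  have hιF₀ : ∀ x, ι x ∈ F₀ := fun x => ⟨x, rfl⟩
  have hdisc : IsDiscreteSubfield p F₀ := by
    refine ⟨D, hD, fun a ha ha0 => ?_⟩
    obtain ⟨b, rfl⟩ := (hF₀ a).1 ha
    obtain ⟨k, hk⟩ := v.exists_eq_coe (x := b) (by rintro rfl; simp at ha0)
    refine ⟨k, ?_⟩
    rw [hval hk, ← map_natCast ι, hval hvp, ← zpow_natCast, ← zpow_mul, ← zpow_mul, mul_comm]
  have hζ' : IsPrimitiveRoot (ι ζ) (p ^ n) := hζ.map_of_injective ι.injective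
  have hy0 : y ≠ 0 := by
    rintro rfl
    rw [zero_pow hpn0] at hy
    exact hx (ι.injective (by rw [← hy, map_zero]))
  have hpow : ∀ u : F, ∃ z : F⟮y⟯, Algebra.norm F z = u ^ p ^ n := fun u => by
    obtain ⟨k, hkn, hk⟩ := isConjProd_pow hζ' (hιF₀ ζ) hy0 (hy ▸ hιF₀ x) (hιF₀ u)
    rw [← map_pow] at hk
    have := exists_norm_zpow_eq (exists_norm_eq_of_isConjProd hF₀ hk) ((p ^ (n - k) : ℕ) : ℤ)
    rwa [zpow_natCast, ← pow_mul, ← pow_add, Nat.add_sub_cancel' hkn] at this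
  have hroot : ∀ {u : F} {k : ℤ}, u ≠ 0 → ¬ (p : ℤ) ∣ k →
      (∃ z : F⟮y⟯, Algebra.norm F z = u ^ k) → ∃ z : F⟮y⟯, Algebra.norm F z = u :=
    fun hu hk h => exists_norm_eq_of_zpow hp.out hu (hpow _) hk h
  have hclose : ∀ u : F, ‖ι u - 1‖ < ‖ϖ‖ ^ (f - 1) → ∃ z : F⟮y⟯, Algebra.norm F z = u := by
    intro u hu
    have hu1 : ‖ι u‖ = 1 :=
      norm_eq_one_of_norm_sub_lt (hu.trans_le (pow_le_one₀ hϖ0.le hϖ1.le))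
    refine hmem u (hval' (k := 0) (by rintro rfl; simp at hu1) (by rw [hu1, zpow_zero])) ?_
    rcases eq_or_ne (u - 1) 0 with h0 | h0
    · rw [h0, v.map_zero]; exact le_top
    obtain ⟨k, hk⟩ := v.exists_eq_coe h0
    rw [← map_one ι, ← map_sub, hval hk, ← zpow_natCast,
      zpow_lt_zpow_iff_right_of_lt_one₀ hϖ0 hϖ1] at hu
    rw [hk, WithTop.coe_le_coe]
    omega
  push Not at hnot
  obtain ⟨u, hu0, hu1, huN⟩ := hnot
  have hun : ‖ι u‖ = 1 := by rw [hval (k := 0) hu0, zpow_zero]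
  have hune : u ≠ 0 := by rintro rfl; simp at hun
  have huN' : ¬ ∃ z : F⟮y⟯, Algebra.norm F z = u := by push Not; exact huN
  have hule : ‖ι u - 1‖ = ‖ϖ‖ ^ (f - 1) := by
    refine le_antisymm ?_ (not_lt.1 fun h => huN' (hclose u h))
    rcases eq_or_ne (u - 1) 0 with h0 | h0
    · rw [← map_one ι, ← map_sub, h0, map_zero, norm_zero]; positivity
    obtain ⟨k, hk⟩ := v.exists_eq_coe h0
    rw [hk, WithTop.coe_le_coe] at hu1
    rw [← map_one ι, ← map_sub, hval hk, ← zpow_natCast]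
    exact zpow_le_zpow_right_of_le_one₀ hϖ0 hϖ1.le hu1
  rcases Nat.eq_zero_or_pos (f - 1) with hf1 | hf1
  · obtain ⟨t, ht, htu⟩ := exists_norm_pow_sub_one_lt (p := p) hun
    refine absurd (hroot hune (k := t) (by exact_mod_cast ht) ?_) huN'
    rw [zpow_natCast]
    exact hclose _ (by rwa [map_pow, hf1, pow_zero])
  obtain ⟨τ, hτ, hτu⟩ := exists_tameRoots_mul_norm_sub_lt (p := p) (u := ι u - 1)
    (a := ϖ ^ (f - 1)) (norm_pos_iff.1 (by rw [hule]; positivity)) (by rw [hule, norm_pow])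
  rw [norm_pow] at hτu
  have hϖζ : ϖ = 1 - ι ζ := by rw [hϖ, map_sub, map_one]
  have hζn : ‖ι ζ‖ ≤ 1 := by
    have h1 : ‖ι ζ‖ ^ p ^ n = 1 := by rw [← norm_pow, hζ'.pow_eq_one, norm_one]
    exact ((pow_eq_one_iff_of_nonneg (norm_nonneg _) hpn0).1 h1).le
  have hσϖ : σ ϖ = ϖ * ∑ i ∈ Finset.range c, ι ζ ^ i := by
    rw [hϖζ, map_sub, map_one, ← hs, hsζ, map_pow, mul_neg_geom_sum]
  have hκ : ‖∑ i ∈ Finset.range c, ι ζ ^ i - (c : Ω)‖ < 1 := by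
    have : ∑ i ∈ Finset.range c, ι ζ ^ i - (c : Ω) = ∑ i ∈ Finset.range c, (ι ζ ^ i - 1) := by
      rw [Finset.sum_sub_distrib]; simp
    rw [this]
    refine (IsUltrametricDist.norm_sum_le_of_forall_le_of_nonneg hϖ0.le fun i _ => ?_).trans_lt hϖ1
    rw [hϖζ, norm_sub_rev 1]
    exact norm_pow_sub_one_le hζn i
  have hlead := norm_galois_sub_pow_lt (fun x => norm_galois_apply σ x) hf1.ne' hϖ0 hϖ1
    (norm_natCast_of_not_dvd (Ω := Ω) p hc).le hκ hσϖ (tameRoots_norm hτ).le (hσW τ hτ) hτu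
  set j := c ^ (f - 1) with hj
  have hNj : ∃ z : F⟮y⟯, Algebra.norm F z = s u / u ^ j := by
    refine hclose _ ?_
    rw [map_div₀, map_pow, hs, div_sub_one (pow_ne_zero _ (norm_pos_iff.1 (by rw [hun]; simp))),
      norm_div, norm_pow, hun, one_pow, div_one]
    exact hlead
  obtain ⟨N, hN, hNc⟩ := isConjProd_twist hp2 hdisc hn hζ' (hιF₀ ζ)
    (fun a ha => by obtain ⟨b, rfl⟩ := (hF₀ a).1 ha; exact ⟨s b, hs b⟩) hσW
    (by rw [← hs, hsζ, map_pow]) hc hme hy0 (hy ▸ hιF₀ x) (hιF₀ w)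
    (by rw [hy, ← hs, hsx, map_mul, map_pow, map_pow]) (hιF₀ u)
    (by rw [hule]; exact pow_lt_one₀ hϖ0.le hϖ1 hf1.ne')
  rw [← hs, ← map_pow, ← map_div₀, ← map_pow] at hNc
  have hNm := exists_norm_eq_of_isConjProd hF₀ hNc
  have hsu0 : s u ≠ 0 := fun h => hune (by
    have := hs u
    rw [h, map_zero, eq_comm, _root_.map_eq_zero] at this
    exact ι.injective (by rw [this, map_zero]))
  by_contra hne
  have hdvd : ¬ (p : ℤ) ∣ (j - m : ℤ) * N := by
    intro h
    rcases (Nat.prime_iff_prime_int.1 hp.out).dvd_or_dvd h with h | h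
    · have h1 := (Int.modEq_iff_dvd.2 h).symm
      rw [hj, Nat.cast_pow] at h1
      exact hne h1
    · exact hN (by exact_mod_cast h)
  refine huN' (hroot hune hdvd ?_)
  have h1 := exists_norm_mul_eq hNm (exists_norm_zpow_eq hNj (-N))
  convert h1 using 3
  rw [zpow_mul, zpow_sub₀ hune, zpow_natCast, zpow_natCast, zpow_natCast, zpow_neg, zpow_natCast,
    ← inv_pow, ← mul_pow]
  congr 1
  field_simp

end ConductorStep

section Conductor

variable {p : ℕ} [hp : Fact p.Prime] {Ω : Type*} [NormedField Ω] [NormedAlgebra ℚ_[p] Ω]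
  [IsUltrametricDist Ω] [Algebra.IsAlgebraic ℚ_[p] Ω] [IsAlgClosed Ω]

/-- Twists of a lift to `ℤ/p^n` of a generator of `(ℤ/p)ˣ` detect congruences modulo `p - 1`. -/
theorem exists_unit_pow_modEq {n : ℕ} (hn : n ≠ 0) : ∃ (c : ℕ) (u : (ZMod (p ^ n))ˣ), ¬ p ∣ c ∧
    (u : ZMod (p ^ n)).val = c ∧
    (∀ k : ℤ, (((u ^ (1 - k) : (ZMod (p ^ n))ˣ) : ZMod (p ^ n))).val *
      (((u ^ k : (ZMod (p ^ n))ˣ) : ZMod (p ^ n))).val ≡ c [MOD p ^ n]) ∧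
    ∀ (i : ℕ) (k : ℤ), (c : ℤ) ^ i ≡ (((u ^ k : (ZMod (p ^ n))ˣ) : ZMod (p ^ n))).val [ZMOD p] →
      (i : ℤ) ≡ k [ZMOD (p : ℤ) - 1] := by
  have hpn0 : p ^ n ≠ 0 := pow_ne_zero _ hp.out.ne_zero
  have : NeZero (p ^ n) := ⟨hpn0⟩
  obtain ⟨g, hg⟩ := IsCyclic.exists_generator (α := (ZMod p)ˣ)
  set c := (g : ZMod p).val with hc
  have hcg : (c : ZMod p) = g := ZMod.natCast_zmod_val _
  have hcp : ¬ p ∣ c := by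
    rw [← ZMod.natCast_eq_zero_iff, hcg]
    exact g.ne_zero
  have hcop : c.Coprime (p ^ n) :=
    (((Nat.Prime.coprime_iff_not_dvd hp.out).2 hcp).symm).pow_right n
  set u := ZMod.unitOfCoprime c hcop with hu
  have hcn : c < p ^ n := (ZMod.val_lt _).trans_le (Nat.le_self_pow hn p)
  refine ⟨c, u, hcp, ?_, fun k => ?_, fun i k h => ?_⟩
  · rw [hu, ZMod.coe_unitOfCoprime, ZMod.val_natCast_of_lt hcn]
  · rw [← ZMod.natCast_eq_natCast_iff, Nat.cast_mul, ZMod.natCast_zmod_val, ZMod.natCast_zmod_val,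
      ← Units.val_mul, ← zpow_add, sub_add_cancel, zpow_one, hu, ZMod.coe_unitOfCoprime]
  · let π := ZMod.castHom (dvd_pow_self p hn) (ZMod p)
    have hπ : Units.map (π : ZMod (p ^ n) →* ZMod p) u = g := by
      ext
      rw [Units.coe_map, hu, ZMod.coe_unitOfCoprime, ← hcg]
      exact map_natCast π c
    have hval : ((((u ^ k : (ZMod (p ^ n))ˣ) : ZMod (p ^ n))).val : ZMod p) =
        ((g ^ k : (ZMod p)ˣ) : ZMod p) := by
      rw [← hπ, ← map_zpow, Units.coe_map, ZMod.natCast_val]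
      rfl
    have h1 : g ^ (i : ℤ) = g ^ k := by
      ext
      rw [← ZMod.intCast_eq_intCast_iff] at h
      push_cast at h
      rw [← hval, ← h, zpow_natCast, Units.val_pow_eq_pow_val, hcg]
    have hord : (orderOf g : ℤ) = (p : ℤ) - 1 := by
      rw [orderOf_eq_card_of_forall_mem_zpowers hg, Nat.card_eq_fintype_card, ZMod.card_units,
        Nat.cast_sub hp.out.one_le, Nat.cast_one]
    rwa [zpow_eq_zpow_iff_modEq, hord] at h1

theorem sInf_norm_level_modEq (hp2 : Odd p) {n : ℕ} (hn : n ≠ 0) {E F : Type} [Field E] [Field F]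
    [Algebra ℚ_[p] E] [Algebra E F] [Algebra ℚ_[p] F] [IsScalarTower ℚ_[p] E F]
    [Algebra F Ω] [IsScalarTower ℚ_[p] F Ω] [Algebra E Ω] [IsScalarTower E F Ω]
    [IsScalarTower ℚ_[p] E Ω] [Algebra.IsIntegral E F] {ζ : F} (hζ : IsPrimitiveRoot ζ (p ^ n)) (hF : E⟮ζ⟯ = ⊤)
    (v : AddValuation F (WithTop ℤ)) (hv1 : v (1 - ζ) = (1 : WithTop ℤ))
    {D : ℕ} (hD : 0 < D) (hvp : v (p : F) = ((D : ℤ) : WithTop ℤ))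
    (hunram : ∀ x : E, x ≠ 0 → ∃ k : ℤ, v (algebraMap E F x) = ((D * k : ℤ) : WithTop ℤ))
    {r : ℤ} {x : F} (hx : memFr p n E ζ r x) {y : Ω} (hy : y ^ p ^ n = algebraMap F Ω x) :
    sInf {f : ℕ | ∀ u : F, v u = 0 → ((f : ℤ) : WithTop ℤ) ≤ v (u - 1) →
        ∃ z : F⟮y⟯, Algebra.norm F z = u} = 0 ∨
      ((sInf {f : ℕ | ∀ u : F, v u = 0 → ((f : ℤ) : WithTop ℤ) ≤ v (u - 1) →
        ∃ z : F⟮y⟯, Algebra.norm F z = u} : ℕ) : ℤ) ≡ 2 - r [ZMOD (p : ℤ) - 1] := by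
  have : NeZero (p ^ n) := ⟨pow_ne_zero _ hp.out.ne_zero⟩
  set S := {f : ℕ | ∀ u : F, v u = 0 → ((f : ℤ) : WithTop ℤ) ≤ v (u - 1) →
    ∃ z : F⟮y⟯, Algebra.norm F z = u} with hS
  refine or_iff_not_imp_left.2 fun hf => ?_
  have hne : S.Nonempty := by
    by_contra h
    rw [Set.not_nonempty_iff_eq_empty.1 h, Nat.sInf_empty] at hf
    exact hf rfl
  have hmem : sInf S ∈ S := Nat.sInf_mem hne
  have hnot : sInf S - 1 ∉ S := Nat.notMem_of_lt_sInf (by omega)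
  obtain ⟨c, u, hc, huc, hme, hdetect⟩ := exists_unit_pow_modEq (p := p) hn
  obtain ⟨hϖ0, hϖ1, hval⟩ := norm_eq_zpow_of_addValuation Ω v hD hvp hv1
  obtain ⟨σ, hσE, hσW, hσζ⟩ := exists_galois_eq_pow_of_unramified
    (K := (IsScalarTower.toAlgHom ℚ_[p] E Ω).fieldRange) (fun a ha ha0 => by
      obtain ⟨b, rfl⟩ := ha
      obtain ⟨k, hk⟩ := hunram b (by rintro rfl; exact ha0 (map_zero (algebraMap E Ω)))
      refine ⟨k, ?_⟩
      have h1 := hval hk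
      have h2 := hval hvp
      rw [map_natCast] at h2
      rw [← IsScalarTower.algebraMap_apply, zpow_mul, ← h2] at h1
      exact h1) hn (hζ.map_of_injective (algebraMap F Ω).injective) hc
  let σE : Ω ≃ₐ[E] Ω :=
    { (σ : Ω ≃+* Ω) with commutes' := fun a => hσE _ ⟨a, rfl⟩ }
  have : IsCyclotomicExtension {p ^ n} E E⟮ζ⟯ :=
    hζ.intermediateField_adjoin_isCyclotomicExtension E
  have : IsGalois E E⟮ζ⟯ := IsCyclotomicExtension.isGalois {p ^ n} E E⟮ζ⟯
  have : Normal E F := by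
    have h1 : Normal E E⟮ζ⟯ := inferInstance
    rw [hF] at h1
    exact Normal.of_algEquiv (h := h1) topEquiv
  set s := σE.restrictNormal F with hsdef
  have hs : ∀ a, algebraMap F Ω (s a) = σ (algebraMap F Ω a) := fun a =>
    σE.restrictNormal_commutes F a
  have hsζ : s ζ = ζ ^ c := (algebraMap F Ω).injective (by rw [hs, hσζ, map_pow])
  obtain ⟨w, hw⟩ := hx.2 s u (by rw [huc, hsζ])
  have hsx : s x = x ^ ((u ^ r : (ZMod (p ^ n))ˣ) : ZMod (p ^ n)).val * w ^ p ^ n := by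
    rw [← hw, mul_comm (s x), mul_inv_cancel_left₀ (pow_ne_zero _ hx.1)]
  have hmod := hdetect _ _ (conductor_pow_modEq hp2 hn hζ v hD hv1 hvp hs hσW hsζ hc (hme r) hx.1
    hsx hy hmem hnot)
  have h1 : ((sInf S : ℕ) : ℤ) = ((sInf S - 1 : ℕ) : ℤ) + 1 := by omega
  rw [h1]
  exact (hmod.add_right 1).trans (by ring_nf; rfl)

end Conductor

end ConductorHelpers

/-- For any integer `r` and any `x ∈ F^r`, the conductor `f_n(x)` of
`F(x^{1/p^n})/F` is either `0` or congruent to `2 - r` modulo `p - 1`. -/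
theorem conductor_cong_or_zero (p n : ℕ) [Fact p.Prime] (hp : Odd p) (hn : 1 ≤ n)
    (E F : Type) [Field E] [Field F] [Algebra ℚ_[p] E] [Algebra E F]
    [Algebra ℚ_[p] F] [IsScalarTower ℚ_[p] E F] [FiniteDimensional ℚ_[p] E]
    (ζ : F) (hζ : IsPrimitiveRoot ζ (p ^ n))
    (hF : IntermediateField.adjoin E {ζ} = ⊤)
    (v : AddValuation F (WithTop ℤ))
    (hv1 : v (1 - ζ) = (1 : WithTop ℤ))
    (hvp : v ((p : F)) = (((p : ℤ) ^ (n - 1) * ((p : ℤ) - 1) : ℤ) : WithTop ℤ))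
    (hunram : ∀ x : E, x ≠ 0 →
      ∃ k : ℤ, v (algebraMap E F x) = ((((p : ℤ) ^ (n - 1) * ((p : ℤ) - 1)) * k : ℤ) : WithTop ℤ))
    (r : ℤ) (x : F) (hx : memFr p n E ζ r x)
    (y : AlgebraicClosure F) (hy : y ^ (p ^ n) = algebraMap F (AlgebraicClosure F) x) :
    sInf (condSet v y) = 0 ∨
      (((sInf (condSet v y) : ℕ) : ℤ) ≡ 2 - r [ZMOD ((p : ℤ) - 1)]) := by
  have hprime : p.Prime := Fact.out
  have : FiniteDimensional E F := by
    have h1 : FiniteDimensional E (IntermediateField.adjoin E {ζ}) :=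
      IntermediateField.adjoin.finiteDimensional
        (hζ.isIntegral (pow_pos hprime.pos n)).tower_top
    rw [hF] at h1
    exact IntermediateField.topEquiv.toLinearEquiv.finiteDimensional
  have : FiniteDimensional ℚ_[p] F := FiniteDimensional.trans ℚ_[p] E F
  have : Algebra.IsAlgebraic ℚ_[p] (AlgebraicClosure F) := Algebra.IsAlgebraic.trans ℚ_[p] F _
  let : NormedField (AlgebraicClosure F) := spectralNorm.normedField ℚ_[p] (AlgebraicClosure F)
  let : NormedAlgebra ℚ_[p] (AlgebraicClosure F) :=
    spectralNorm.normedAlgebra ℚ_[p] (AlgebraicClosure F)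
  have : IsUltrametricDist (AlgebraicClosure F) :=
    IsUltrametricDist.isUltrametricDist_of_isNonarchimedean_norm isNonarchimedean_spectralNorm
  have hD : (((p ^ (n - 1) * (p - 1) : ℕ) : ℤ)) = (p : ℤ) ^ (n - 1) * ((p : ℤ) - 1) := by
    rw [Nat.cast_mul, Nat.cast_pow, Nat.cast_sub hprime.one_le, Nat.cast_one]
  exact sInf_norm_level_modEq (Ω := AlgebraicClosure F) hp (by omega) hζ hF v hv1
    (D := p ^ (n - 1) * (p - 1)) (Nat.mul_pos (pow_pos hprime.pos _) (by have := hprime.two_le; omega))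
    (by rw [hD]; exact hvp) (by rw [hD]; exact hunram) hx hy
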